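/- arXiv:1906.06757 — 2 statements merged into one kernel-verified Lean document; each statement's English description precedes it below -/
import Mathlib

section
/- Let g and ḡ be projectively equivalent metrics on U and let R_{ij} be the Ricci tensor of g. Then at every point of U the matrices g⁻¹R and L commute: (g⁻¹R)·L = L·(g⁻¹R), i.e., Σ_s R^i_s L^s_j − Σ_s L^i_s R^s_j = 0 where R^i_s := Σ_a (g⁻¹)^{ia} R_{as}. -/
open Matrix

noncomputable section

/-- Partial derivative in the `i`-th coordinate direction of a real-valued function on `ℝⁿ`. -/
def pd {n : ℕ} (i : Fin n) (f : (Fin n → ℝ) → ℝ) : (Fin n → ℝ) → ℝ :=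
  fun x => fderiv ℝ f x (Pi.single i 1)

/-- Iterated partial derivatives along a list of coordinate directions. -/
def iterPD {n : ℕ} : List (Fin n) → ((Fin n → ℝ) → ℝ) → ((Fin n → ℝ) → ℝ)
  | [], f => f
  | i :: l, f => pd i (iterPD l f)

/-- `g` is a (pseudo-Riemannian) metric on `U`: a smooth field of invertible symmetric
real `n×n` matrices. -/
structure IsMetricOn {n : ℕ} (U : Set (Fin n → ℝ))
    (g : (Fin n → ℝ) → Matrix (Fin n) (Fin n) ℝ) : Prop where
  smooth : ∀ i j : Fin n, ContDiffOn ℝ (⊤ : ℕ∞) (fun x => g x i j) U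
  symm : ∀ x ∈ U, (g x).IsSymm
  nondeg : ∀ x ∈ U, IsUnit (g x).det

/-- The Christoffel symbols `Γ^k_{ij}` of the metric `g`. -/
def Gamma {n : ℕ} (g : (Fin n → ℝ) → Matrix (Fin n) (Fin n) ℝ)
    (k i j : Fin n) (x : Fin n → ℝ) : ℝ :=
  (1/2) * ∑ ℓ, (g x)⁻¹ k ℓ *
    (pd i (fun y => g y ℓ j) x + pd j (fun y => g y ℓ i) x - pd ℓ (fun y => g y i j) x)

/-- An open interval of `ℝ` (possibly empty or unbounded): an open order-connected set. -/
def IsOpenInterval (I : Set ℝ) : Prop := IsOpen I ∧ I.OrdConnected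

/-- `γ` is a `g`-geodesic defined on the open interval `I`, with values in `U`. -/
structure IsGeodesicOn {n : ℕ} (U : Set (Fin n → ℝ))
    (g : (Fin n → ℝ) → Matrix (Fin n) (Fin n) ℝ)
    (γ : ℝ → (Fin n → ℝ)) (I : Set ℝ) : Prop where
  interval : IsOpenInterval I
  smooth : ∀ k : Fin n, ContDiffOn ℝ (⊤ : ℕ∞) (fun s => γ s k) I
  mem : ∀ t ∈ I, γ t ∈ U
  eqn : ∀ t ∈ I, ∀ k : Fin n,
    deriv (deriv fun s => γ s k) t
      + ∑ i, ∑ j, Gamma g k i j (γ t) * deriv (fun s => γ s i) t * deriv (fun s => γ s j) t = 0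

/-- `g` and `gbar` are projectively equivalent on `U`: every `g`-geodesic with nowhere
vanishing velocity becomes, after a smooth reparameterization (a diffeomorphism of open
intervals), a `gbar`-geodesic. -/
def ProjEquiv {n : ℕ} (U : Set (Fin n → ℝ))
    (g gbar : (Fin n → ℝ) → Matrix (Fin n) (Fin n) ℝ) : Prop :=
  ∀ (γ : ℝ → (Fin n → ℝ)) (I : Set ℝ), IsGeodesicOn U g γ I →
    (∀ t ∈ I, ∃ k, deriv (fun s => γ s k) t ≠ 0) →
    ∃ (φ : ℝ → ℝ) (J : Set ℝ), IsOpenInterval J ∧ ContDiffOn ℝ (⊤ : ℕ∞) φ J ∧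
      Set.InjOn φ J ∧ φ '' J = I ∧ (∀ t ∈ J, deriv φ t ≠ 0) ∧
      IsGeodesicOn U gbar (γ ∘ φ) J

/-- The (1,1)-tensor `L = |det gbar / det g|^{1/(n+1)} gbar⁻¹ g` built from `g` and `gbar`. -/
def Lfield {n : ℕ} (g gbar : (Fin n → ℝ) → Matrix (Fin n) (Fin n) ℝ)
    (x : Fin n → ℝ) : Matrix (Fin n) (Fin n) ℝ :=
  |(gbar x).det / (g x).det| ^ ((1 : ℝ)/((n : ℝ)+1)) • ((gbar x)⁻¹ * g x)

/-- The family `S(t) = adjugate (t·Id − L)`. -/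
def Sfield {n : ℕ} (g gbar : (Fin n → ℝ) → Matrix (Fin n) (Fin n) ℝ) (t : ℝ)
    (x : Fin n → ℝ) : Matrix (Fin n) (Fin n) ℝ :=
  (t • (1 : Matrix (Fin n) (Fin n) ℝ) - Lfield g gbar x).adjugate

/-- The second order operator associated (via Carter's quantization) to a field `A` of
symmetric matrices: `Â f = |det g|^{-1/2} ∑ᵢⱼ ∂ᵢ(|det g|^{1/2} Aⁱʲ ∂ⱼ f)`. -/
def assocOp {n : ℕ} (g A : (Fin n → ℝ) → Matrix (Fin n) (Fin n) ℝ)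
    (f : (Fin n → ℝ) → ℝ) (x : Fin n → ℝ) : ℝ :=
  |(g x).det| ^ (-(1 : ℝ)/2) * ∑ i, ∑ j,
    pd i (fun y => |(g y).det| ^ ((1 : ℝ)/2) * A y i j * pd j f y) x

/-- The operator `K̂^{(t)}`, associated to `A = S(t)·g⁻¹`. -/
def Khat {n : ℕ} (g gbar : (Fin n → ℝ) → Matrix (Fin n) (Fin n) ℝ) (t : ℝ)
    (f : (Fin n → ℝ) → ℝ) (x : Fin n → ℝ) : ℝ :=
  assocOp g (fun y => Sfield g gbar t y * (g y)⁻¹) f x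

/-- The Beltrami-Laplace operator of `g`, associated to `A = g⁻¹`. -/
def LaplaceOp {n : ℕ} (g : (Fin n → ℝ) → Matrix (Fin n) (Fin n) ℝ)
    (f : (Fin n → ℝ) → ℝ) (x : Fin n → ℝ) : ℝ :=
  assocOp g (fun y => (g y)⁻¹) f x

/-- `K` is a Killing tensor for `g` on `U`: the associated quadratic function is constant
along every `g`-geodesic. -/
def IsKillingTensorOn {n : ℕ} (U : Set (Fin n → ℝ))
    (g K : (Fin n → ℝ) → Matrix (Fin n) (Fin n) ℝ) : Prop :=
  ∀ (γ : ℝ → (Fin n → ℝ)) (I : Set ℝ), IsGeodesicOn U g γ I →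
    ∀ τ₁ ∈ I, ∀ τ₂ ∈ I,
      (∑ i, ∑ j, deriv (fun s => γ s i) τ₁ * K (γ τ₁) i j * deriv (fun s => γ s j) τ₁) =
      (∑ i, ∑ j, deriv (fun s => γ s i) τ₂ * K (γ τ₂) i j * deriv (fun s => γ s j) τ₂)

/-- The covariant derivative `∇_k T_{ij}` of a (0,2)-tensor field `T`. -/
def covDeriv2 {n : ℕ} (g T : (Fin n → ℝ) → Matrix (Fin n) (Fin n) ℝ)
    (k i j : Fin n) (x : Fin n → ℝ) : ℝ :=
  pd k (fun y => T y i j) x - (∑ s, Gamma g s k i x * T x s j)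
    - ∑ s, Gamma g s k j x * T x i s

/-- The Ricci curvature tensor `R_{ij}` of `g`. -/
def Ricci {n : ℕ} (g : (Fin n → ℝ) → Matrix (Fin n) (Fin n) ℝ)
    (i j : Fin n) (x : Fin n → ℝ) : ℝ :=
  (∑ ℓ, pd ℓ (fun y => Gamma g ℓ i j y) x) - (∑ ℓ, pd i (fun y => Gamma g ℓ ℓ j y) x)
    + ∑ ℓ, ∑ s, (Gamma g ℓ ℓ s x * Gamma g s i j x - Gamma g ℓ i s x * Gamma g s ℓ j x)

/-- A function vanishes up to order `k` at `p`: it and all its partial derivatives of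
order `≤ k` vanish at `p`. -/
def VanishUpTo {n : ℕ} (k : ℕ) (f : (Fin n → ℝ) → ℝ) (p : Fin n → ℝ) : Prop :=
  ∀ l : List (Fin n), l.length ≤ k → iterPD l f p = 0


/-- The plain (flat) second order operator `Â f = ∑ᵢⱼ ∂ᵢ(Aⁱʲ ∂ⱼ f)` associated to a
matrix field `A`. -/
def opPlain {n : ℕ} (A : (Fin n → ℝ) → Matrix (Fin n) (Fin n) ℝ)
    (f : (Fin n → ℝ) → ℝ) (x : Fin n → ℝ) : ℝ :=
  ∑ i, ∑ j, pd i (fun y => A y i j * pd j f y) x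

end

open scoped ContDiff

section PartialDerivatives

variable {n : ℕ} {x : Fin n → ℝ} {U : Set (Fin n → ℝ)}

lemma pd_congr {f h : (Fin n → ℝ) → ℝ} (e : f =ᶠ[nhds x] h) (k : Fin n) :
    pd k f x = pd k h x := by
  simp only [pd, e.fderiv_eq]

lemma pd_mul {f h : (Fin n → ℝ) → ℝ} (hf : DifferentiableAt ℝ f x)
    (hh : DifferentiableAt ℝ h x) (k : Fin n) :
    pd k (fun y => f y * h y) x = pd k f x * h x + f x * pd k h x := by
  simp only [pd, fderiv_fun_mul hf hh]
  simp
  ring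

lemma pd_add {f h : (Fin n → ℝ) → ℝ} (hf : DifferentiableAt ℝ f x)
    (hh : DifferentiableAt ℝ h x) (k : Fin n) :
    pd k (fun y => f y + h y) x = pd k f x + pd k h x := by
  simp [pd, fderiv_fun_add hf hh]

lemma pd_neg (f : (Fin n → ℝ) → ℝ) (k : Fin n) :
    pd k (fun y => -f y) x = -pd k f x := by
  simp [pd]

lemma pd_const (c : ℝ) (k : Fin n) : pd k (fun _ => c) x = 0 := by
  simp [pd]

lemma pd_sum {ι : Type*} {s : Finset ι} {f : ι → (Fin n → ℝ) → ℝ}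
    (hf : ∀ i ∈ s, DifferentiableAt ℝ (f i) x) (k : Fin n) :
    pd k (fun y => ∑ i ∈ s, f i y) x = ∑ i ∈ s, pd k (f i) x := by
  simp [pd, fderiv_fun_sum hf]

lemma pd_comm {f : (Fin n → ℝ) → ℝ} (hf : ContDiffAt ℝ ∞ f x) (k l : Fin n) :
    pd l (pd k f) x = pd k (pd l f) x := by
  have hd : DifferentiableAt ℝ (fderiv ℝ f) x :=
    (hf.fderiv_right (m := 1) (by norm_cast)).differentiableAt (by norm_num)
  have h := hf.isSymmSndFDerivAt (by simp; norm_cast)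
  have key (a b : Fin n) :
      pd a (pd b f) x = fderiv ℝ (fderiv ℝ f) x (Pi.single a 1) (Pi.single b 1) := by
    change fderiv ℝ (fun y => fderiv ℝ f y (Pi.single b 1)) x (Pi.single a 1) = _
    rw [fderiv_clm_apply hd (by fun_prop)]
    simp
  rw [key, key]
  exact h _ _

lemma contDiffOn_pd (hU : IsOpen U) {f : (Fin n → ℝ) → ℝ} (hf : ContDiffOn ℝ ∞ f U)
    (k : Fin n) : ContDiffOn ℝ ∞ (pd k f) U :=
  (hf.fderiv_of_isOpen hU (by norm_cast)).clm_apply contDiffOn_const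

end PartialDerivatives

section MatrixFields

variable {n : ℕ} {x : Fin n → ℝ} {U : Set (Fin n → ℝ)}

/-- Entrywise partial derivative of a matrix field. -/
noncomputable def pdMatrix (k : Fin n) (F : (Fin n → ℝ) → Matrix (Fin n) (Fin n) ℝ)
    (x : Fin n → ℝ) : Matrix (Fin n) (Fin n) ℝ :=
  Matrix.of fun i j => pd k (fun y => F y i j) x

/-- Entrywise differentiability of a matrix field at a point. -/
def MatrixDifferentiableAt (F : (Fin n → ℝ) → Matrix (Fin n) (Fin n) ℝ) (x : Fin n → ℝ) : Prop :=
  ∀ i j, DifferentiableAt ℝ (fun y => F y i j) x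

/-- Entrywise smoothness of a matrix field on a set. -/
def MatrixSmoothOn (F : (Fin n → ℝ) → Matrix (Fin n) (Fin n) ℝ) (U : Set (Fin n → ℝ)) : Prop :=
  ∀ i j, ContDiffOn ℝ ∞ (fun y => F y i j) U

variable {F H : (Fin n → ℝ) → Matrix (Fin n) (Fin n) ℝ}

lemma MatrixSmoothOn.differentiableAt (hF : MatrixSmoothOn F U) (hU : IsOpen U) (hx : x ∈ U) :
    MatrixDifferentiableAt F x := fun i j =>
  ((hF i j).contDiffAt (hU.mem_nhds hx)).differentiableAt (by simp)

lemma MatrixDifferentiableAt.mul (hF : MatrixDifferentiableAt F x)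
    (hH : MatrixDifferentiableAt H x) : MatrixDifferentiableAt (fun y => F y * H y) x :=
  fun i j => by
    simp only [Matrix.mul_apply]
    exact DifferentiableAt.fun_sum fun s _ => (hF i s).mul (hH s j)

lemma MatrixDifferentiableAt.add (hF : MatrixDifferentiableAt F x)
    (hH : MatrixDifferentiableAt H x) : MatrixDifferentiableAt (fun y => F y + H y) x :=
  fun i j => (hF i j).add (hH i j)

lemma MatrixDifferentiableAt.neg (hF : MatrixDifferentiableAt F x) :
    MatrixDifferentiableAt (fun y => -F y) x :=
  fun i j => (hF i j).neg

lemma MatrixDifferentiableAt.transpose (hF : MatrixDifferentiableAt F x) :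
    MatrixDifferentiableAt (fun y => (F y)ᵀ) x :=
  fun i j => hF j i

lemma MatrixDifferentiableAt.vecMulVec {u v : (Fin n → ℝ) → Fin n → ℝ}
    (hu : ∀ i, DifferentiableAt ℝ (fun y => u y i) x)
    (hv : ∀ i, DifferentiableAt ℝ (fun y => v y i) x) :
    MatrixDifferentiableAt (fun y => vecMulVec (u y) (v y)) x := fun i j => by
  simpa only [vecMulVec_apply] using (hu i).fun_mul (hv j)

lemma pdMatrix_congr (e : F =ᶠ[nhds x] H) (k : Fin n) : pdMatrix k F x = pdMatrix k H x := by
  ext i j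
  exact pd_congr (e.fun_comp fun A => A i j) k

lemma pdMatrix_mul (hF : MatrixDifferentiableAt F x) (hH : MatrixDifferentiableAt H x)
    (k : Fin n) :
    pdMatrix k (fun y => F y * H y) x = pdMatrix k F x * H x + F x * pdMatrix k H x := by
  ext i j
  simp only [pdMatrix, Matrix.mul_apply, Matrix.add_apply, Matrix.of_apply]
  rw [pd_sum (fun s _ => (hF i s).fun_mul (hH s j)), ← Finset.sum_add_distrib]
  exact Finset.sum_congr rfl fun s _ => pd_mul (hF i s) (hH s j) k

lemma pdMatrix_add (hF : MatrixDifferentiableAt F x) (hH : MatrixDifferentiableAt H x)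
    (k : Fin n) : pdMatrix k (fun y => F y + H y) x = pdMatrix k F x + pdMatrix k H x := by
  ext i j
  exact pd_add (hF i j) (hH i j) k

lemma pdMatrix_neg (k : Fin n) : pdMatrix k (fun y => -F y) x = -pdMatrix k F x := by
  ext i j
  exact pd_neg _ k

lemma pdMatrix_const (C : Matrix (Fin n) (Fin n) ℝ) (k : Fin n) :
    pdMatrix k (fun _ => C) x = 0 := by
  ext i j
  exact pd_const _ k

lemma pdMatrix_transpose (k : Fin n) :
    pdMatrix k (fun y => (F y)ᵀ) x = (pdMatrix k F x)ᵀ := rfl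

lemma pdMatrix_smul {w : (Fin n → ℝ) → ℝ} (hw : DifferentiableAt ℝ w x)
    (hF : MatrixDifferentiableAt F x) (k : Fin n) :
    pdMatrix k (fun y => w y • F y) x = pd k w x • F x + w x • pdMatrix k F x := by
  ext i j
  exact pd_mul hw (hF i j) k

lemma pdMatrix_vecMulVec_const {u : (Fin n → ℝ) → Fin n → ℝ} (c : Fin n → ℝ)
    (hu : ∀ i, DifferentiableAt ℝ (fun y => u y i) x) (k : Fin n) :
    pdMatrix k (fun y => vecMulVec (u y) c) x =
      vecMulVec (fun i => pd k (fun y => u y i) x) c := by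
  ext i j
  simp only [pdMatrix, vecMulVec_apply, Matrix.of_apply]
  rw [pd_mul (hu i) (differentiableAt_const _), pd_const]
  ring

lemma pdMatrix_comm (hF : MatrixSmoothOn F U) (hU : IsOpen U) (hx : x ∈ U) (k l : Fin n) :
    pdMatrix l (pdMatrix k F) x = pdMatrix k (pdMatrix l F) x := by
  ext i j
  exact pd_comm ((hF i j).contDiffAt (hU.mem_nhds hx)) k l

/-- The curvature `∂ₗGₖ - ∂ₖGₗ + [Gₗ, Gₖ]` of a connection with coefficient matrices `Gₖ`. -/
noncomputable def connCurvature (G : Fin n → (Fin n → ℝ) → Matrix (Fin n) (Fin n) ℝ) (l k : Fin n)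
    (x : Fin n → ℝ) : Matrix (Fin n) (Fin n) ℝ :=
  pdMatrix l (G k) x - pdMatrix k (G l) x + G l x * G k x - G k x * G l x

/-- Integrability condition of the linear system
`∇ₖ Bⁱʲ = lamⁱ δʲₖ + lamʲ δⁱₖ` for a torsion-free connection. -/
lemma curvature_identity (hU : IsOpen U) (hx : x ∈ U)
    {G : Fin n → (Fin n → ℝ) → Matrix (Fin n) (Fin n) ℝ}
    (hG : ∀ k, MatrixSmoothOn (G k) U)
    (hsymm : ∀ k l i, G k x i l = G l x i k)
    {B : (Fin n → ℝ) → Matrix (Fin n) (Fin n) ℝ} (hB : MatrixSmoothOn B U)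
    {lam : (Fin n → ℝ) → Fin n → ℝ} (hlam : ∀ i, ContDiffOn ℝ ∞ (fun y => lam y i) U)
    (hpd : ∀ y ∈ U, ∀ k, pdMatrix k B y = -(G k y * B y) + -(B y * (G k y)ᵀ) +
      (vecMulVec (lam y) (Pi.single k 1) + (vecMulVec (lam y) (Pi.single k 1))ᵀ)) :
    let M := fun l => (fun i => pd l (fun y => lam y i) x) + G l x *ᵥ lam x
    ∀ l k, connCurvature G l k x * B x + B x * (connCurvature G l k x)ᵀ =
      vecMulVec (M l) (Pi.single k 1) + (vecMulVec (M l) (Pi.single k 1))ᵀ -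
        (vecMulVec (M k) (Pi.single l 1) + (vecMulVec (M k) (Pi.single l 1))ᵀ) := by
  have dG k := (hG k).differentiableAt hU hx
  have dB := hB.differentiableAt hU hx
  have dlam i : DifferentiableAt ℝ (fun y => lam y i) x :=
    ((hlam i).contDiffAt (hU.mem_nhds hx)).differentiableAt (by simp)
  have dE (k : Fin n) : MatrixDifferentiableAt
      (fun y => vecMulVec (lam y) (Pi.single k 1)) x :=
    .vecMulVec dlam fun _ => differentiableAt_const _
  have snd (l k : Fin n) : pdMatrix l (pdMatrix k B) x =
      -(pdMatrix l (G k) x * B x + G k x * pdMatrix l B x) +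
      -(pdMatrix l B x * (G k x)ᵀ + B x * (pdMatrix l (G k) x)ᵀ) +
      (vecMulVec (fun i => pd l (fun y => lam y i) x) (Pi.single k 1) +
        (vecMulVec (fun i => pd l (fun y => lam y i) x) (Pi.single k 1))ᵀ) := by
    rw [pdMatrix_congr (Filter.eventually_of_mem (hU.mem_nhds hx) fun y hy => hpd y hy k),
      pdMatrix_add ((((dG k).mul dB).neg).add ((dB.mul (dG k).transpose).neg))
        ((dE k).add (dE k).transpose),
      pdMatrix_add (((dG k).mul dB).neg) ((dB.mul (dG k).transpose).neg),
      pdMatrix_add (dE k) (dE k).transpose, pdMatrix_neg, pdMatrix_neg,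
      pdMatrix_mul (dG k) dB, pdMatrix_mul dB (dG k).transpose, pdMatrix_transpose,
      pdMatrix_transpose, pdMatrix_vecMulVec_const _ dlam]
  intro M l k
  have hs (k l : Fin n) : G k x *ᵥ Pi.single l 1 = G l x *ᵥ Pi.single k 1 := by
    ext i
    simp [hsymm k l i]
  have hE (k l : Fin n) : G k x * vecMulVec (lam x) (Pi.single l 1) =
      vecMulVec (G k x *ᵥ lam x) (Pi.single l 1) := by
    rw [mul_vecMulVec]
  have hET (k l : Fin n) : G k x * (vecMulVec (lam x) (Pi.single l 1))ᵀ =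
      vecMulVec (G k x *ᵥ Pi.single l 1) (lam x) := by
    rw [transpose_vecMulVec, mul_vecMulVec]
  have hE' (k l : Fin n) : (vecMulVec (lam x) (Pi.single l 1))ᵀ * (G k x)ᵀ =
      (vecMulVec (G k x *ᵥ lam x) (Pi.single l 1))ᵀ := by
    rw [← Matrix.transpose_mul, hE]
  have hET' (k l : Fin n) : vecMulVec (lam x) (Pi.single l 1) * (G k x)ᵀ =
      (vecMulVec (G k x *ᵥ Pi.single l 1) (lam x))ᵀ := by
    rw [← hET, Matrix.transpose_mul, Matrix.transpose_transpose]
  have h := pdMatrix_comm hB hU hx k l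
  rw [snd, snd, hpd x hx, hpd x hx] at h
  simp only [mul_add, add_mul, mul_neg, neg_mul, hE, hET, hE', hET', hs k l] at h
  simp only [M, connCurvature, add_vecMulVec, Matrix.transpose_add, Matrix.transpose_sub,
    Matrix.transpose_mul, mul_add, add_mul, mul_sub, sub_mul]
  rw [← sub_eq_zero] at h ⊢
  rw [← neg_eq_zero, ← h]
  noncomm_ring

end MatrixFields

section CurvatureAlgebra

variable {n : ℕ}

lemma curvature_pair_symm {N : Fin n → Fin n → Fin n → Fin n → ℝ}
    (h₁ : ∀ i s l k, N i s l k = -N s i l k) (h₂ : ∀ i s l k, N i s l k = -N i s k l)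
    (hB : ∀ i s l k, N i s l k + N i l k s + N i k s l = 0) (i s l k : Fin n) :
    N i s l k = N l k i s := by
  linarith [hB i s l k, hB s l k i, hB l k i s, hB k i s l, h₁ i s l k, h₂ i s l k, h₁ i l k s,
    h₂ i l k s, h₁ i k s l, h₂ i k s l, h₁ s l k i, h₂ s l k i, h₁ s k i l, h₂ s k i l,
    h₁ s i l k, h₂ s i l k, h₁ l k i s, h₂ l k i s, h₁ l i s k, h₂ l i s k, h₁ l s k i,
    h₂ l s k i, h₁ k i s l, h₂ k i s l, h₁ k s l i, h₂ k s l i, h₁ k l i s, h₂ k l i s]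

/-- If a symmetric `A` satisfies the curvature integrability condition, then the Ricci
contraction of the curvature commutes with `A` (all indices lowered by `g`). -/
lemma ricci_contraction_comm {g H A : Matrix (Fin n) (Fin n) ℝ}
    {R : Fin n → Fin n → Matrix (Fin n) (Fin n) ℝ} {M : Fin n → Fin n → ℝ}
    {Ric : Matrix (Fin n) (Fin n) ℝ}
    (hgs : gᵀ = g) (hHs : Hᵀ = H) (hAs : Aᵀ = A) (hgH : g * H = 1) (hHg : H * g = 1)
    (hanti : ∀ l k, R l k = -R k l)
    (hBianchi : ∀ i s l k, R l k i s + R k s i l + R s l i k = 0)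
    (hRH : ∀ l k, R l k * H + H * (R l k)ᵀ = 0)
    (hRA : ∀ l k, R l k * A + A * (R l k)ᵀ =
      vecMulVec (M l) (Pi.single k 1) + (vecMulVec (M l) (Pi.single k 1))ᵀ -
        (vecMulVec (M k) (Pi.single l 1) + (vecMulVec (M k) (Pi.single l 1))ᵀ))
    (hRic : ∀ l s, Ric l s = ∑ j, R j l j s) :
    g * A * Ric = Ric * A * g := by
  have hKT (l k : Fin n) : (g * R l k)ᵀ = -(g * R l k) := by
    have h : g * (R l k * H + H * (R l k)ᵀ) * g = 0 := by rw [hRH]; simp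
    have h' : g * (R l k * H + H * (R l k)ᵀ) * g = g * R l k * (H * g) +
        g * H * (R l k)ᵀ * g := by noncomm_ring
    rw [h', hHg, hgH, mul_one, one_mul] at h
    rw [Matrix.transpose_mul, hgs]
    exact eq_neg_of_add_eq_zero_right h
  have hpair (i s l k : Fin n) : (g * R l k) i s = (g * R i s) l k := by
    refine curvature_pair_symm (N := fun i s l k => (g * R l k) i s) (fun i s l k => ?_)
      (fun i s l k => ?_) (fun i s l k => ?_) i s l k
    · exact congrFun (congrFun (hKT l k) s) i
    · rw [hanti l k]
      simp
    · simp only [Matrix.mul_apply]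
      rw [← Finset.sum_add_distrib, ← Finset.sum_add_distrib]
      refine Finset.sum_eq_zero fun a _ => ?_
      rw [← mul_add, ← mul_add, hBianchi, mul_zero]
  have hRup (l k : Fin n) : R l k = H * (g * R l k) := by
    rw [← Matrix.mul_assoc, hHg, one_mul]
  have hRics : Ricᵀ = Ric := by
    ext s l
    have e (l s : Fin n) : Ric l s = ∑ j, ∑ i, H j i * (g * R j l) i s := by
      rw [hRic]
      refine Finset.sum_congr rfl fun j _ => ?_
      conv_lhs => rw [hRup, Matrix.mul_apply]
    rw [Matrix.transpose_apply, e, e, Finset.sum_comm]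
    refine Finset.sum_congr rfl fun j _ => Finset.sum_congr rfl fun i _ => ?_
    rw [hpair, show H i j = H j i from congrFun (congrFun hHs j) i]
  set Mm : Matrix (Fin n) (Fin n) ℝ := Matrix.of fun i l => M l i with hMm
  set C : Matrix (Fin n) (Fin n) ℝ := Matrix.of fun i l => ∑ j, (R l j * A) i j with hC
  have hcontr : C - A * Ricᵀ = (n : ℝ) • Mm - (∑ j, M j j) • (1 : Matrix (Fin n) (Fin n) ℝ) := by
    ext i l
    have h : ∑ j, (R l j * A + A * (R l j)ᵀ) i j = _ :=
      Finset.sum_congr rfl fun j _ => congrFun (congrFun (hRA l j) i) j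
    have h2 : ∑ j, (A * (R l j)ᵀ) i j = -(A * Ricᵀ) i l := by
      simp only [Matrix.mul_apply, Matrix.transpose_apply, hRic]
      rw [Finset.sum_comm, ← Finset.sum_neg_distrib]
      refine Finset.sum_congr rfl fun s _ => ?_
      rw [← Finset.mul_sum, ← mul_neg, ← Finset.sum_neg_distrib]
      congr 1
      refine Finset.sum_congr rfl fun j _ => ?_
      rw [hanti l j]
      rfl
    simp only [Matrix.add_apply, Matrix.sub_apply, Finset.sum_add_distrib,
      Finset.sum_sub_distrib, h2, vecMulVec_apply, Matrix.transpose_apply] at h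
    simp only [Matrix.sub_apply, Matrix.smul_apply, hMm, hC, Matrix.of_apply, smul_eq_mul]
    rw [sub_eq_add_neg, h]
    simp [Pi.single_apply, Matrix.one_apply]
    ring
  have hgC : (g * C)ᵀ = g * C := by
    have e (m l : Fin n) : (g * C) m l = ∑ j, ∑ s, (g * R l j) m s * A s j := by
      simp only [Matrix.mul_apply, hC, Matrix.of_apply, Finset.mul_sum, Finset.sum_mul]
      rw [Finset.sum_comm]
      refine Finset.sum_congr rfl fun j _ => ?_
      rw [Finset.sum_comm]
      simp only [mul_assoc]
    ext l m
    rw [Matrix.transpose_apply, e, e, Finset.sum_comm]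
    refine Finset.sum_congr rfl fun j _ => Finset.sum_congr rfl fun s _ => ?_
    rw [hpair, show A j s = A s j from congrFun (congrFun hAs s) j]
  have hgM : (g * Mm)ᵀ = g * Mm := by
    ext l k
    have h := congrArg (fun X => (g * X).trace) (hRA l k)
    have h1 : (g * (R l k * A)).trace = 0 := by
      have : (g * (R l k * A)).trace = -(g * (R l k * A)).trace := by
        conv_lhs =>
          rw [← Matrix.mul_assoc, ← Matrix.trace_transpose, Matrix.transpose_mul, hKT, hAs,
            mul_neg, Matrix.trace_neg, Matrix.trace_mul_comm, Matrix.mul_assoc]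
      linarith
    have h2 : (g * (A * (R l k)ᵀ)).trace = 0 := by
      rw [← Matrix.trace_transpose, Matrix.transpose_mul, Matrix.transpose_mul,
        Matrix.transpose_transpose, hAs, hgs, Matrix.trace_mul_comm, h1]
    have h3 (l k : Fin n) : (g * vecMulVec (M l) (Pi.single k 1)).trace = (g * Mm) k l := by
      rw [mul_vecMulVec, trace_vecMulVec]
      simp [Matrix.mul_apply, mulVec, dotProduct, hMm, Pi.single_apply]
    have h4 (l k : Fin n) : (g * (vecMulVec (M l) (Pi.single k 1))ᵀ).trace = (g * Mm) k l := by
      rw [← h3, ← Matrix.trace_transpose, Matrix.transpose_mul, Matrix.transpose_transpose, hgs,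
        Matrix.trace_mul_comm]
    simp only [mul_add, mul_sub, Matrix.trace_add, Matrix.trace_sub, h1, h2, h3, h4] at h
    rw [Matrix.transpose_apply]
    linarith
  have hsym : (g * A * Ricᵀ)ᵀ = g * A * Ricᵀ := by
    have h : g * A * Ricᵀ =
        g * C - ((n : ℝ) • (g * Mm) - (∑ j, M j j) • g) := by
      have := congrArg (g * ·) hcontr
      simp only [mul_sub, Matrix.mul_smul, mul_one] at this
      rw [← this, Matrix.mul_assoc]
      abel
    rw [h]
    simp only [Matrix.transpose_sub, Matrix.transpose_smul, hgC, hgM, hgs]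
  rw [Matrix.transpose_mul, Matrix.transpose_mul, Matrix.transpose_transpose, hAs, hgs] at hsym
  rw [hRics] at hsym
  rw [Matrix.mul_assoc Ric, hsym]

end CurvatureAlgebra

section ChristoffelMatrices

variable {n : ℕ} {x : Fin n → ℝ} {U : Set (Fin n → ℝ)}
  {F g : (Fin n → ℝ) → Matrix (Fin n) (Fin n) ℝ}

lemma MatrixSmoothOn.det (hF : MatrixSmoothOn F U) :
    ContDiffOn ℝ ∞ (fun y => (F y).det) U := by
  simp only [Matrix.det_apply']
  exact ContDiffOn.sum fun σ _ => contDiffOn_const.mul (contDiffOn_prod fun i _ => hF _ _)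

lemma MatrixSmoothOn.adjugate (hF : MatrixSmoothOn F U) :
    MatrixSmoothOn (fun y => (F y).adjugate) U := fun i j => by
  simp only [Matrix.adjugate_apply]
  refine MatrixSmoothOn.det fun a b => ?_
  by_cases h : a = j
  · subst h
    simpa using contDiffOn_const
  · simpa [Matrix.updateRow_ne h] using hF a b

/-- Jacobi's formula. -/
lemma pd_det (hF : MatrixDifferentiableAt F x) (k : Fin n) :
    pd k (fun y => (F y).det) x = ((F x).adjugate * pdMatrix k F x).trace := by
  have hprod (σ : Equiv.Perm (Fin n)) : HasFDerivAt (fun y => ∏ i, F y (σ i) i)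
      (∑ i, (∏ j ∈ Finset.univ.erase i, F x (σ j) j) • fderiv ℝ (fun y => F y (σ i) i) x) x :=
    HasFDerivAt.finsetProd fun i _ => (hF (σ i) i).hasFDerivAt
  have hdet : HasFDerivAt (fun y => (F y).det)
      (∑ σ : Equiv.Perm (Fin n), ((Equiv.Perm.sign σ : ℤ) : ℝ) • ∑ i,
        (∏ j ∈ Finset.univ.erase i, F x (σ j) j) • fderiv ℝ (fun y => F y (σ i) i) x) x := by
    simp only [Matrix.det_apply']
    exact HasFDerivAt.fun_sum (u := Finset.univ) fun σ _ =>
      (hprod σ).const_mul ((Equiv.Perm.sign σ : ℤ) : ℝ)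
  have hcol (i : Fin n) : ((F x).adjugate * pdMatrix k F x) i i =
      ((F x).updateCol i fun a => pdMatrix k F x a i).det := by
    rw [← cramer_apply, cramer_eq_adjugate_mulVec]
    rfl
  simp only [Matrix.trace, Matrix.diag_apply, hcol, pd, hdet.fderiv]
  simp only [Matrix.det_apply', _root_.sum_apply, _root_.smul_apply,
    smul_eq_mul, Finset.mul_sum]
  rw [Finset.sum_comm]
  refine Finset.sum_congr rfl fun i _ => Finset.sum_congr rfl fun σ _ => ?_
  rw [← Finset.mul_prod_erase _ _ (Finset.mem_univ i)]
  congr 1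
  rw [mul_comm]
  congr 1
  · simp [pdMatrix, pd]
  · refine Finset.prod_congr rfl fun j hj => ?_
    rw [Matrix.updateCol_ne (Finset.ne_of_mem_erase hj)]

/-- The matrix `(Γⁱₖₛ)ᵢₛ` of Christoffel symbols with one lower index fixed. -/
noncomputable def christoffelMatrix (g : (Fin n → ℝ) → Matrix (Fin n) (Fin n) ℝ) (k : Fin n)
    (y : Fin n → ℝ) : Matrix (Fin n) (Fin n) ℝ :=
  Matrix.of fun i s => Gamma g i k s y

namespace IsMetricOn

lemma matrixSmoothOn (hg : IsMetricOn U g) : MatrixSmoothOn g U := hg.smooth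

lemma matrixSmoothOn_inv (hg : IsMetricOn U g) : MatrixSmoothOn (fun y => (g y)⁻¹) U :=
  fun i j => by
    simp only [Matrix.inv_def, Matrix.smul_apply, Ring.inverse_eq_inv', smul_eq_mul]
    exact (hg.matrixSmoothOn.det.inv fun y hy => (hg.nondeg y hy).ne_zero).mul
      (hg.matrixSmoothOn.adjugate i j)

lemma inv_isSymm (hg : IsMetricOn U g) (hx : x ∈ U) : ((g x)⁻¹)ᵀ = (g x)⁻¹ := by
  rw [Matrix.transpose_nonsing_inv, (hg.symm x hx).eq]

lemma pd_symm (hg : IsMetricOn U g) (hU : IsOpen U) (hx : x ∈ U) (k i j : Fin n) :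
    pd k (fun y => g y i j) x = pd k (fun y => g y j i) x :=
  pd_congr (Filter.eventually_of_mem (hU.mem_nhds hx) fun y hy => (hg.symm y hy).apply j i) k

lemma gamma_symm (hg : IsMetricOn U g) (hU : IsOpen U) (hx : x ∈ U) (k i j : Fin n) :
    Gamma g k i j x = Gamma g k j i x := by
  simp only [Gamma]
  congr 1
  refine Finset.sum_congr rfl fun l _ => ?_
  rw [hg.pd_symm hU hx l i j]
  ring

lemma contDiffOn_gamma (hg : IsMetricOn U g) (hU : IsOpen U) (k i j : Fin n) :
    ContDiffOn ℝ ∞ (Gamma g k i j) U := by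
  refine contDiffOn_const.mul (ContDiffOn.sum fun l _ => (hg.matrixSmoothOn_inv k l).mul ?_)
  exact ((contDiffOn_pd hU (hg.smooth _ _) _).add (contDiffOn_pd hU (hg.smooth _ _) _)).sub
    (contDiffOn_pd hU (hg.smooth _ _) _)

lemma exists_christoffelMatrix_eq (hg : IsMetricOn U g) (hU : IsOpen U) (hx : x ∈ U)
    (k : Fin n) : ∃ N : Matrix (Fin n) (Fin n) ℝ, Nᵀ = -N ∧
      christoffelMatrix g k x = (1 / 2 : ℝ) • ((g x)⁻¹ * (pdMatrix k g x + N)) := by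
  refine ⟨Matrix.of fun l j => pd j (fun y => g y l k) x - pd l (fun y => g y k j) x, ?_, ?_⟩
  · ext i j
    simp only [Matrix.transpose_apply, Matrix.of_apply, Matrix.neg_apply]
    rw [hg.pd_symm hU hx i j k, hg.pd_symm hU hx j k i]
    ring
  · ext i j
    simp [christoffelMatrix, Gamma, Matrix.mul_apply, pdMatrix, add_sub_assoc]

lemma pdMatrix_transpose_eq (hg : IsMetricOn U g) (hU : IsOpen U) (hx : x ∈ U) (k : Fin n) :
    (pdMatrix k g x)ᵀ = pdMatrix k g x := by
  ext i j
  exact hg.pd_symm hU hx k j i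

lemma pdMatrix_inv (hg : IsMetricOn U g) (hU : IsOpen U) (hx : x ∈ U) (k : Fin n) :
    pdMatrix k (fun y => (g y)⁻¹) x =
      -(christoffelMatrix g k x * (g x)⁻¹) + -((g x)⁻¹ * (christoffelMatrix g k x)ᵀ) := by
  have h : pdMatrix k (fun y => (g y)⁻¹) x = -((g x)⁻¹ * pdMatrix k g x * (g x)⁻¹) := by
    have h1 : pdMatrix k (fun y => (g y)⁻¹ * g y) x = 0 := by
      rw [pdMatrix_congr (Filter.eventually_of_mem (hU.mem_nhds hx) fun y hy =>
        Matrix.nonsing_inv_mul _ (hg.nondeg y hy)) k]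
      exact pdMatrix_const 1 k
    rw [pdMatrix_mul (hg.matrixSmoothOn_inv.differentiableAt hU hx)
      (hg.matrixSmoothOn.differentiableAt hU hx)] at h1
    have h2 := congrArg (· * (g x)⁻¹) (eq_neg_of_add_eq_zero_left h1)
    simpa [Matrix.mul_assoc, Matrix.mul_nonsing_inv _ (hg.nondeg x hx)] using h2
  obtain ⟨N, hN, hG⟩ := hg.exists_christoffelMatrix_eq hU hx k
  rw [h, hG, Matrix.transpose_smul, Matrix.transpose_mul, Matrix.transpose_add, hN,
    hg.pdMatrix_transpose_eq hU hx, hg.inv_isSymm hx]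
  simp only [Matrix.smul_mul, Matrix.mul_smul, ← smul_neg, ← smul_add]
  simp only [mul_add, add_mul, mul_neg, neg_mul, Matrix.mul_assoc]
  module

lemma trace_christoffelMatrix (hg : IsMetricOn U g) (hU : IsOpen U) (hx : x ∈ U)
    (k : Fin n) :
    (christoffelMatrix g k x).trace = (1 / 2) * ((g x)⁻¹ * pdMatrix k g x).trace := by
  obtain ⟨N, hN, hG⟩ := hg.exists_christoffelMatrix_eq hU hx k
  have h : ((g x)⁻¹ * N).trace = 0 := by
    have : ((g x)⁻¹ * N).trace = -((g x)⁻¹ * N).trace := by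
      conv_lhs =>
        rw [← Matrix.trace_transpose, Matrix.transpose_mul, hN, hg.inv_isSymm hx, neg_mul,
          Matrix.trace_neg, Matrix.trace_mul_comm]
    linarith
  rw [hG, Matrix.trace_smul, mul_add, Matrix.trace_add, h]
  simp

lemma pd_det_eq (hg : IsMetricOn U g) (hU : IsOpen U) (hx : x ∈ U) (k : Fin n) :
    pd k (fun y => (g y).det) x = 2 * (g x).det * (christoffelMatrix g k x).trace := by
  rw [pd_det (hg.matrixSmoothOn.differentiableAt hU hx), hg.trace_christoffelMatrix hU hx,
    Matrix.inv_def, Ring.inverse_eq_inv', Matrix.smul_mul, Matrix.trace_smul, smul_eq_mul]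
  have := (hg.nondeg x hx).ne_zero
  field_simp

lemma matrixSmoothOn_christoffelMatrix (hg : IsMetricOn U g) (hU : IsOpen U) (k : Fin n) :
    MatrixSmoothOn (christoffelMatrix g k) U := fun i j => hg.contDiffOn_gamma hU i k j

end IsMetricOn

end ChristoffelMatrices

section Geodesics

open Set Topology

lemma contDiffOn_of_hasDerivAt_eq {E : Type*} [NormedAddCommGroup E] [NormedSpace ℝ E]
    {F : E → E} {V : Set E} (hF : ContDiffOn ℝ ∞ F V) {z : ℝ → E} {I : Set ℝ} (hI : IsOpen I)
    (hzV : ∀ t ∈ I, z t ∈ V) (hz : ∀ t ∈ I, HasDerivAt z (F (z t)) t) :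
    ContDiffOn ℝ ∞ z I := by
  rw [contDiffOn_infty]
  intro m
  induction m with
  | zero => exact contDiffOn_zero.2 fun t ht => (hz t ht).continuousAt.continuousWithinAt
  | succ m ih =>
    push_cast
    rw [contDiffOn_succ_iff_deriv_of_isOpen hI]
    refine ⟨fun t ht => (hz t ht).differentiableAt.differentiableWithinAt, by simp, ?_⟩
    refine ((hF.of_le (mod_cast le_top)).comp ih hzV).congr fun t ht => ?_
    exact (hz t ht).deriv

variable {n : ℕ} {U : Set (Fin n → ℝ)} {g gbar : (Fin n → ℝ) → Matrix (Fin n) (Fin n) ℝ}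

lemma exists_isGeodesicOn (hg : IsMetricOn U g) (hU : IsOpen U) {x : Fin n → ℝ} (hx : x ∈ U)
    {v : Fin n → ℝ} (hv : v ≠ 0) :
    ∃ (γ : ℝ → Fin n → ℝ) (I : Set ℝ), IsGeodesicOn U g γ I ∧ 0 ∈ I ∧ γ 0 = x ∧
      (∀ k, deriv (fun s => γ s k) 0 = v k) ∧
      ∀ t ∈ I, ∃ k, deriv (fun s => γ s k) t ≠ 0 := by
  set F : (Fin n → ℝ) × (Fin n → ℝ) → (Fin n → ℝ) × (Fin n → ℝ) := fun p =>
    (p.2, fun k => -∑ i, ∑ j, Gamma g k i j p.1 * p.2 i * p.2 j) with hF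
  set V : Set ((Fin n → ℝ) × (Fin n → ℝ)) := U ×ˢ {0}ᶜ with hV
  have hVo : IsOpen V := hU.prod isOpen_compl_singleton
  have hxV : (x, v) ∈ V := ⟨hx, hv⟩
  have hFV : ContDiffOn ℝ ∞ F V := by
    refine contDiffOn_snd.prodMk (contDiffOn_pi.2 fun k => ?_)
    refine (ContDiffOn.sum fun i _ => ContDiffOn.sum fun j _ => ?_).neg
    have h2 (i : Fin n) : ContDiffOn ℝ ∞ (fun p : (Fin n → ℝ) × (Fin n → ℝ) => p.2 i) V := by
      fun_prop
    exact (((hg.contDiffOn_gamma hU k i j).comp contDiffOn_fst fun p hp => hp.1).mul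
      (h2 i)).mul (h2 j)
  obtain ⟨z, hz0, ε, hε, hz⟩ :=
    ((hFV.contDiffAt (hVo.mem_nhds hxV)).of_le (m := 1)
      (by norm_cast)).exists_forall_mem_closedBall_exists_eq_forall_mem_Ioo_hasDerivAt₀ 0
  have hzc : ContinuousAt z 0 := (hz 0 (by simp [hε])).continuousAt
  have hmem : z ⁻¹' V ∈ 𝓝 (0 : ℝ) := hzc (hVo.mem_nhds (by rwa [hz0]))
  obtain ⟨δ, hδ, hδV⟩ := Metric.mem_nhds_iff.1 (Filter.inter_mem hmem
    (Ioo_mem_nhds (show (0 : ℝ) - ε < 0 by linarith) (show (0 : ℝ) < 0 + ε by linarith)))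
  rw [Real.ball_eq_Ioo] at hδV
  set I := Ioo (0 - δ) (0 + δ) with hI
  have hIo : IsOpen I := isOpen_Ioo
  have hzI (t) (ht : t ∈ I) : HasDerivAt z (F (z t)) t := hz t (hδV ht).2
  have hsm := contDiffOn_of_hasDerivAt_eq hFV hIo (fun t ht => (hδV ht).1) hzI
  have h1 (t) (ht : t ∈ I) (k : Fin n) :
      HasDerivAt (fun s => (z s).1 k) ((z t).2 k) t :=
    (hasDerivAt_pi.1 (hzI t ht).fst) k
  have h2 (t) (ht : t ∈ I) (k : Fin n) : HasDerivAt (fun s => (z s).2 k) ((F (z t)).2 k) t :=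
    (hasDerivAt_pi.1 (hzI t ht).snd) k
  have h0 : (0 : ℝ) ∈ I := by simp [hI, hδ]
  refine ⟨fun t => (z t).1, I, ⟨⟨hIo, ordConnected_Ioo⟩, fun k => ?_,
    fun t ht => (hδV ht).1.1, fun t ht k => ?_⟩, h0, by simp [hz0], fun k => ?_, fun t ht => ?_⟩
  · exact contDiffOn_pi.1 (contDiff_fst.comp_contDiffOn hsm) k
  · have e : deriv (fun s => (z s).1 k) =ᶠ[𝓝 t] fun s => (z s).2 k :=
      Filter.eventually_of_mem (hIo.mem_nhds ht) fun s hs => (h1 s hs k).deriv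
    rw [e.deriv_eq, (h2 t ht k).deriv]
    simp only [(h1 t ht _).deriv, hF]
    ring
  · rw [(h1 0 h0 k).deriv, hz0]
  · by_contra! h
    exact (hδV ht).1.2 (funext fun k => by rw [← (h1 t ht k).deriv]; exact h k)

/-- The difference of the two connections, evaluated twice on a vector, is proportional to
that vector. -/
lemma ProjEquiv.exists_gamma_sub_eq (h : ProjEquiv U g gbar) (hg : IsMetricOn U g)
    (hU : IsOpen U) {x : Fin n → ℝ} (hx : x ∈ U) (v : Fin n → ℝ) :
    ∃ c : ℝ, ∀ k, ∑ i, ∑ j, (Gamma gbar k i j x - Gamma g k i j x) * v i * v j = c * v k := by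
  by_cases hv : v = 0
  · exact ⟨0, fun k => by simp [hv]⟩
  obtain ⟨γ, I, hγ, h0, hγ0, hγv, hne⟩ := exists_isGeodesicOn hg hU hx hv
  obtain ⟨φ, J, ⟨hJ, -⟩, hφ, -, himg, hφ', hbar⟩ := h γ I hγ hne
  obtain ⟨t, ht, hφt⟩ : (0 : ℝ) ∈ φ '' J := himg ▸ h0
  have hI := hγ.interval.1
  have hφI (s) (hs : s ∈ J) : φ s ∈ I := himg ▸ mem_image_of_mem φ hs
  have dφ (s) (hs : s ∈ J) : DifferentiableAt ℝ φ s :=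
    (hφ.contDiffAt (hJ.mem_nhds hs)).differentiableAt (by simp)
  have ddφ : DifferentiableAt ℝ (deriv φ) t :=
    (((contDiffOn_infty_iff_deriv_of_isOpen hJ).1 hφ).2.contDiffAt
      (hJ.mem_nhds ht)).differentiableAt (by simp)
  have dγ (k : Fin n) (s) (hs : s ∈ I) : DifferentiableAt ℝ (fun s => γ s k) s :=
    ((hγ.smooth k).contDiffAt (hI.mem_nhds hs)).differentiableAt (by simp)
  have ddγ (k : Fin n) : DifferentiableAt ℝ (deriv fun s => γ s k) (φ t) :=
    (((contDiffOn_infty_iff_deriv_of_isOpen hI).1 (hγ.smooth k)).2.contDiffAt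
      (hI.mem_nhds (hφI t ht))).differentiableAt (by simp)
  have hd (k : Fin n) (s) (hs : s ∈ J) :
      deriv (fun s => γ (φ s) k) s = deriv (fun s => γ s k) (φ s) * deriv φ s :=
    ((dγ k _ (hφI s hs)).hasDerivAt.comp s (dφ s hs).hasDerivAt).deriv
  have hdd (k : Fin n) : deriv (deriv fun s => γ (φ s) k) t =
      deriv (deriv fun s => γ s k) 0 * deriv φ t ^ 2 + v k * deriv (deriv φ) t := by
    have e : deriv (fun s => γ (φ s) k) =ᶠ[𝓝 t]
        fun s => deriv (fun s => γ s k) (φ s) * deriv φ s :=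
      Filter.eventually_of_mem (hJ.mem_nhds ht) fun s hs => hd k s hs
    rw [e.deriv_eq, ← hγv k]
    refine (((ddγ k).hasDerivAt.comp t (dφ t ht).hasDerivAt).mul ddφ.hasDerivAt).deriv.trans ?_
    simp only [Function.comp_apply, hφt]
    ring
  refine ⟨-(deriv (deriv φ) t / deriv φ t ^ 2), fun k => ?_⟩
  have e1 := hγ.eqn 0 h0 k
  have e2 := hbar.eqn t ht k
  simp only [hγ0, hγv] at e1
  simp only [Function.comp_apply, hdd, hd _ t ht, hφt, hγ0, hγv] at e2
  have e3 : ∑ i, ∑ j, Gamma gbar k i j x * (v i * deriv φ t) * (v j * deriv φ t) =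
      deriv φ t ^ 2 * ∑ i, ∑ j, Gamma gbar k i j x * v i * v j := by
    simp only [Finset.mul_sum]
    exact Finset.sum_congr rfl fun i _ => Finset.sum_congr rfl fun j _ => by ring
  rw [e3] at e2
  simp only [sub_mul, Finset.sum_sub_distrib]
  have hne0 := hφ' t ht
  field_simp
  linear_combination e2 - deriv φ t ^ 2 * e1

/-- A symmetric vector-valued bilinear form with `D(v, v)` always proportional to `v` is of the
form `D(v, w) = ψ(v) w + ψ(w) v`. -/
lemma exists_eq_of_forall_proportional {D : Fin n → Fin n → Fin n → ℝ}
    (hs : ∀ k i j, D k i j = D k j i)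
    (hD : ∀ v : Fin n → ℝ, ∃ c : ℝ, ∀ k, ∑ i, ∑ j, D k i j * v i * v j = c * v k) :
    ∃ ψ : Fin n → ℝ, ∀ k i j, D k i j =
      (if i = k then ψ j else 0) + (if j = k then ψ i else 0) := by
  have hpol (i j : Fin n) (s : ℝ) (hij : i ≠ j) : ∃ c : ℝ, ∀ k,
      D k i i + 2 * s * D k i j + s ^ 2 * D k j j =
        c * ((if k = i then 1 else 0) + s * (if k = j then 1 else 0)) := by
    obtain ⟨c, hc⟩ := hD (Pi.single i 1 + s • Pi.single j 1)
    refine ⟨c, fun k => ?_⟩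
    have := hc k
    simp only [Pi.add_apply, Pi.smul_apply, smul_eq_mul, Pi.single_apply, mul_add, add_mul,
      Finset.sum_add_distrib, mul_ite, ite_mul, mul_one, mul_zero, zero_mul,
      Finset.sum_ite_eq', Finset.mem_univ, if_true] at this
    rw [hs k j i] at this
    simp only [mul_add, mul_ite, mul_one, mul_zero]
    linear_combination this
  have hdiag (i k : Fin n) (hik : k ≠ i) : D k i i = 0 := by
    obtain ⟨c, hc⟩ := hD (Pi.single i 1)
    have := hc k
    simpa [Pi.single_apply, hik] using this
  refine ⟨fun j => D j j j / 2, fun k i j => ?_⟩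
  by_cases hij : i = j
  · subst hij
    by_cases hik : i = k
    · subst hik; simp
    · simp [hik, hdiag i k (Ne.symm hik)]
  have hji : j ≠ i := Ne.symm hij
  have off (i j : Fin n) (hij : i ≠ j) : D i i j = D j j j / 2 := by
    obtain ⟨c, hc⟩ := hpol i j 1 hij
    obtain ⟨d, hd⟩ := hpol i j (-1) hij
    have hji := Ne.symm hij
    have c1 := hc i
    have c2 := hc j
    have d1 := hd i
    have d2 := hd j
    simp [hij, hji, hdiag i j hji, hdiag j i hij] at c1 c2 d1 d2
    linarith
  by_cases hik : i = k
  · subst hik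
    simp [hji, off i j hij]
  by_cases hjk : j = k
  · subst hjk
    simp [hij, hs j i j, off j i hji]
  · obtain ⟨c, hc⟩ := hpol i j 1 hij
    have := hc k
    simpa [hik, hjk, Ne.symm hik, Ne.symm hjk, hdiag] using this

end Geodesics

section ProjectiveEquivalence

variable {n : ℕ} {x : Fin n → ℝ} {U : Set (Fin n → ℝ)}
  {g gbar : (Fin n → ℝ) → Matrix (Fin n) (Fin n) ℝ}

/-- The one-form relating the Levi-Civita connections of two projectively equivalent metrics. -/
noncomputable def projectiveForm (g gbar : (Fin n → ℝ) → Matrix (Fin n) (Fin n) ℝ)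
    (y : Fin n → ℝ) (k : Fin n) : ℝ :=
  ((christoffelMatrix gbar k y).trace - (christoffelMatrix g k y).trace) / (n + 1)

/-- The conformal weight `|det gbar / det g|^{1/(n+1)}`. -/
noncomputable def projectiveWeight (g gbar : (Fin n → ℝ) → Matrix (Fin n) (Fin n) ℝ)
    (y : Fin n → ℝ) : ℝ :=
  |(gbar y).det / (g y).det| ^ ((1 : ℝ) / ((n : ℝ) + 1))

lemma ProjEquiv.christoffelMatrix_eq (h : ProjEquiv U g gbar) (hg : IsMetricOn U g)
    (hgbar : IsMetricOn U gbar) (hU : IsOpen U) (hx : x ∈ U) (k : Fin n) :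
    christoffelMatrix gbar k x = christoffelMatrix g k x +
      vecMulVec (Pi.single k 1) (projectiveForm g gbar x) +
      projectiveForm g gbar x k • (1 : Matrix (Fin n) (Fin n) ℝ) := by
  obtain ⟨ψ, hψ⟩ := exists_eq_of_forall_proportional
    (D := fun k i j => Gamma gbar k i j x - Gamma g k i j x)
    (fun k i j => by rw [hg.gamma_symm hU hx, hgbar.gamma_symm hU hx])
    (h.exists_gamma_sub_eq hg hU hx)
  have e : projectiveForm g gbar x = ψ := by
    ext k
    have hn : (n : ℝ) + 1 ≠ 0 := by positivity
    rw [projectiveForm, div_eq_iff hn, Matrix.trace, Matrix.trace, ← Finset.sum_sub_distrib]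
    simp only [Matrix.diag_apply, christoffelMatrix, Matrix.of_apply, hψ]
    simp [Finset.sum_add_distrib]
    ring
  rw [e]
  ext i s
  have := hψ i k s
  simp only [christoffelMatrix, Matrix.of_apply, Matrix.add_apply, vecMulVec_apply,
    Pi.single_apply, Matrix.smul_apply, Matrix.one_apply, smul_eq_mul]
  simp only [eq_comm (a := i), ite_mul, one_mul, zero_mul, mul_ite, mul_one, mul_zero]
  linarith

namespace IsMetricOn

lemma projectiveWeight_eq (hg : IsMetricOn U g) (hgbar : IsMetricOn U gbar) (hx : x ∈ U) :
    projectiveWeight g gbar x =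
      Real.exp ((Real.log (gbar x).det - Real.log (g x).det) * (1 / ((n : ℝ) + 1))) := by
  have h1 := (hg.nondeg x hx).ne_zero
  have h2 := (hgbar.nondeg x hx).ne_zero
  rw [projectiveWeight, Real.rpow_def_of_pos (abs_pos.2 (div_ne_zero h2 h1)), Real.log_abs,
    Real.log_div h2 h1]

lemma contDiffOn_projectiveWeight (hg : IsMetricOn U g) (hgbar : IsMetricOn U gbar) :
    ContDiffOn ℝ ∞ (projectiveWeight g gbar) U := by
  refine ContDiffOn.congr ?_ fun y hy => hg.projectiveWeight_eq hgbar hy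
  exact (((hgbar.matrixSmoothOn.det.log fun y hy => (hgbar.nondeg y hy).ne_zero).sub
    (hg.matrixSmoothOn.det.log fun y hy => (hg.nondeg y hy).ne_zero)).mul contDiffOn_const).exp

lemma pd_projectiveWeight (hg : IsMetricOn U g) (hgbar : IsMetricOn U gbar) (hU : IsOpen U)
    (hx : x ∈ U) (k : Fin n) : pd k (projectiveWeight g gbar) x =
      2 * projectiveForm g gbar x k * projectiveWeight g gbar x := by
  have hlog {g : (Fin n → ℝ) → Matrix (Fin n) (Fin n) ℝ} (hg : IsMetricOn U g) :=
    (((hg.matrixSmoothOn.det.contDiffAt (hU.mem_nhds hx)).differentiableAt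
      (by simp)).hasFDerivAt).log (hg.nondeg x hx).ne_zero
  have hpd {g : (Fin n → ℝ) → Matrix (Fin n) (Fin n) ℝ} (hg : IsMetricOn U g) :
      (g x).det⁻¹ * fderiv ℝ (fun y => (g y).det) x (Pi.single k 1) =
        2 * (christoffelMatrix g k x).trace := by
    have h := hg.pd_det_eq hU hx k
    have := (hg.nondeg x hx).ne_zero
    rw [pd] at h
    rw [h]
    field_simp
  rw [pd_congr (Filter.eventually_of_mem (hU.mem_nhds hx) fun y hy =>
    hg.projectiveWeight_eq hgbar hy), hg.projectiveWeight_eq hgbar hx, pd,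
    (((hlog hgbar).fun_sub (hlog hg)).mul_const (1 / ((n : ℝ) + 1))).exp.fderiv]
  simp only [_root_.smul_apply, _root_.sub_apply, smul_eq_mul, hpd hg, hpd hgbar, projectiveForm]
  ring

end IsMetricOn

/-- The contravariant form `|det gbar / det g|^{1/(n+1)} gbar⁻¹` of `L` satisfies
`∇ₖ Aⁱʲ = lamⁱ δʲₖ + lamʲ δⁱₖ`. -/
lemma ProjEquiv.pdMatrix_weight_smul_inv (h : ProjEquiv U g gbar) (hg : IsMetricOn U g)
    (hgbar : IsMetricOn U gbar) (hU : IsOpen U) (hx : x ∈ U) (k : Fin n) :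
    let A := fun y => projectiveWeight g gbar y • (gbar y)⁻¹
    let lam := fun y i => -(projectiveWeight g gbar y *
      ((gbar y)⁻¹ *ᵥ projectiveForm g gbar y) i)
    pdMatrix k A x = -(christoffelMatrix g k x * A x) + -(A x * (christoffelMatrix g k x)ᵀ) +
      (vecMulVec (lam x) (Pi.single k 1) + (vecMulVec (lam x) (Pi.single k 1))ᵀ) := by
  intro A lam
  have hw := ((hg.contDiffOn_projectiveWeight hgbar).contDiffAt
    (hU.mem_nhds hx)).differentiableAt (by simp)
  rw [pdMatrix_smul hw (hgbar.matrixSmoothOn_inv.differentiableAt hU hx),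
    hg.pd_projectiveWeight hgbar hU hx, hgbar.pdMatrix_inv hU hx,
    h.christoffelMatrix_eq hg hgbar hU hx]
  have hlam : vecMulVec (lam x) (Pi.single k 1) = -(projectiveWeight g gbar x •
      vecMulVec ((gbar x)⁻¹ *ᵥ projectiveForm g gbar x) (Pi.single k 1)) := by
    ext i j
    simp [lam, vecMulVec_apply, mul_assoc]
  have hP : (gbar x)⁻¹ * (vecMulVec (Pi.single k 1) (projectiveForm g gbar x))ᵀ =
      vecMulVec ((gbar x)⁻¹ *ᵥ projectiveForm g gbar x) (Pi.single k 1) := by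
    rw [transpose_vecMulVec, mul_vecMulVec]
  have hP' : vecMulVec (Pi.single k 1) (projectiveForm g gbar x) * (gbar x)⁻¹ =
      (vecMulVec ((gbar x)⁻¹ *ᵥ projectiveForm g gbar x) (Pi.single k 1))ᵀ := by
    rw [← hP, Matrix.transpose_mul, Matrix.transpose_transpose, hgbar.inv_isSymm hx]
  simp only [A, hlam, Matrix.transpose_add, Matrix.transpose_smul, Matrix.transpose_one,
    Matrix.transpose_neg, add_mul, mul_add, hP, hP', Matrix.smul_mul, Matrix.mul_smul,
    one_mul, mul_one]
  module

end ProjectiveEquivalence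

section LeviCivitaCurvature

variable {n : ℕ} {x : Fin n → ℝ} {U : Set (Fin n → ℝ)}
  {g : (Fin n → ℝ) → Matrix (Fin n) (Fin n) ℝ}

lemma connCurvature_swap (G : Fin n → (Fin n → ℝ) → Matrix (Fin n) (Fin n) ℝ) (l k : Fin n) :
    connCurvature G l k x = -connCurvature G k l x := by
  simp only [connCurvature]
  abel

lemma IsMetricOn.bianchi (hg : IsMetricOn U g) (hU : IsOpen U) (hx : x ∈ U)
    (i s l k : Fin n) :
    connCurvature (christoffelMatrix g) l k x i s + connCurvature (christoffelMatrix g) k s x i l +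
      connCurvature (christoffelMatrix g) s l x i k = 0 := by
  have hpd (a i j k : Fin n) : pd a (fun y => Gamma g k i j y) x =
      pd a (fun y => Gamma g k j i y) x :=
    pd_congr (Filter.eventually_of_mem (hU.mem_nhds hx) fun y hy => hg.gamma_symm hU hy k i j) a
  simp only [connCurvature, Matrix.add_apply, Matrix.sub_apply, Matrix.mul_apply, pdMatrix,
    christoffelMatrix, Matrix.of_apply]
  rw [hpd l k s, hpd k l s, hpd s k l]
  simp only [hg.gamma_symm hU hx _ k s, hg.gamma_symm hU hx _ l s, hg.gamma_symm hU hx _ k l]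
  ring

lemma ricci_eq_sum_connCurvature (l s : Fin n) :
    Ricci g l s x = ∑ j, connCurvature (christoffelMatrix g) j l x j s := by
  simp only [Ricci, connCurvature, Matrix.add_apply, Matrix.sub_apply, Matrix.mul_apply, pdMatrix,
    christoffelMatrix, Matrix.of_apply, Finset.sum_add_distrib, Finset.sum_sub_distrib]
  ring

end LeviCivitaCurvature

theorem Ricci_commutes_with_L {n : ℕ} (hn : 2 ≤ n) (U : Set (Fin n → ℝ)) (hUo : IsOpen U) (hUc : IsConnected U)
    (g gbar : (Fin n → ℝ) → Matrix (Fin n) (Fin n) ℝ)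
    (hg : IsMetricOn U g) (hgbar : IsMetricOn U gbar)
    (hproj : ProjEquiv U g gbar) :
    ∀ x ∈ U,
      ((g x)⁻¹ * Matrix.of fun i j => Ricci g i j x) * Lfield g gbar x =
        Lfield g gbar x * ((g x)⁻¹ * Matrix.of fun i j => Ricci g i j x) := by
  intro x hx
  have hgs := (hg.symm x hx).eq
  have hgH := Matrix.mul_nonsing_inv _ (hg.nondeg x hx)
  have hHg := Matrix.nonsing_inv_mul _ (hg.nondeg x hx)
  have hw := hg.contDiffOn_projectiveWeight hgbar
  have hform (i : Fin n) : ContDiffOn ℝ ∞ (fun y => projectiveForm g gbar y i) U := by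
    simp only [projectiveForm, Matrix.trace, Matrix.diag_apply]
    exact ((ContDiffOn.sum fun a _ => hgbar.matrixSmoothOn_christoffelMatrix hUo i a a).sub
      (ContDiffOn.sum fun a _ => hg.matrixSmoothOn_christoffelMatrix hUo i a a)).div_const _
  have hG := hg.matrixSmoothOn_christoffelMatrix hUo
  have hGs (k l i : Fin n) : christoffelMatrix g k x i l = christoffelMatrix g l x i k :=
    hg.gamma_symm hUo hx i k l
  set A : Matrix (Fin n) (Fin n) ℝ := projectiveWeight g gbar x • (gbar x)⁻¹ with hA
  have hL : Lfield g gbar x = A * g x := by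
    rw [hA, Matrix.smul_mul]
    rfl
  have hRH (l k : Fin n) : connCurvature (christoffelMatrix g) l k x * (g x)⁻¹ +
      (g x)⁻¹ * (connCurvature (christoffelMatrix g) l k x)ᵀ = 0 := by
    have h := curvature_identity hUo hx hG hGs hg.matrixSmoothOn_inv (lam := fun _ => 0)
      (fun i => contDiffOn_const) (fun y hy k => by simpa using hg.pdMatrix_inv hUo hy k) l k
    have h0 : (fun _ => 0 : Fin n → ℝ) = 0 := rfl
    simpa [pd_const, h0] using h
  have hRA := curvature_identity hUo hx hG hGs
    (B := fun y => projectiveWeight g gbar y • (gbar y)⁻¹)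
    (fun i j => hw.mul (hgbar.matrixSmoothOn_inv i j))
    (lam := fun y i => -(projectiveWeight g gbar y *
      ((gbar y)⁻¹ *ᵥ projectiveForm g gbar y) i))
    (fun i => by
      simp only [Matrix.mulVec, dotProduct]
      exact (hw.mul (ContDiffOn.sum fun a _ =>
        (hgbar.matrixSmoothOn_inv i a).mul (hform a))).neg)
    (fun y hy k => hproj.pdMatrix_weight_smul_inv hg hgbar hUo hy k)
  have key := ricci_contraction_comm (A := A) hgs (hg.inv_isSymm hx)
    (by rw [hA, Matrix.transpose_smul, hgbar.inv_isSymm hx]) hgH hHg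
    (connCurvature_swap (christoffelMatrix g)) (hg.bianchi hUo hx) hRH hRA
    (Ric := Matrix.of fun i j => Ricci g i j x) fun l s => ricci_eq_sum_connCurvature l s
  rw [hL]
  calc _ = (g x)⁻¹ * ((Matrix.of fun i j => Ricci g i j x) * A * g x) := by
        simp only [Matrix.mul_assoc]
    _ = (g x)⁻¹ * g x * A * (Matrix.of fun i j => Ricci g i j x) := by
        rw [← key]
        simp only [Matrix.mul_assoc]
    _ = A * (g x * (g x)⁻¹) * (Matrix.of fun i j => Ricci g i j x) := by
        rw [hHg, hgH, one_mul, mul_one]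
    _ = _ := by simp only [Matrix.mul_assoc]
end

section
/- Let g be a metric on U, let K be a Killing tensor for g, and let R be the Ricci tensor of g. Define the (1,1)-tensor field C := (g⁻¹R)(g⁻¹K) − (g⁻¹K)(g⁻¹R) and its covariant divergence D_j := Σ_i ∂_i C^i_j + Σ_{i,s} Γ^i_{is} C^s_j − Σ_{i,s} Γ^s_{ij} C^i_s. Let K̂ be the operator associated to the symmetric matrix field g⁻¹ K g⁻¹ and Δ_g the operator associated to g⁻¹. If D vanishes up to order k at a point p ∈ U, then for every smooth function f : U → ℝ the function Δ_g(K̂ f) − K̂(Δ_g f) vanishes up to order k at p. -/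
open Matrix

/-- Commuting calculus on a frame bundle: horizontal derivations `H a`, the inverse metric `h`, the
metric `g` and the curvature `Rm d c a b = R^d_{cab}`, all in components with respect to the
tautological frame. -/
structure FrameCalculus (ι B : Type*) [Fintype ι] [DecidableEq ι] [CommRing B] [Algebra ℝ B] where
  H : ι → Derivation ℝ B B
  h : ι → ι → B
  g : ι → ι → B
  Rm : ι → ι → ι → ι → B
  h_symm : ∀ a b, h a b = h b a
  g_symm : ∀ a b, g a b = g b a
  h_mul_g : ∀ a c, ∑ b, h a b * g b c = if a = c then 1 else 0
  H_h : ∀ c a b, H c (h a b) = 0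
  H_g : ∀ c a b, H c (g a b) = 0
  Rm_antisymm : ∀ d c a b, Rm d c a b = -Rm d c b a
  Rm_skew_h : ∀ d e a b, ∑ s, Rm d s a b * h s e = -∑ s, Rm e s a b * h s d
  Rm_skew_g : ∀ c d a b, ∑ s, g c s * Rm s d a b = -∑ s, g d s * Rm s c a b
  Rm_bianchi : ∀ d c a b, Rm d c a b + Rm d a b c + Rm d b c a = 0

namespace FrameCalculus

variable {ι B : Type*} [Fintype ι] [DecidableEq ι] [CommRing B] [Algebra ℝ B]
  (F : FrameCalculus ι B)

/-- The horizontal derivation with raised index. -/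
def G (a : ι) : Derivation ℝ B B := ∑ b, F.h a b • F.H b

lemma G_apply (a : ι) (x : B) : F.G a x = ∑ b, F.h a b * F.H b x := by
  have := map_sum (Derivation.coeFnAddMonoidHom (R := ℝ) (A := B) (M := B))
    (fun b => F.h a b • F.H b) Finset.univ
  have := congrFun this x
  rw [G, ← Derivation.coeFnAddMonoidHom_apply, this, Finset.sum_apply]
  rfl

lemma G_g (c a b : ι) : F.G c (F.g a b) = 0 := by simp [G_apply, H_g]

lemma H_G (a b : ι) (x : B) : F.H a (F.G b x) = ∑ c, F.h b c * F.H a (F.H c x) := by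
  simp [G_apply, H_h]

lemma comm_G_H (a b : ι) (x : B) :
    F.H b (F.G a x) = F.G a (F.H b x) + ∑ c, F.h a c * ⁅F.H b, F.H c⁆ x := by
  rw [H_G, G_apply, ← Finset.sum_add_distrib]
  refine Finset.sum_congr rfl fun c _ => ?_
  rw [Derivation.commutator_apply]; ring

lemma sum_G_mul_H (x y : B) : ∑ a, F.H a x * F.G a y = ∑ a, F.G a x * F.H a y := by
  simp only [G_apply, Finset.mul_sum, Finset.sum_mul]
  rw [Finset.sum_comm]
  refine Finset.sum_congr rfl fun a _ => Finset.sum_congr rfl fun b _ => ?_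
  rw [F.h_symm a b]; ring

lemma sum_G (X : ι → B) : ∑ a, F.G a (X a) = ∑ a, F.H a (∑ b, F.h a b * X b) := by
  simp only [G_apply, map_sum, Derivation.leibniz, H_h, smul_eq_mul, mul_zero, add_zero]
  rw [Finset.sum_comm]
  refine Finset.sum_congr rfl fun a _ => Finset.sum_congr rfl fun b _ => ?_
  rw [F.h_symm a b]

/-- The Laplacian. -/
def lap (x : B) : B := ∑ a, F.G a (F.H a x)

lemma lap_eq (x : B) : F.lap x = ∑ a, F.H a (F.G a x) := by
  rw [lap, sum_G]; simp [G_apply]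

/-- The Ricci tensor. -/
def Ric (a b : ι) : B := ∑ i, F.Rm i a i b

/-- The curvature with all indices lowered. -/
def L (c d a b : ι) : B := ∑ s, F.g c s * F.Rm s d a b

lemma Rm_eq (j d a b : ι) : F.Rm j d a b = ∑ e, F.h j e * F.L e d a b := by
  simp only [L, Finset.mul_sum]
  rw [Finset.sum_comm]
  simp only [← mul_assoc, ← Finset.sum_mul, h_mul_g]
  simp

lemma L_skew (c d a b : ι) : F.L c d a b = -F.L d c a b := F.Rm_skew_g c d a b

lemma L_antisymm (c d a b : ι) : F.L c d a b = -F.L c d b a := by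
  simp only [L, ← Finset.sum_neg_distrib]
  refine Finset.sum_congr rfl fun s _ => ?_
  rw [F.Rm_antisymm]; ring

lemma L_bianchi (d c a b : ι) : F.L d c a b + F.L d a b c + F.L d b c a = 0 := by
  simp only [L, ← Finset.sum_add_distrib]
  refine Finset.sum_eq_zero fun s _ => ?_
  rw [← mul_add, ← mul_add, F.Rm_bianchi, mul_zero]

lemma L_pair (a b c d : ι) : F.L a b c d = F.L c d a b := by
  have key : (2 : ℝ) • F.L a b c d = (2 : ℝ) • F.L c d a b := by
    rw [two_smul, two_smul]
    linear_combination F.L_bianchi a b c d - F.L_bianchi b c d a - F.L_bianchi c d a b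
      + F.L_bianchi d a b c + F.L_skew b d a c + F.L_skew b a c d + F.L_skew c a b d
      - F.L_antisymm a c b d + F.L_skew c b d a - F.L_skew d a b c - F.L_antisymm d b c a
      - F.L_skew d c a b
  exact smul_right_injective B (two_ne_zero' ℝ) key

lemma Ric_symm (a b : ι) : F.Ric a b = F.Ric b a := by
  simp only [Ric, Rm_eq]
  rw [Finset.sum_comm]
  refine Finset.sum_congr rfl fun i _ => Finset.sum_congr rfl fun e _ => ?_
  rw [F.h_symm, F.L_pair]

lemma sum_h_mul_Rm (d i : ι) :
    ∑ a, ∑ c, F.h a c * F.Rm d a i c = ∑ s, F.Ric s i * F.h s d := by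
  have h1 : ∀ c, ∑ a, F.h a c * F.Rm d a i c = -∑ s, F.Rm c s i c * F.h s d := fun c => by
    rw [← F.Rm_skew_h]
    exact Finset.sum_congr rfl fun a _ => mul_comm _ _
  rw [Finset.sum_comm]
  simp only [h1, Ric, Finset.sum_mul, ← Finset.sum_neg_distrib]
  rw [Finset.sum_comm]
  refine Finset.sum_congr rfl fun s _ => Finset.sum_congr rfl fun c _ => ?_
  rw [F.Rm_antisymm c s i c]; ring

/-- The components `v c` of a covector, seen through the action of the curvature. -/
def IsCovector (v : ι → B) : Prop :=
  ∀ a b c, ⁅F.H a, F.H b⁆ (v c) = -∑ d, F.Rm d c a b * v d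

/-- The components `v c` of a vector, seen through the action of the curvature. -/
def IsVector (v : ι → B) : Prop :=
  ∀ a b c, ⁅F.H a, F.H b⁆ (v c) = ∑ d, F.Rm c d a b * v d

/-- The components `T c i` of a (1,1)-tensor, with lower index `c`. -/
def IsMixed (T : ι → ι → B) : Prop :=
  ∀ a b c i, ⁅F.H a, F.H b⁆ (T c i) =
    ∑ d, F.Rm i d a b * T c d - ∑ d, F.Rm d c a b * T d i

/-- The components `K i j` of a contravariant tensor of rank two. -/
def IsBivector (K : ι → ι → B) : Prop :=
  ∀ a b i j, ⁅F.H a, F.H b⁆ (K i j) =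
    ∑ d, F.Rm i d a b * K d j + ∑ d, F.Rm j d a b * K i d

/-- The components `T c i j` of a (2,1)-tensor, with lower index `c`. -/
def IsMixedThree (T : ι → ι → ι → B) : Prop :=
  ∀ a b c i j, ⁅F.H a, F.H b⁆ (T c i j) =
    ∑ d, F.Rm i d a b * T c d j + ∑ d, F.Rm j d a b * T c i d - ∑ d, F.Rm d c a b * T d i j

variable {F}

lemma IsMixed.sum_commutator {T : ι → ι → B} (hT : F.IsMixed T) :
    ∑ a, ∑ i, ∑ c, F.h a c * ⁅F.H i, F.H c⁆ (T a i) = 0 := by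
  have h1 : ∑ a, ∑ i, ∑ c, F.h a c * ∑ d, F.Rm i d i c * T a d =
      ∑ a, ∑ c, ∑ d, F.h a c * F.Ric d c * T a d := by
    refine Finset.sum_congr rfl fun a _ => ?_
    rw [Finset.sum_comm]
    refine Finset.sum_congr rfl fun c _ => ?_
    simp only [Ric, Finset.mul_sum, Finset.sum_mul]
    rw [Finset.sum_comm]
    exact Finset.sum_congr rfl fun d _ => Finset.sum_congr rfl fun i _ => by ring
  have h2 : ∑ a, ∑ i, ∑ c, F.h a c * ∑ d, F.Rm d a i c * T d i =
      ∑ a, ∑ c, ∑ d, F.h a c * F.Ric d c * T a d := by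
    calc _ = ∑ d, ∑ i, (∑ a, ∑ c, F.h a c * F.Rm d a i c) * T d i := by
          simp only [Finset.mul_sum, Finset.sum_mul]
          rw [Finset.sum_comm, Finset.sum_comm (s := Finset.univ (α := ι))
            (f := fun d i => ∑ a, ∑ c, F.h a c * F.Rm d a i c * T d i)]
          refine Finset.sum_congr rfl fun i _ => ?_
          simp only [mul_assoc]
          exact Finset.sum_comm_cycle
      _ = _ := by
          simp only [sum_h_mul_Rm, Finset.sum_mul]
          refine Finset.sum_congr rfl fun d _ => ?_
          rw [Finset.sum_comm]
          refine Finset.sum_congr rfl fun s _ => Finset.sum_congr rfl fun i _ => ?_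
          rw [F.h_symm d s, F.Ric_symm i s]; ring
  simp only [hT _ _ _ _, mul_sub, Finset.sum_sub_distrib]
  rw [h1, h2, sub_self]

lemma lap_div {X : ι → B} (hX : F.IsVector X) (hHX : F.IsMixed fun a i => F.H a (X i)) :
    F.lap (∑ i, F.H i (X i)) =
      ∑ i, F.H i (F.lap (X i) - ∑ a, ∑ d, F.h i a * F.Ric d a * X d) := by
  have h1 : ∀ a, F.H a (∑ i, F.H i (X i)) = ∑ i, F.H i (F.H a (X i)) - ∑ d, F.Ric d a * X d := by
    intro a
    have : ∀ i, F.H a (F.H i (X i)) = F.H i (F.H a (X i)) - ∑ d, F.Rm i d i a * X d := fun i => by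
      rw [← hX, Derivation.commutator_apply]; ring
    simp only [map_sum, this, Finset.sum_sub_distrib, Ric, Finset.sum_mul]
    congr 1
    exact Finset.sum_comm
  have h2 : ∑ a, ∑ i, F.G a (F.H i (F.H a (X i))) = ∑ i, F.H i (F.lap (X i)) := by
    have := hHX.sum_commutator
    simp only [lap, map_sum, comm_G_H, Finset.sum_add_distrib]
    rw [Finset.sum_comm (f := fun i a => ∑ c, F.h a c * ⁅F.H i, F.H c⁆ (F.H a (X i))), this,
      add_zero, Finset.sum_comm]
  have h3 := F.sum_G fun a => ∑ d, F.Ric d a * X d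
  simp only [map_sum, lap] at h2
  simp only [map_sum, Finset.mul_sum] at h3
  simp only [lap, h1, map_sub, Finset.sum_sub_distrib, map_sum, h2, h3, mul_assoc]

lemma H_lap {f : B} (hf : ∀ a b, ⁅F.H a, F.H b⁆ f = 0) (hdf : F.IsCovector fun a => F.H a f)
    (j : ι) : F.H j (F.lap f) =
      F.lap (F.H j f) - ∑ s, ∑ d, F.Ric s j * F.h s d * F.H d f := by
  have hs : ∀ a b, F.H a (F.H b f) = F.H b (F.H a f) := fun a b =>
    sub_eq_zero.1 (hf a b)
  have h2 : ∑ a, ∑ c, F.h a c * ⁅F.H j, F.H c⁆ (F.H a f) =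
      -∑ s, ∑ d, F.Ric s j * F.h s d * F.H d f := by
    simp only [hdf _ _ _, mul_neg, Finset.sum_neg_distrib, Finset.mul_sum]
    congr 1
    calc _ = ∑ d, (∑ a, ∑ c, F.h a c * F.Rm d a j c) * F.H d f := by
          simp only [Finset.sum_mul, mul_assoc]
          exact Finset.sum_comm_cycle
      _ = _ := by
          simp only [sum_h_mul_Rm, Finset.sum_mul]
          rw [Finset.sum_comm]
  simp only [lap, map_sum, comm_G_H, Finset.sum_add_distrib]
  rw [h2, sub_eq_add_neg]
  congr 1
  exact Finset.sum_congr rfl fun a _ => by rw [hs j a]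

/-- A symmetric contravariant Killing tensor in frame components. -/
structure IsKilling (F : FrameCalculus ι B) (K : ι → ι → B) : Prop where
  symm : ∀ i j, K i j = K j i
  cyclic : ∀ a i j, F.G a (K i j) + F.G i (K j a) + F.G j (K a i) = 0
  bivector : F.IsBivector K
  mixedThree : F.IsMixedThree fun c i j => F.H c (K i j)

/-- The contraction of the curvature with a bivector, with raised indices. -/
def curvContr (F : FrameCalculus ι B) (K : ι → ι → B) (j a : ι) : B :=
  ∑ c, ∑ i, ∑ d, F.h a c * F.Rm j d i c * K i d

/-- The product of the Ricci tensor with a bivector. -/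
def ricMul (F : FrameCalculus ι B) (K : ι → ι → B) (a j : ι) : B :=
  ∑ c, ∑ d, F.h a c * F.Ric d c * K d j

namespace IsKilling

variable {K : ι → ι → B} (hK : F.IsKilling K)
include hK

lemma curvContr_symm (a j : ι) : F.curvContr K a j = F.curvContr K j a := by
  have h1 : ∀ a j, F.curvContr K a j =
      ∑ c, ∑ e, ∑ i, ∑ d, F.h j c * F.h a e * F.L e d i c * K i d := fun a j => by
    simp only [curvContr, Rm_eq, Finset.mul_sum, Finset.sum_mul]
    refine Finset.sum_congr rfl fun c _ => ?_
    rw [Finset.sum_comm_cycle]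
    exact Finset.sum_congr rfl fun e _ => Finset.sum_congr rfl fun i _ =>
      Finset.sum_congr rfl fun d _ => by ring
  rw [h1, h1, Finset.sum_comm]
  refine Finset.sum_congr rfl fun c _ => Finset.sum_congr rfl fun e _ => ?_
  rw [Finset.sum_comm]
  refine Finset.sum_congr rfl fun i _ => Finset.sum_congr rfl fun d _ => ?_
  rw [hK.symm d i, F.L_pair, F.L_skew, F.L_antisymm]; ring

lemma commutator_trace (a b : ι) : ⁅F.H a, F.H b⁆ (∑ i, ∑ j, F.g i j * K i j) = 0 := by
  have hg : ∀ i j, ⁅F.H a, F.H b⁆ (F.g i j) = 0 := fun i j => by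
    simp [Derivation.commutator_apply, H_g]
  have h1 : ∑ i, ∑ j, F.g i j * ∑ d, F.Rm i d a b * K d j = ∑ j, ∑ d, F.L j d a b * K d j := by
    simp only [L, Finset.mul_sum, Finset.sum_mul]
    rw [Finset.sum_comm]
    refine Finset.sum_congr rfl fun j _ => ?_
    rw [Finset.sum_comm]
    refine Finset.sum_congr rfl fun d _ => Finset.sum_congr rfl fun i _ => ?_
    rw [F.g_symm]; ring
  have h2 : ∑ i, ∑ j, F.g i j * ∑ d, F.Rm j d a b * K i d = ∑ j, ∑ d, F.L j d a b * K d j := by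
    simp only [L, Finset.mul_sum, Finset.sum_mul]
    refine Finset.sum_congr rfl fun i _ => ?_
    rw [Finset.sum_comm]
    refine Finset.sum_congr rfl fun d _ => Finset.sum_congr rfl fun j _ => ?_
    rw [hK.symm]; ring
  have h3 : ∑ j, ∑ d, F.L j d a b * K d j + ∑ j, ∑ d, F.L j d a b * K d j = 0 := by
    nth_rw 1 [Finset.sum_comm]
    simp only [← Finset.sum_add_distrib]
    refine Finset.sum_eq_zero fun i _ => Finset.sum_eq_zero fun j _ => ?_
    rw [F.L_skew, hK.symm]; ring
  simp only [map_sum, Derivation.leibniz, hg, smul_eq_mul, mul_zero, add_zero,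
    hK.bivector _ _ _ _, mul_add, Finset.sum_add_distrib, h1, h2, h3]

lemma two_mul_div (j : ι) :
    2 * ∑ i, F.H i (K i j) = -F.G j (∑ a, ∑ b, F.g a b * K a b) := by
  have h1 : ∑ a, ∑ b, F.g a b * F.G a (K b j) = ∑ i, F.H i (K i j) := by
    rw [Finset.sum_comm]
    refine Finset.sum_congr rfl fun b _ => ?_
    simp only [G_apply, Finset.mul_sum]
    rw [Finset.sum_comm]
    have : ∀ c, ∑ a, F.g a b * (F.h a c * F.H c (K b j)) =
        (∑ a, F.h c a * F.g a b) * F.H c (K b j) := fun c => by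
      rw [Finset.sum_mul]
      exact Finset.sum_congr rfl fun a _ => by rw [F.h_symm]; ring
    simp [this, h_mul_g]
  have h2 : ∑ a, ∑ b, F.g a b * F.G b (K j a) = ∑ i, F.H i (K i j) := by
    rw [← h1, Finset.sum_comm]
    exact Finset.sum_congr rfl fun b _ => Finset.sum_congr rfl fun a _ => by
      rw [F.g_symm, hK.symm]
  have h3 : ∀ a b, F.G j (K a b) = -F.G a (K b j) - F.G b (K j a) := fun a b => by
    linear_combination hK.cyclic j a b
  simp only [map_sum, Derivation.leibniz, G_g, smul_eq_mul, mul_zero, add_zero, h3, mul_sub,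
    mul_neg, Finset.sum_sub_distrib, Finset.sum_neg_distrib, h1, h2]
  ring

lemma G_div_symm (a j : ι) : F.G a (∑ i, F.H i (K i j)) = F.G j (∑ i, F.H i (K i a)) := by
  have h1 : ∀ a j (x : B), F.G a (F.G j x) =
      ∑ b, ∑ c, F.h a b * F.h j c * F.H b (F.H c x) := fun a j x => by
    simp only [G_apply F a, H_G, Finset.mul_sum, mul_assoc]
  have h2 : ∀ x, (∀ a b, ⁅F.H a, F.H b⁆ x = 0) → F.G a (F.G j x) = F.G j (F.G a x) := by
    intro x hx
    rw [h1, h1, Finset.sum_comm]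
    refine Finset.sum_congr rfl fun b _ => Finset.sum_congr rfl fun c _ => ?_
    have : F.H c (F.H b x) = F.H b (F.H c x) := sub_eq_zero.1 (hx c b)
    rw [this]; ring
  have h3 := h2 _ hK.commutator_trace
  have h4 : ∀ a j, (2 : ℝ) • F.G a (∑ i, F.H i (K i j)) =
      -F.G a (F.G j (∑ a, ∑ b, F.g a b * K a b)) := fun a j => by
    rw [← map_neg, ← hK.two_mul_div, two_smul, two_mul, map_add]
  refine smul_right_injective B (two_ne_zero' ℝ) ?_
  simp only [h4, h3]

lemma sum_H_G (a j : ι) : ∑ i, F.H i (F.G a (K i j)) =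
    F.G a (∑ i, F.H i (K i j)) + F.ricMul K a j + F.curvContr K j a := by
  simp only [comm_G_H, Finset.sum_add_distrib, map_sum, hK.bivector _ _ _ _, mul_add,
    ← add_assoc, ricMul, curvContr, Ric, Finset.mul_sum, Finset.sum_mul]
  congr 1
  · congr 1
    rw [Finset.sum_comm]
    refine Finset.sum_congr rfl fun c _ => ?_
    rw [Finset.sum_comm]
    exact Finset.sum_congr rfl fun d _ => Finset.sum_congr rfl fun i _ => by ring
  · rw [Finset.sum_comm]
    exact Finset.sum_congr rfl fun c _ => Finset.sum_congr rfl fun i _ =>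
      Finset.sum_congr rfl fun d _ => by ring

lemma commutator_G (a b i j k : ι) : ⁅F.H a, F.H b⁆ (F.G i (K j k)) =
    ∑ d, F.Rm i d a b * F.G d (K j k) + ∑ d, F.Rm j d a b * F.G i (K d k)
      + ∑ d, F.Rm k d a b * F.G i (K j d) := by
  have hh : ∀ i j, ⁅F.H a, F.H b⁆ (F.h i j) = 0 := fun i j => by
    simp [Derivation.commutator_apply, H_h]
  have h1 : ∑ c, F.h i c * ∑ d, F.Rm d c a b * F.H d (K j k) =
      -∑ d, F.Rm i d a b * F.G d (K j k) := by
    simp only [G_apply, Finset.mul_sum]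
    rw [Finset.sum_comm, Finset.sum_comm (f := fun d c => F.Rm i d a b * _),
      ← Finset.sum_neg_distrib]
    refine Finset.sum_congr rfl fun d _ => ?_
    simp only [← mul_assoc, ← Finset.sum_mul, ← F.Rm_skew_h, ← neg_mul]
    congr 1
    exact Finset.sum_congr rfl fun c _ => by rw [F.h_symm]; ring
  have h2 : ∀ (l : ι) (u : ι → B), ∑ c, F.h i c * ∑ d, F.Rm l d a b * F.H c (u d) =
      ∑ d, F.Rm l d a b * F.G i (u d) := fun l u => by
    simp only [G_apply, Finset.mul_sum]
    rw [Finset.sum_comm]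
    exact Finset.sum_congr rfl fun d _ => Finset.sum_congr rfl fun c _ => by ring
  simp only [G_apply F i, map_sum, Derivation.leibniz, hh, smul_eq_mul, mul_zero, add_zero,
    hK.mixedThree _ _ _ _ _, mul_add, mul_sub, Finset.sum_add_distrib, Finset.sum_sub_distrib,
    h1, h2 j fun d => K d k, h2 k fun d => K j d]
  ring

lemma sum_commutator_G (j : ι) : ∑ i, ∑ a, ⁅F.H i, F.H a⁆ (F.G i (K j a)) =
    ∑ i, ∑ a, ∑ d, F.Rm j d i a * F.G i (K d a) := by
  have h1 : ∑ i, ∑ a, ∑ d, F.Rm i d i a * F.G d (K j a) = ∑ d, ∑ a, F.Ric d a * F.G d (K j a) := by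
    simp only [Ric, Finset.sum_mul]
    rw [Finset.sum_comm_cycle]
    exact Finset.sum_congr rfl fun d _ => Finset.sum_comm
  have h2 : ∑ i, ∑ a, ∑ d, F.Rm a d i a * F.G i (K j d) =
      -∑ d, ∑ a, F.Ric d a * F.G d (K j a) := by
    rw [← Finset.sum_neg_distrib]
    refine Finset.sum_congr rfl fun i _ => ?_
    rw [Finset.sum_comm, ← Finset.sum_neg_distrib]
    refine Finset.sum_congr rfl fun d _ => ?_
    rw [F.Ric_symm, Ric, ← neg_mul, ← Finset.sum_neg_distrib, Finset.sum_mul]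
    exact Finset.sum_congr rfl fun a _ => by rw [F.Rm_antisymm]
  simp only [hK.commutator_G, Finset.sum_add_distrib, h1, h2]
  ring

lemma three_mul_div_lap (j : ι) :
    3 * ∑ i, F.H i (F.lap (K i j)) =
      ∑ i, F.H i (F.ricMul K i j - F.ricMul K j i)
        - 2 * ∑ i, ∑ a, ∑ d, F.Rm j d i a * F.G i (K d a) := by
  set Z := ∑ i, ∑ a, ∑ d, F.Rm j d i a * F.G i (K d a) with hZ
  have hZ' := hK.sum_commutator_G j
  rw [← hZ] at hZ'
  simp only [Derivation.commutator_apply, Finset.sum_sub_distrib] at hZ'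
  have hA : ∑ i, F.H i (F.lap (K i j)) = ∑ i, ∑ a, F.H a (F.H i (F.G i (K j a))) := by
    simp only [lap_eq, map_sum]
    rw [Finset.sum_comm]
    exact Finset.sum_congr rfl fun i _ => Finset.sum_congr rfl fun a _ => by rw [hK.symm]
  have hB : ∑ i, ∑ a, F.H i (F.H a (F.G j (K a i))) = ∑ i, F.H i
      (F.G j (∑ k, F.H k (K k i)) + F.ricMul K j i + F.curvContr K i j) := by
    refine Finset.sum_congr rfl fun i _ => ?_
    rw [← hK.sum_H_G, map_sum]
  have hA' : ∑ i, ∑ a, F.H i (F.H a (F.G i (K j a))) = ∑ i, F.H i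
      (F.G i (∑ k, F.H k (K k j)) + F.ricMul K i j + F.curvContr K j i) := by
    refine Finset.sum_congr rfl fun i _ => ?_
    rw [← hK.sum_H_G, map_sum]
    exact Finset.sum_congr rfl fun a _ => by rw [hK.symm]
  have hcyc : ∑ i, ∑ a, F.H i (F.H a (F.G i (K j a))) + ∑ i, ∑ a, F.H a (F.H i (F.G i (K j a))) +
    ∑ i, ∑ a, F.H i (F.H a (F.G j (K a i))) = 0 := by
    rw [Finset.sum_comm (f := fun i a => F.H a (F.H i (F.G i (K j a))))]
    simp only [← Finset.sum_add_distrib, ← map_add]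
    refine Finset.sum_eq_zero fun i _ => Finset.sum_eq_zero fun a _ => ?_
    have := hK.cyclic i j a
    rw [hK.symm a i] at this ⊢
    rw [hK.symm j i]
    rw [show F.G i (K j a) + F.G a (K i j) + F.G j (K i a) = 0 by linear_combination this,
      map_zero, map_zero]
  simp only [map_add, map_sub, Finset.sum_add_distrib, Finset.sum_sub_distrib] at hA' hB ⊢
  simp only [hK.curvContr_symm j, hK.G_div_symm j] at hA' hB
  linear_combination 3 * hA + hcyc + hA' - hB - 2 * hZ'

omit hK in
lemma lap_mul (x y : B) :
    F.lap (x * y) = F.lap x * y + 2 * ∑ a, F.G a x * F.H a y + x * F.lap y := by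
  have h := F.sum_G_mul_H x y
  simp only [lap, Derivation.leibniz, map_add, smul_eq_mul, Finset.sum_add_distrib,
    ← Finset.mul_sum] at h ⊢
  have e2 : ∑ a, F.H a y * F.G a x = ∑ a, F.G a x * F.H a y :=
    Finset.sum_congr rfl fun _ _ => mul_comm _ _
  rw [e2, h]
  ring

lemma three_mul_sum_G_mul_H {f : B} (hf : ∀ a b, ⁅F.H a, F.H b⁆ f = 0)
    (hdf : F.IsCovector fun a => F.H a f) :
    3 * ∑ i, ∑ a, ∑ j, F.G i (K a j) * F.H i (F.H a (F.H j f)) =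
      -2 * ∑ j, (∑ i, ∑ a, ∑ d, F.Rm j d i a * F.G i (K d a)) * F.H j f := by
  have hs : ∀ a b, F.H a (F.H b f) = F.H b (F.H a f) := fun a b => sub_eq_zero.1 (hf a b)
  have hT : ∀ a i j, F.H a (F.H i (F.H j f)) =
      F.H i (F.H a (F.H j f)) + ∑ d, F.Rm d j i a * F.H d f := fun a i j => by
    have := hdf a i j
    simp only [F.Rm_antisymm _ j a i, neg_mul, Finset.sum_neg_distrib, neg_neg] at this
    rw [← this, Derivation.commutator_apply]; ring
  have h1 : ∑ i, ∑ a, ∑ j, F.G i (K a j) * ∑ d, F.Rm d j i a * F.H d f =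
      ∑ j, (∑ i, ∑ a, ∑ d, F.Rm j d i a * F.G i (K d a)) * F.H j f := by
    simp only [Finset.mul_sum, Finset.sum_mul]
    rw [Finset.sum_comm (f := fun j i => ∑ a, ∑ d, F.Rm j d i a * F.G i (K d a) * F.H j f)]
    refine Finset.sum_congr rfl fun i _ => ?_
    rw [Finset.sum_comm (f := fun j a => ∑ d, F.Rm j d i a * F.G i (K d a) * F.H j f)]
    refine Finset.sum_congr rfl fun a _ => ?_
    rw [Finset.sum_comm]
    refine Finset.sum_congr rfl fun d _ => Finset.sum_congr rfl fun j _ => ?_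
    rw [hK.symm]; ring
  set X := ∑ i, ∑ a, ∑ j, F.G i (K a j) * F.H i (F.H a (F.H j f)) with hX
  have h2 : ∑ i, ∑ a, ∑ j, F.G a (K i j) * F.H i (F.H a (F.H j f)) =
      X + ∑ i, ∑ a, ∑ j, F.G i (K a j) * ∑ d, F.Rm d j i a * F.H d f := by
    rw [Finset.sum_comm]
    simp only [hX, ← Finset.sum_add_distrib, ← mul_add, ← hT]
  have h3 : ∑ i, ∑ a, ∑ j, F.G j (K a i) * F.H i (F.H a (F.H j f)) =
      ∑ i, ∑ a, ∑ j, F.G a (K i j) * F.H i (F.H a (F.H j f)) := by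
    refine Finset.sum_congr rfl fun i _ => ?_
    rw [Finset.sum_comm]
    refine Finset.sum_congr rfl fun a _ => Finset.sum_congr rfl fun j _ => ?_
    rw [hK.symm j i, hs]
  have h4 : ∑ i, ∑ a, ∑ j, F.G i (K a j) * F.H i (F.H a (F.H j f)) +
      ∑ i, ∑ a, ∑ j, F.G a (K i j) * F.H i (F.H a (F.H j f)) +
      ∑ i, ∑ a, ∑ j, F.G j (K a i) * F.H i (F.H a (F.H j f)) = 0 := by
    simp only [← Finset.sum_add_distrib, ← add_mul]
    refine Finset.sum_eq_zero fun i _ => Finset.sum_eq_zero fun a _ =>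
      Finset.sum_eq_zero fun j _ => ?_
    have := hK.cyclic i a j
    rw [hK.symm j i, hK.symm i a] at this
    rw [this, zero_mul]
  rw [h3, h2, h1, ← hX] at h4
  linear_combination h4

/-- The commutator of the Laplacian with the operator of a Killing tensor is a first order
operator, whose coefficients are the divergence of the commutator of Ricci and Killing tensors. -/
theorem three_mul_commutator {f : B} (hf : ∀ a b, ⁅F.H a, F.H b⁆ f = 0)
    (hdf : F.IsCovector fun a => F.H a f) (hX : F.IsVector fun i => ∑ j, K i j * F.H j f)
    (hHX : F.IsMixed fun a i => F.H a (∑ j, K i j * F.H j f)) :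
    3 * (F.lap (∑ i, F.H i (∑ j, K i j * F.H j f)) - ∑ i, F.H i (∑ j, K i j * F.H j (F.lap f))) =
      -2 * ∑ j, (∑ i, F.H i (F.ricMul K i j - F.ricMul K j i)) * F.H j f := by
  have hs : ∀ a b, F.H a (F.H b f) = F.H b (F.H a f) := fun a b => sub_eq_zero.1 (hf a b)
  have hY : ∀ i, F.lap (∑ j, K i j * F.H j f) -
      ∑ a, ∑ d, F.h i a * F.Ric d a * (∑ j, K d j * F.H j f) -
      ∑ j, K i j * F.H j (F.lap f) =
      ∑ j, F.lap (K i j) * F.H j f - ∑ a, ∑ j, F.G i (K a j) * F.H a (F.H j f)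
        - ∑ j, (F.ricMul K i j - F.ricMul K j i) * F.H j f := by
    intro i
    have e1 : ∑ a, ∑ d, F.h i a * F.Ric d a * (∑ j, K d j * F.H j f) =
        ∑ j, F.ricMul K i j * F.H j f := by
      simp only [ricMul, Finset.mul_sum, Finset.sum_mul]
      rw [Finset.sum_comm_cycle]
      exact Finset.sum_congr rfl fun _ _ => Finset.sum_congr rfl fun _ _ =>
        Finset.sum_congr rfl fun _ _ => by ring
    have e2 : ∑ j, K i j * ∑ s, ∑ d, F.Ric s j * F.h s d * F.H d f =
        ∑ j, F.ricMul K j i * F.H j f := by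
      simp only [ricMul, Finset.mul_sum, Finset.sum_mul]
      rw [Finset.sum_comm_cycle]
      refine Finset.sum_congr rfl fun j _ => ?_
      rw [Finset.sum_comm]
      refine Finset.sum_congr rfl fun s _ => Finset.sum_congr rfl fun d _ => ?_
      rw [F.Ric_symm, F.h_symm, hK.symm]; ring
    have e3 : 2 * ∑ j, ∑ a, F.G a (K i j) * F.H a (F.H j f) =
        -∑ a, ∑ j, F.G i (K a j) * F.H a (F.H j f) := by
      have e4 : ∑ j, ∑ a, F.G j (K a i) * F.H a (F.H j f) =
          ∑ j, ∑ a, F.G a (K i j) * F.H a (F.H j f) := by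
        rw [Finset.sum_comm]
        exact Finset.sum_congr rfl fun _ _ => Finset.sum_congr rfl fun _ _ => by
          rw [hK.symm, hs]
      have e5 : ∑ j, ∑ a, F.G a (K i j) * F.H a (F.H j f) +
          ∑ j, ∑ a, F.G i (K j a) * F.H a (F.H j f) +
          ∑ j, ∑ a, F.G j (K a i) * F.H a (F.H j f) = 0 := by
        simp only [← Finset.sum_add_distrib, ← add_mul, hK.cyclic, zero_mul,
          Finset.sum_const_zero]
      rw [e4] at e5
      rw [Finset.sum_comm (f := fun j a => F.G i (K j a) * F.H a (F.H j f))] at e5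
      have e6 : ∑ a, ∑ j, F.G i (K a j) * F.H a (F.H j f) =
        ∑ a, ∑ j, F.G i (K j a) * F.H a (F.H j f) :=
        Finset.sum_congr rfl fun _ _ => Finset.sum_congr rfl fun _ _ => by rw [hK.symm]
      rw [e6]
      linear_combination e5
    have e7 : F.lap (∑ j, K i j * F.H j f) = ∑ j, F.lap (K i j * F.H j f) := by
      simp only [lap, map_sum]
      exact Finset.sum_comm
    rw [e7, e1]
    simp only [lap_mul, F.H_lap hf hdf, mul_sub, Finset.sum_add_distrib,
      Finset.sum_sub_distrib, e2, sub_mul, ← Finset.mul_sum, e3]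
    ring
  have hC : ∑ i, ∑ j, (F.ricMul K i j - F.ricMul K j i) * F.H i (F.H j f) = 0 := by
    simp only [sub_mul, Finset.sum_sub_distrib]
    rw [sub_eq_zero, Finset.sum_comm]
    exact Finset.sum_congr rfl fun _ _ => Finset.sum_congr rfl fun _ _ => by rw [hs]
  have hZ := hK.three_mul_sum_G_mul_H hf hdf
  have hdl : 3 * ∑ i, ∑ j, F.H i (F.lap (K i j)) * F.H j f =
      ∑ j, (∑ i, F.H i (F.ricMul K i j - F.ricMul K j i)) * F.H j f
       - 2 * ∑ j, (∑ i, ∑ a, ∑ d, F.Rm j d i a * F.G i (K d a)) * F.H j f := by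
    rw [Finset.sum_comm, Finset.mul_sum, Finset.mul_sum, ← Finset.sum_sub_distrib]
    refine Finset.sum_congr rfl fun j _ => ?_
    rw [← Finset.sum_mul]
    linear_combination F.H j f * hK.three_mul_div_lap j
  have hlap : ∑ i, ∑ a, ∑ j, F.H i (F.G i (K a j)) * F.H a (F.H j f) =
      ∑ i, ∑ j, F.lap (K i j) * F.H i (F.H j f) := by
    simp only [lap_eq, Finset.sum_mul]
    rw [Finset.sum_comm_cycle]
    rw [Finset.sum_comm_cycle]
  rw [lap_div hX hHX, ← Finset.sum_sub_distrib]
  simp only [← map_sub, hY]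
  have hdiv : ∑ j, (∑ i, F.H i (F.ricMul K i j - F.ricMul K j i)) * F.H j f =
      ∑ i, ∑ j, F.H i (F.ricMul K i j - F.ricMul K j i) * F.H j f := by
    rw [Finset.sum_comm]
    simp only [Finset.sum_mul]
  rw [hdiv] at hdl ⊢
  simp only [map_sub, map_sum, Derivation.leibniz, smul_eq_mul, mul_comm (F.H _ f),
    mul_comm (F.H _ (F.H _ f)), Finset.sum_sub_distrib, Finset.sum_add_distrib, hlap] at hdl hC ⊢
  simp only [hC]
  linear_combination hdl - hZ

end IsKilling

end FrameCalculus

section MatrixDerivation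

variable {ι B : Type*} [Fintype ι] [CommRing B] [Algebra ℝ B] (δ : Derivation ℝ B B)

lemma Derivation.matrix_map_mul (M N : Matrix ι ι B) :
    (M * N).map δ = M.map δ * N + M * N.map δ := by
  ext i j
  simp only [Matrix.map_apply, Matrix.mul_apply, Matrix.add_apply, map_sum, Derivation.leibniz,
    smul_eq_mul, Finset.sum_add_distrib]
  rw [add_comm]
  congr 1
  exact Finset.sum_congr rfl fun _ _ => mul_comm _ _

omit [Fintype ι] in
lemma Derivation.matrix_map_one [DecidableEq ι] : (1 : Matrix ι ι B).map δ = 0 := by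
  ext i j
  simp only [Matrix.map_apply, Matrix.one_apply, Matrix.zero_apply]
  split_ifs <;> simp

end MatrixDerivation

/-- The algebra of a frame bundle: `A` consists of the functions on the base, with commuting
derivations `D k`, a metric `g`, its inverse `h` and Christoffel matrices `(Γ k) s j = Γ^s_{kj}`;
`B` consists of the functions on the frame bundle, with the tautological frame `e`, its inverse `θ`
and the standard horizontal derivations `H c`. -/
structure FrameBundle (ι A B : Type*) [Fintype ι] [DecidableEq ι] [CommRing A] [Algebra ℝ A]
    [CommRing B] [Algebra ℝ B] where
  D : ι → Derivation ℝ A A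
  D_comm : ∀ i j x, D i (D j x) = D j (D i x)
  g : Matrix ι ι A
  h : Matrix ι ι A
  g_symm : gᵀ = g
  h_symm : hᵀ = h
  h_mul_g : h * g = 1
  Γ : ι → Matrix ι ι A
  Γ_symm : ∀ s i j, Γ i s j = Γ j s i
  D_g : ∀ k, g.map (D k) = (Γ k)ᵀ * g + g * Γ k
  φ : A →+* B
  e : Matrix ι ι B
  θ : Matrix ι ι B
  θ_mul_e : θ * e = 1
  e_mul_θ : e * θ = 1
  H : ι → Derivation ℝ B B
  H_φ : ∀ c x, H c (φ x) = ∑ k, e k c * φ (D k x)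
  H_e : ∀ c, e.map (H c) = -((∑ k, e k c • (Γ k).map φ) * e)

namespace FrameBundle

variable {ι A B : Type*} [Fintype ι] [DecidableEq ι] [CommRing A] [Algebra ℝ A]
    [CommRing B] [Algebra ℝ B] (P : FrameBundle ι A B)

/-- The matrix of the connection along `H c`, in coordinates. -/
def conn (c : ι) : Matrix ι ι B := ∑ k, P.e k c • (P.Γ k).map P.φ

lemma map_e (c : ι) : P.e.map (P.H c) = -(P.conn c * P.e) := P.H_e c

lemma map_θ_of_map_e (δ : Derivation ℝ B B) {M : Matrix ι ι B}
    (hδ : P.e.map δ = -(M * P.e)) : P.θ.map δ = P.θ * M := by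
  have h1 := δ.matrix_map_mul P.θ P.e
  rw [P.θ_mul_e, δ.matrix_map_one, hδ] at h1
  calc P.θ.map δ = (P.θ.map δ * P.e) * P.θ := by
        rw [Matrix.mul_assoc, P.e_mul_θ, Matrix.mul_one]
    _ = (P.θ * M * P.e) * P.θ := by
        congr 1
        rw [Matrix.mul_neg, ← sub_eq_add_neg, eq_comm, sub_eq_zero] at h1
        rw [h1, Matrix.mul_assoc]
    _ = P.θ * M := by rw [Matrix.mul_assoc, P.e_mul_θ, Matrix.mul_one]

lemma map_θ (c : ι) : P.θ.map (P.H c) = P.θ * P.conn c := P.map_θ_of_map_e _ (P.map_e c)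

lemma map_map_φ (c : ι) (T : Matrix ι ι A) :
    (T.map P.φ).map (P.H c) = ∑ k, P.e k c • (T.map (P.D k)).map P.φ := by
  ext i j
  simp [Matrix.sum_apply, P.H_φ]

/-- The covariant derivative of a covariant tensor of rank two. -/
def covLow (K : Matrix ι ι A) (k : ι) : Matrix ι ι A :=
  K.map (P.D k) - (P.Γ k)ᵀ * K - K * P.Γ k

/-- The covariant derivative of a contravariant tensor of rank two. -/
def covUp (K : Matrix ι ι A) (k : ι) : Matrix ι ι A :=
  K.map (P.D k) + P.Γ k * K + K * (P.Γ k)ᵀ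

/-- Frame components of a covariant tensor of rank two. -/
def low (K : Matrix ι ι A) : Matrix ι ι B := P.eᵀ * K.map P.φ * P.e

/-- Frame components of a contravariant tensor of rank two. -/
def up (K : Matrix ι ι A) : Matrix ι ι B := P.θ * K.map P.φ * P.θᵀ

lemma map_low (K : Matrix ι ι A) (c : ι) :
    (P.low K).map (P.H c) = ∑ k, P.e k c • P.low (P.covLow K k) := by
  have h1 : ∀ k, P.low (P.covLow K k) = P.eᵀ * ((K.map (P.D k)).map P.φ
      - ((P.Γ k).map P.φ)ᵀ * K.map P.φ - K.map P.φ * (P.Γ k).map P.φ) * P.e := fun k => by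
    simp only [low, covLow, Matrix.map_sub P.φ (map_sub P.φ), Matrix.map_mul, Matrix.transpose_map]
  rw [low, Derivation.matrix_map_mul, Derivation.matrix_map_mul, Matrix.transpose_map,
    map_e, map_map_φ]
  simp only [h1, conn, Matrix.mul_sub, Matrix.sub_mul, smul_sub, Finset.sum_sub_distrib,
    Matrix.transpose_neg, Matrix.transpose_mul, Matrix.transpose_sum, Matrix.transpose_smul,
    Matrix.sum_mul, Matrix.mul_sum, Matrix.smul_mul, Matrix.mul_smul, Matrix.mul_assoc,
    Matrix.mul_neg, Matrix.neg_mul, Matrix.add_mul]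
  abel

lemma map_up (K : Matrix ι ι A) (c : ι) :
    (P.up K).map (P.H c) = ∑ k, P.e k c • P.up (P.covUp K k) := by
  have h1 : ∀ k, P.up (P.covUp K k) = P.θ * ((K.map (P.D k)).map P.φ
      + (P.Γ k).map P.φ * K.map P.φ + K.map P.φ * ((P.Γ k).map P.φ)ᵀ) * P.θᵀ := fun k => by
    simp only [up, covUp, Matrix.map_add P.φ (map_add P.φ), Matrix.map_mul, Matrix.transpose_map]
  rw [up, Derivation.matrix_map_mul, Derivation.matrix_map_mul, Matrix.transpose_map,
    map_θ, map_map_φ]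
  simp only [h1, conn, Matrix.mul_add, smul_add, Finset.sum_add_distrib,
    Matrix.transpose_mul, Matrix.transpose_sum, Matrix.transpose_smul,
    Matrix.sum_mul, Matrix.mul_sum, Matrix.smul_mul, Matrix.mul_smul, Matrix.mul_assoc,
    Matrix.add_mul]
  abel

lemma low_transpose (K : Matrix ι ι A) : (P.low K)ᵀ = P.low Kᵀ := by
  simp only [low, Matrix.transpose_mul, Matrix.transpose_transpose, Matrix.transpose_map,
    Matrix.mul_assoc]

lemma up_transpose (K : Matrix ι ι A) : (P.up K)ᵀ = P.up Kᵀ := by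
  simp only [up, Matrix.transpose_mul, Matrix.transpose_transpose, Matrix.transpose_map,
    Matrix.mul_assoc]

lemma θT_mul_eT : P.θᵀ * P.eᵀ = 1 := by
  rw [← Matrix.transpose_mul, P.e_mul_θ, Matrix.transpose_one]

lemma up_mul_low (K L : Matrix ι ι A) :
    P.up K * P.low L = P.θ * (K * L).map P.φ * P.e := by
  rw [up, low, Matrix.map_mul]
  calc _ = P.θ * K.map P.φ * (P.θᵀ * P.eᵀ) * L.map P.φ * P.e := by simp only [Matrix.mul_assoc]
    _ = _ := by rw [θT_mul_eT, Matrix.mul_one]; simp only [Matrix.mul_assoc]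

lemma up_mul_low_mul_up (K L M : Matrix ι ι A) :
    P.up K * P.low L * P.up M = P.up (K * L * M) := by
  rw [up_mul_low, up, up, Matrix.map_mul (L := K * L)]
  calc _ = P.θ * (K * L).map P.φ * (P.e * P.θ) * M.map P.φ * P.θᵀ := by
        simp only [Matrix.mul_assoc]
    _ = _ := by rw [e_mul_θ, Matrix.mul_one]; simp only [Matrix.mul_assoc]

lemma up_h_mul_low_g : P.up P.h * P.low P.g = 1 := by
  rw [up_mul_low, P.h_mul_g, Matrix.map_one _ (map_zero _) (map_one _), Matrix.mul_one, P.θ_mul_e]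

lemma map_low_g (c : ι) : (P.low P.g).map (P.H c) = 0 := by
  rw [map_low]
  refine Finset.sum_eq_zero fun k _ => ?_
  rw [covLow, P.D_g, low]
  simp

lemma map_up_h (c : ι) : (P.up P.h).map (P.H c) = 0 := by
  have h1 := (P.H c).matrix_map_mul (P.up P.h) (P.low P.g)
  rw [up_h_mul_low_g, Derivation.matrix_map_one, map_low_g, Matrix.mul_zero, add_zero] at h1
  calc _ = (P.up P.h).map (P.H c) * (P.low P.g * P.up P.h) := by
        rw [mul_eq_one_comm.1 P.up_h_mul_low_g, Matrix.mul_one]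
    _ = 0 := by rw [← Matrix.mul_assoc, ← h1, Matrix.zero_mul]

/-- The curvature of the base, `curv l k s j = R^s_{jlk}`. -/
def curv (l k : ι) : Matrix ι ι A :=
  (P.Γ k).map (P.D l) - (P.Γ l).map (P.D k) + P.Γ l * P.Γ k - P.Γ k * P.Γ l

/-- The curvature of the base along two frame vectors. -/
def frameCurv (a b : ι) : Matrix ι ι B :=
  ∑ l, ∑ k, (P.e l a * P.e k b) • (P.curv l k).map P.φ

lemma H_e_apply (a k b : ι) : P.H a (P.e k b) =
    -∑ l, ∑ m, P.e l a * P.e m b * P.φ (P.Γ l k m) := by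
  have := congrFun (congrFun (P.map_e a) k) b
  simp only [Matrix.map_apply, Matrix.neg_apply, Matrix.mul_apply, conn, Matrix.sum_apply,
    Matrix.smul_apply, smul_eq_mul, Finset.sum_mul] at this
  rw [this, Finset.sum_comm]
  congr 1
  exact Finset.sum_comm.trans <| Finset.sum_congr rfl fun _ _ =>
    Finset.sum_congr rfl fun _ _ => by ring

lemma H_e_symm (a k b : ι) : P.H a (P.e k b) = P.H b (P.e k a) := by
  rw [H_e_apply, H_e_apply, Finset.sum_comm]
  congr 1
  exact Finset.sum_congr rfl fun _ _ => Finset.sum_congr rfl fun _ _ => by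
    rw [P.Γ_symm]; ring

lemma commutator_φ (a b : ι) (x : A) : ⁅P.H a, P.H b⁆ (P.φ x) = 0 := by
  rw [Derivation.commutator_apply, sub_eq_zero]
  simp only [P.H_φ, map_sum, Derivation.leibniz, smul_eq_mul, Finset.sum_add_distrib,
    Finset.mul_sum]
  congr 1
  · rw [Finset.sum_comm]
    exact Finset.sum_congr rfl fun _ _ => Finset.sum_congr rfl fun _ _ => by
      rw [P.D_comm]; ring
  · exact Finset.sum_congr rfl fun _ _ => by rw [H_e_symm]

lemma map_conn (a b : ι) : (P.conn b).map (P.H a) =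
    ∑ k, P.H a (P.e k b) • (P.Γ k).map P.φ
      + ∑ l, ∑ k, (P.e l a * P.e k b) • ((P.Γ k).map (P.D l)).map P.φ := by
  ext i j
  simp only [conn, Matrix.map_apply, Matrix.sum_apply, Matrix.add_apply, Matrix.smul_apply,
    smul_eq_mul, map_sum, Derivation.leibniz, P.H_φ, Finset.sum_add_distrib, Finset.mul_sum]
  rw [add_comm, Finset.sum_comm]
  congr 1
  · exact Finset.sum_congr rfl fun _ _ => by ring
  · exact Finset.sum_congr rfl fun _ _ => Finset.sum_congr rfl fun _ _ => by ring

lemma frameCurv_eq (a b : ι) : P.frameCurv a b =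
    (P.conn b).map (P.H a) - (P.conn a).map (P.H b)
      + P.conn a * P.conn b - P.conn b * P.conn a := by
  have h1 : ∀ a b, P.conn a * P.conn b =
      ∑ l, ∑ k, (P.e l a * P.e k b) • (P.Γ l * P.Γ k).map P.φ := fun a b => by
    simp only [conn, Matrix.sum_mul, Matrix.mul_sum, Matrix.smul_mul, Matrix.mul_smul,
      Finset.smul_sum, smul_smul, Matrix.map_mul]
    rw [Finset.sum_comm]
    exact Finset.sum_congr rfl fun _ _ => Finset.sum_congr rfl fun _ _ => by rw [mul_comm]
  have h2 : ∀ f : ι → ι → Matrix ι ι B, ∑ l, ∑ k, (P.e l b * P.e k a) • f l k =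
      ∑ l, ∑ k, (P.e l a * P.e k b) • f k l := fun f => by
    rw [Finset.sum_comm]
    exact Finset.sum_congr rfl fun _ _ => Finset.sum_congr rfl fun _ _ => by rw [mul_comm]
  simp only [frameCurv, map_conn, h1, curv, H_e_symm P b]
  rw [h2 fun l k => ((P.Γ k).map (P.D l)).map P.φ, h2 fun l k => (P.Γ l * P.Γ k).map P.φ]
  have h3 : ∀ l k, ((P.Γ k).map (P.D l) - (P.Γ l).map (P.D k) + P.Γ l * P.Γ k
      - P.Γ k * P.Γ l).map P.φ = ((P.Γ k).map (P.D l)).map P.φ - ((P.Γ l).map (P.D k)).map P.φ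
       + (P.Γ l * P.Γ k).map P.φ - (P.Γ k * P.Γ l).map P.φ := fun l k => by
    rw [Matrix.map_sub _ (map_sub P.φ), Matrix.map_add _ (map_add P.φ),
      Matrix.map_sub _ (map_sub P.φ)]
  simp only [h3, smul_sub, smul_add, Finset.sum_sub_distrib, Finset.sum_add_distrib]
  abel

/-- The action of the curvature on functions on the frame bundle. -/
def Ω (a b : ι) : Derivation ℝ B B := ⁅P.H a, P.H b⁆

lemma map_commutator (a b : ι) (M : Matrix ι ι B) : M.map (P.Ω a b) =
    (M.map (P.H b)).map (P.H a) - (M.map (P.H a)).map (P.H b) := by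
  ext i j
  simp [Ω, Derivation.commutator_apply]

lemma commutator_e_aux (a b : ι) :
    P.e.map (P.Ω a b) = -(P.frameCurv a b * P.e) := by
  have h1 : ∀ a b, (P.e.map (P.H b)).map (P.H a) =
      -((P.conn b).map (P.H a) * P.e) + P.conn b * (P.conn a * P.e) := fun a b => by
    have h2 : (-(P.conn b * P.e)).map (P.H a) = -(P.conn b * P.e).map (P.H a) := by
      ext i j
      simp
    rw [map_e, h2, Derivation.matrix_map_mul, map_e]
    noncomm_ring
  rw [map_commutator, h1 a b, h1 b a, frameCurv_eq]
  noncomm_ring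

/-- The curvature in frame components. -/
def Rm (a b : ι) : Matrix ι ι B := P.θ * P.frameCurv a b * P.e

lemma commutator_e (a b : ι) : P.e.map (P.Ω a b) = -(P.e * P.Rm a b) := by
  rw [commutator_e_aux, Rm, ← Matrix.mul_assoc, ← Matrix.mul_assoc, P.e_mul_θ, Matrix.one_mul]

lemma commutator_θ (a b : ι) : P.θ.map (P.Ω a b) = P.Rm a b * P.θ := by
  rw [P.map_θ_of_map_e _ (P.commutator_e_aux a b), Rm, Matrix.mul_assoc _ _ P.θ, P.e_mul_θ,
    Matrix.mul_one]

lemma commutator_map_φ (a b : ι) (T : Matrix ι ι A) : (T.map P.φ).map (P.Ω a b) = 0 := by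
  ext i j
  simp [Ω, commutator_φ]

lemma commutator_low (a b : ι) (K : Matrix ι ι A) : (P.low K).map (P.Ω a b) =
    -((P.Rm a b)ᵀ * P.low K) - P.low K * P.Rm a b := by
  rw [low, Derivation.matrix_map_mul, Derivation.matrix_map_mul, Matrix.transpose_map,
    commutator_e, commutator_map_φ]
  simp only [Matrix.transpose_neg, Matrix.transpose_mul]
  noncomm_ring

lemma commutator_up (a b : ι) (K : Matrix ι ι A) : (P.up K).map (P.Ω a b) =
    P.Rm a b * P.up K + P.up K * (P.Rm a b)ᵀ := by
  rw [up, Derivation.matrix_map_mul, Derivation.matrix_map_mul, Matrix.transpose_map,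
    commutator_θ, commutator_map_φ]
  simp only [Matrix.transpose_mul]
  noncomm_ring

lemma Rm_apply (d c a b : ι) : P.Rm a b d c =
    ∑ s, P.θ d s * ∑ l, ∑ k, ∑ j, P.e l a * P.e k b * P.e j c * P.φ (P.curv l k s j) := by
  simp only [Rm, Matrix.mul_assoc, Matrix.mul_apply (M := P.θ)]
  refine Finset.sum_congr rfl fun s _ => ?_
  congr 1
  simp only [Matrix.mul_apply, frameCurv, Matrix.sum_apply, Matrix.smul_apply, Matrix.map_apply,
    smul_eq_mul, Finset.sum_mul]
  rw [Finset.sum_comm]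
  refine Finset.sum_congr rfl fun l _ => ?_
  rw [Finset.sum_comm]
  exact Finset.sum_congr rfl fun _ _ => Finset.sum_congr rfl fun _ _ => by ring

lemma curv_bianchi (l k s j : ι) :
    P.curv l k s j + P.curv k j s l + P.curv j l s k = 0 := by
  have h1 : ∀ a b c, (P.Γ a * P.Γ b) s c = (P.Γ a * P.Γ c) s b := fun a b c => by
    simp only [Matrix.mul_apply]
    exact Finset.sum_congr rfl fun i _ => by rw [P.Γ_symm i b c]
  simp only [curv, Matrix.sub_apply, Matrix.add_apply, Matrix.map_apply]
  rw [P.Γ_symm s k j, P.Γ_symm s l j, P.Γ_symm s l k, h1 l k j, h1 k l j, h1 j l k]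
  ring

lemma Rm_bianchi (d c a b : ι) : P.Rm a b d c + P.Rm b c d a + P.Rm c a d b = 0 := by
  simp only [Rm_apply]
  rw [← Finset.sum_add_distrib, ← Finset.sum_add_distrib]
  refine Finset.sum_eq_zero fun s _ => ?_
  have h1 : ∑ l, ∑ k, ∑ j, P.e l b * P.e k c * P.e j a * P.φ (P.curv l k s j) =
      ∑ l, ∑ k, ∑ j, P.e l a * P.e k b * P.e j c * P.φ (P.curv k j s l) := by
    rw [Finset.sum_comm_cycle]
    exact Finset.sum_congr rfl fun _ _ => Finset.sum_congr rfl fun _ _ =>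
      Finset.sum_congr rfl fun _ _ => by ring
  have h2 : ∑ l, ∑ k, ∑ j, P.e l c * P.e k a * P.e j b * P.φ (P.curv l k s j) =
      ∑ l, ∑ k, ∑ j, P.e l a * P.e k b * P.e j c * P.φ (P.curv j l s k) := by
    rw [Finset.sum_comm_cycle, Finset.sum_comm_cycle]
    exact Finset.sum_congr rfl fun _ _ => Finset.sum_congr rfl fun _ _ =>
      Finset.sum_congr rfl fun _ _ => by ring
  rw [h1, h2, ← mul_add, ← mul_add]
  simp only [← Finset.sum_add_distrib, ← mul_add, ← map_add, curv_bianchi, map_zero, mul_zero,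
    Finset.sum_const_zero]

lemma map_Ω_eq_zero {M : Matrix ι ι B} (hM : ∀ c, M.map (P.H c) = 0) (a b : ι) :
    M.map (P.Ω a b) = 0 := by
  rw [map_commutator, hM, hM]
  ext i j
  simp

lemma frameCurv_antisymm (a b : ι) : P.frameCurv a b = -P.frameCurv b a := by
  rw [frameCurv_eq, frameCurv_eq]; abel

/-- The frame calculus of a frame bundle. -/
def toFrameCalculus : FrameCalculus ι B where
  H := P.H
  h := P.up P.h
  g := P.low P.g
  Rm d c a b := P.Rm a b d c
  h_symm a b := by
    conv_rhs => rw [← P.h_symm, ← up_transpose, Matrix.transpose_apply]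
  g_symm a b := by
    conv_rhs => rw [← P.g_symm, ← low_transpose, Matrix.transpose_apply]
  h_mul_g a c := by
    have := congrFun (congrFun P.up_h_mul_low_g a) c
    rwa [Matrix.mul_apply, Matrix.one_apply] at this
  H_h c a b := congrFun (congrFun (P.map_up_h c) a) b
  H_g c a b := congrFun (congrFun (P.map_low_g c) a) b
  Rm_antisymm d c a b := by
    rw [Rm, frameCurv_antisymm, Rm]; simp
  Rm_skew_h d e a b := by
    have h1 := P.commutator_up a b P.h
    rw [P.map_Ω_eq_zero P.map_up_h] at h1
    have h2 := congrFun (congrFun h1 d) e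
    simp only [Matrix.zero_apply, Matrix.add_apply, Matrix.mul_apply, Matrix.transpose_apply]
      at h2
    have h3 : ∑ s, P.Rm a b e s * P.up P.h s d = ∑ s, P.up P.h d s * P.Rm a b e s :=
      Finset.sum_congr rfl fun s _ => by
        conv_lhs => rw [← P.h_symm, ← up_transpose, Matrix.transpose_apply, mul_comm]
    rw [h3]
    linear_combination -h2
  Rm_skew_g c d a b := by
    have h1 := P.commutator_low a b P.g
    rw [P.map_Ω_eq_zero P.map_low_g] at h1
    have h2 := congrFun (congrFun h1 c) d
    simp only [Matrix.zero_apply, Matrix.sub_apply, Matrix.neg_apply, Matrix.mul_apply,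
      Matrix.transpose_apply] at h2
    have h3 : ∑ s, P.low P.g d s * P.Rm a b s c = ∑ s, P.Rm a b s c * P.low P.g s d :=
      Finset.sum_congr rfl fun s _ => by
        conv_lhs => rw [← P.g_symm, ← low_transpose, Matrix.transpose_apply, mul_comm]
    rw [h3]
    linear_combination h2
  Rm_bianchi := P.Rm_bianchi

lemma Ω_e (a b k c : ι) : P.Ω a b (P.e k c) = -∑ d, P.e k d * P.Rm a b d c := by
  simpa [Matrix.mul_apply] using congrFun (congrFun (P.commutator_e a b) k) c

lemma Ω_θ (a b i s : ι) : P.Ω a b (P.θ i s) = ∑ d, P.Rm a b i d * P.θ d s := by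
  simpa [Matrix.mul_apply] using congrFun (congrFun (P.commutator_θ a b) i) s

lemma Ω_φ (a b : ι) (x : A) : P.Ω a b (P.φ x) = 0 := P.commutator_φ a b x

lemma Ω_up (a b : ι) (K : Matrix ι ι A) (i j : ι) : P.Ω a b (P.up K i j) =
    ∑ d, P.Rm a b i d * P.up K d j + ∑ d, P.Rm a b j d * P.up K i d := by
  have := congrFun (congrFun (P.commutator_up a b K) i) j
  simp only [Matrix.map_apply, Matrix.add_apply, Matrix.mul_apply, Matrix.transpose_apply] at this
  rw [this]
  congr 1
  exact Finset.sum_congr rfl fun _ _ => mul_comm _ _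

lemma isBivector_up (K : Matrix ι ι A) : P.toFrameCalculus.IsBivector (P.up K) :=
  fun a b i j => P.Ω_up a b K i j

/-- Frame components of a vector field. -/
def vec (V : ι → A) (i : ι) : B := ∑ s, P.θ i s * P.φ (V s)

lemma Ω_vec (a b : ι) (V : ι → A) (i : ι) :
    P.Ω a b (P.vec V i) = ∑ d, P.Rm a b i d * P.vec V d := by
  simp only [vec, map_sum, Derivation.leibniz, Ω_φ, Ω_θ, smul_eq_mul, mul_zero, zero_add,
    Finset.mul_sum]
  rw [Finset.sum_comm]
  exact Finset.sum_congr rfl fun _ _ => Finset.sum_congr rfl fun _ _ => by ring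

lemma sum_Ω_e_mul (a b c : ι) (u : ι → B) :
    ∑ k, P.Ω a b (P.e k c) * u k = -∑ d, P.Rm a b d c * ∑ k, P.e k d * u k := by
  simp only [Ω_e, neg_mul, Finset.sum_neg_distrib, Finset.mul_sum, Finset.sum_mul]
  rw [Finset.sum_comm]
  congr 1
  exact Finset.sum_congr rfl fun _ _ => Finset.sum_congr rfl fun _ _ => by ring

lemma isMixedThree_map_up (K : Matrix ι ι A) :
    P.toFrameCalculus.IsMixedThree fun c i j => P.H c (P.up K i j) := by
  have h1 : ∀ c i j, P.H c (P.up K i j) = ∑ k, P.e k c * P.up (P.covUp K k) i j := fun c i j => by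
    have := congrFun (congrFun (P.map_up K c) i) j
    simpa only [Matrix.map_apply, Matrix.sum_apply, Matrix.smul_apply, smul_eq_mul] using this
  intro a b c i j
  change P.Ω a b (P.H c (P.up K i j)) = ∑ d, P.Rm a b i d * P.H c (P.up K d j)
    + ∑ d, P.Rm a b j d * P.H c (P.up K i d) - ∑ d, P.Rm a b d c * P.H d (P.up K i j)
  have h2 : ∀ (l : ι) (u : ι → ι → B), ∑ k, P.e k c * ∑ d, P.Rm a b l d * u k d =
      ∑ d, P.Rm a b l d * ∑ k, P.e k c * u k d := fun l u => by
    simp only [Finset.mul_sum]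
    rw [Finset.sum_comm]
    exact Finset.sum_congr rfl fun _ _ => Finset.sum_congr rfl fun _ _ => by ring
  simp only [h1, map_sum, Derivation.leibniz, smul_eq_mul, Finset.sum_add_distrib, Ω_up, mul_add]
  rw [h2 i fun k d => P.up (P.covUp K k) d j, h2 j fun k d => P.up (P.covUp K k) i d,
    sub_eq_add_neg, ← sum_Ω_e_mul P a b c fun k => P.up (P.covUp K k) i j]
  congr 1
  exact Finset.sum_congr rfl fun _ _ => mul_comm _ _

/-- The covariant derivative of a vector field. -/
def covVec (V : ι → A) (k s : ι) : A := P.D k (V s) + ∑ t, P.Γ k s t * V t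

lemma H_vec (V : ι → A) (c i : ι) :
    P.H c (P.vec V i) = ∑ k, P.e k c * P.vec (P.covVec V k) i := by
  have h1 : ∀ s, P.H c (P.θ i s) = ∑ t, ∑ k, P.θ i t * (P.e k c * P.φ (P.Γ k t s)) := fun s => by
    have := congrFun (congrFun (P.map_θ c) i) s
    simpa [Matrix.mul_apply, conn, Matrix.sum_apply, Finset.mul_sum] using this
  simp only [vec, covVec, map_sum, map_add, map_mul, Derivation.leibniz, P.H_φ, h1, smul_eq_mul,
    mul_add, Finset.sum_add_distrib, Finset.mul_sum]
  congr 1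
  · rw [Finset.sum_comm]
    exact Finset.sum_congr rfl fun _ _ => Finset.sum_congr rfl fun _ _ => by ring
  · rw [Finset.sum_comm_cycle]
    refine Finset.sum_congr rfl fun _ _ => ?_
    rw [Finset.sum_comm]
    exact Finset.sum_congr rfl fun _ _ => Finset.sum_congr rfl fun _ _ => by ring

lemma isVector_vec (V : ι → A) : P.toFrameCalculus.IsVector (P.vec V) :=
  fun a b i => P.Ω_vec a b V i

lemma isMixed_H_vec (V : ι → A) :
    P.toFrameCalculus.IsMixed fun c i => P.H c (P.vec V i) := by
  intro a b c i
  change P.Ω a b (P.H c (P.vec V i)) = ∑ d, P.Rm a b i d * P.H c (P.vec V d)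
    - ∑ d, P.Rm a b d c * P.H d (P.vec V i)
  have h2 : ∀ (l : ι) (u : ι → ι → B), ∑ k, P.e k c * ∑ d, P.Rm a b l d * u k d =
      ∑ d, P.Rm a b l d * ∑ k, P.e k c * u k d := fun l u => by
    simp only [Finset.mul_sum]
    rw [Finset.sum_comm]
    exact Finset.sum_congr rfl fun _ _ => Finset.sum_congr rfl fun _ _ => by ring
  simp only [H_vec, map_sum, Derivation.leibniz, smul_eq_mul, Finset.sum_add_distrib, Ω_vec]
  rw [h2 i fun k d => P.vec (P.covVec V k) d, sub_eq_add_neg,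
    ← sum_Ω_e_mul P a b c fun k => P.vec (P.covVec V k) i]
  congr 1
  exact Finset.sum_congr rfl fun _ _ => mul_comm _ _

lemma isCovector_H_φ (f : A) : P.toFrameCalculus.IsCovector fun a => P.H a (P.φ f) := by
  intro a b c
  change P.Ω a b (P.H c (P.φ f)) = -∑ d, P.Rm a b d c * P.H d (P.φ f)
  simp only [P.H_φ, ← sum_Ω_e_mul P a b c fun k => P.φ (P.D k f), map_sum, Derivation.leibniz,
    Ω_φ, smul_eq_mul, mul_zero, zero_add]
  exact Finset.sum_congr rfl fun _ _ => mul_comm _ _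

lemma sum_e_mul_θ (k s : ι) : ∑ i, P.e k i * P.θ i s = if k = s then 1 else 0 := by
  have := congrFun (congrFun P.e_mul_θ k) s
  rwa [Matrix.mul_apply, Matrix.one_apply] at this

/-- The divergence of a vector field. -/
def div (V : ι → A) : A := ∑ k, P.covVec V k k

lemma sum_H_vec (V : ι → A) : ∑ i, P.H i (P.vec V i) = P.φ (P.div V) := by
  have h1 : ∀ k, ∑ i, P.e k i * P.vec (P.covVec V k) i = P.φ (P.covVec V k k) := fun k => by
    simp only [vec, Finset.mul_sum]
    rw [Finset.sum_comm]
    simp only [← mul_assoc, ← Finset.sum_mul, sum_e_mul_θ]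
    simp
  simp only [H_vec, div, map_sum, ← h1]
  exact Finset.sum_comm

/-- The second order operator associated to a contravariant tensor. -/
def op (M : Matrix ι ι A) (f : A) : A := P.div fun i => ∑ j, M i j * P.D j f

lemma sum_up_mul_H (M : Matrix ι ι A) (f : A) (i : ι) :
    ∑ j, P.up M i j * P.H j (P.φ f) = P.vec (fun i => ∑ j, M i j * P.D j f) i := by
  have h1 : P.up M * P.eᵀ = P.θ * M.map P.φ := by
    rw [up, Matrix.mul_assoc, θT_mul_eT, Matrix.mul_one]
  have h2 : ∀ k, ∑ j, P.up M i j * P.e k j = ∑ s, P.θ i s * P.φ (M s k) := fun k => by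
    simpa [Matrix.mul_apply] using congrFun (congrFun h1 i) k
  simp only [P.H_φ, Finset.mul_sum, vec, map_sum, map_mul]
  rw [Finset.sum_comm, Finset.sum_comm (f := fun s j => P.θ i s * (P.φ (M s j) * _))]
  refine Finset.sum_congr rfl fun k _ => ?_
  simp only [← mul_assoc, ← Finset.sum_mul, h2]

lemma sum_H_up_mul_H (M : Matrix ι ι A) (f : A) :
    ∑ i, P.H i (∑ j, P.up M i j * P.H j (P.φ f)) = P.φ (P.op M f) := by
  simp only [sum_up_mul_H, sum_H_vec, op]

lemma lap_φ (f : A) : P.toFrameCalculus.lap (P.φ f) = P.φ (P.op P.h f) := by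
  rw [FrameCalculus.lap_eq, ← sum_H_up_mul_H]
  simp only [FrameCalculus.G_apply]
  rfl

lemma up_mul_mul_symm {K : Matrix ι ι A} (hK : Kᵀ = K) (i j : ι) :
    P.up (P.h * K * P.h) i j = P.up (P.h * K * P.h) j i := by
  have : (P.h * K * P.h)ᵀ = P.h * K * P.h := by
    simp only [Matrix.transpose_mul, P.h_symm, hK, Matrix.mul_assoc]
  conv_rhs => rw [← this, ← up_transpose, Matrix.transpose_apply]

lemma isKilling_up {K : Matrix ι ι A} (hK : Kᵀ = K)
    (hcyc : ∀ i j k, P.covLow K k i j + P.covLow K i j k + P.covLow K j k i = 0) :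
    P.toFrameCalculus.IsKilling (P.up (P.h * K * P.h)) where
  symm := P.up_mul_mul_symm hK
  cyclic a i j := by
    have h1 : ∀ b p q, P.H b (P.low K p q) =
        ∑ k, ∑ t, ∑ s, P.e k b * P.e s p * P.e t q * P.φ (P.covLow K k s t) := fun b p q => by
      have := congrFun (congrFun (P.map_low K b) p) q
      simp only [Matrix.map_apply, Matrix.sum_apply, Matrix.smul_apply, smul_eq_mul] at this
      rw [this]
      simp only [low, Matrix.mul_apply, Matrix.transpose_apply, Matrix.map_apply,
        Finset.mul_sum, Finset.sum_mul]
      exact Finset.sum_congr rfl fun _ _ => Finset.sum_congr rfl fun _ _ =>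
        Finset.sum_congr rfl fun _ _ => by ring
    have h2 : ∀ b p q, P.H b (P.low K p q) + P.H p (P.low K q b) + P.H q (P.low K b p) = 0 := by
      intro b p q
      have h3 : P.H p (P.low K q b) =
          ∑ k, ∑ t, ∑ s, P.e k b * P.e s p * P.e t q * P.φ (P.covLow K s t k) := by
        rw [h1, ← Finset.sum_comm_cycle]
        exact Finset.sum_congr rfl fun _ _ => Finset.sum_congr rfl fun _ _ =>
          Finset.sum_congr rfl fun _ _ => by ring
      have h4 : P.H q (P.low K b p) =
          ∑ k, ∑ t, ∑ s, P.e k b * P.e s p * P.e t q * P.φ (P.covLow K t k s) := by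
        rw [h1, Finset.sum_comm_cycle]
        exact Finset.sum_congr rfl fun _ _ => Finset.sum_congr rfl fun _ _ =>
          Finset.sum_congr rfl fun _ _ => by ring
      rw [h1, h3, h4]
      simp only [← Finset.sum_add_distrib, ← mul_add, ← map_add]
      refine Finset.sum_eq_zero fun k _ => Finset.sum_eq_zero fun t _ =>
        Finset.sum_eq_zero fun s _ => ?_
      rw [hcyc, map_zero, mul_zero]
    have h5 : ∀ a i j, P.toFrameCalculus.G a (P.up (P.h * K * P.h) i j) =
        ∑ b, ∑ q, ∑ p, P.up P.h a b * P.up P.h i p * P.up P.h q j * P.H b (P.low K p q) := by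
      intro a i j
      rw [FrameCalculus.G_apply]
      refine Finset.sum_congr rfl fun b _ => ?_
      have : (P.up (P.h * K * P.h)).map (P.H b) = P.up P.h * (P.low K).map (P.H b) * P.up P.h := by
        rw [← up_mul_low_mul_up, Derivation.matrix_map_mul, Derivation.matrix_map_mul, map_up_h]
        simp
      have := congrFun (congrFun this i) j
      simp only [Matrix.map_apply, Matrix.mul_apply] at this
      change P.up P.h a b * P.H b (P.up (P.h * K * P.h) i j) = _
      simp only [this, Finset.mul_sum, Finset.sum_mul]
      exact Finset.sum_congr rfl fun _ _ => Finset.sum_congr rfl fun _ _ => by ring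
    have hs : ∀ a b, P.up P.h a b = P.up P.h b a := P.toFrameCalculus.h_symm
    have h6 : P.toFrameCalculus.G i (P.up (P.h * K * P.h) j a) =
        ∑ b, ∑ q, ∑ p, P.up P.h a b * P.up P.h i p * P.up P.h q j * P.H p (P.low K q b) := by
      rw [h5, ← Finset.sum_comm_cycle]
      exact Finset.sum_congr rfl fun b _ => Finset.sum_congr rfl fun q _ =>
        Finset.sum_congr rfl fun p _ => by rw [hs j q, hs b a]; ring
    have h7 : P.toFrameCalculus.G j (P.up (P.h * K * P.h) a i) =
        ∑ b, ∑ q, ∑ p, P.up P.h a b * P.up P.h i p * P.up P.h q j * P.H q (P.low K b p) := by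
      rw [h5, Finset.sum_comm_cycle]
      exact Finset.sum_congr rfl fun b _ => Finset.sum_congr rfl fun q _ =>
        Finset.sum_congr rfl fun p _ => by rw [hs j q, hs p i]; ring
    rw [h5, h6, h7]
    simp only [← Finset.sum_add_distrib, ← mul_add, h2, mul_zero, Finset.sum_const_zero]
  bivector := P.isBivector_up _
  mixedThree := P.isMixedThree_map_up _

/-- The Ricci tensor of the base. -/
def ricci : Matrix ι ι A := Matrix.of fun k j => ∑ l, P.curv l k l j

lemma Ric_eq (a b : ι) : P.toFrameCalculus.Ric a b = P.low P.ricci b a := by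
  change ∑ i, P.Rm i b i a = _
  have h1 : ∀ l s, ∑ i, P.θ i s * P.e l i = if l = s then 1 else 0 := fun l s => by
    rw [← sum_e_mul_θ P l s]
    exact Finset.sum_congr rfl fun _ _ => mul_comm _ _
  calc ∑ i, P.Rm i b i a = ∑ s, ∑ l, (∑ i, P.θ i s * P.e l i) *
      ∑ k, ∑ j, P.e k b * P.e j a * P.φ (P.curv l k s j) := by
        simp only [Rm_apply, Finset.mul_sum, Finset.sum_mul]
        rw [Finset.sum_comm]
        refine Finset.sum_congr rfl fun s _ => ?_
        rw [Finset.sum_comm]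
        refine Finset.sum_congr rfl fun l _ => ?_
        rw [Finset.sum_comm]
        refine Finset.sum_congr rfl fun k _ => ?_
        rw [Finset.sum_comm]
        exact Finset.sum_congr rfl fun _ _ => Finset.sum_congr rfl fun _ _ => by ring
    _ = P.low P.ricci b a := by
        simp only [h1, ite_mul, one_mul, zero_mul, Finset.sum_ite_eq', Finset.mem_univ, if_true]
        simp only [low, Matrix.mul_apply, Matrix.transpose_apply, Matrix.map_apply, ricci,
          Matrix.of_apply, map_sum, Finset.mul_sum, Finset.sum_mul]
        rw [Finset.sum_comm_cycle, Finset.sum_comm_cycle, Finset.sum_comm]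
        refine Finset.sum_congr rfl fun _ _ => ?_
        refine Finset.sum_congr rfl fun _ _ => ?_
        exact Finset.sum_congr rfl fun _ _ => by ring

/-- The commutator of the Ricci tensor with `K`, as a (1,1)-tensor. -/
def carter (K : Matrix ι ι A) : Matrix ι ι A :=
  (P.h * P.ricci) * (P.h * K) - (P.h * K) * (P.h * P.ricci)

/-- The divergence of a (1,1)-tensor. -/
def divMixed (C : Matrix ι ι A) (j : ι) : A :=
  ∑ i, P.D i (C i j) + ∑ i, ∑ s, P.Γ i i s * C s j - ∑ i, ∑ s, P.Γ i s j * C i s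

lemma sum_H_mixed (C : Matrix ι ι A) (c : ι) :
    ∑ i, P.H i ((P.θ * C.map P.φ * P.e) i c) = ∑ t, P.φ (P.divMixed C t) * P.e t c := by
  have h1 : ∀ i, (P.θ * C.map P.φ * P.e).map (P.H i) = ∑ k, P.e k i •
      (P.θ * (C.map (P.D k) + P.Γ k * C - C * P.Γ k).map P.φ * P.e) := fun i => by
    rw [Derivation.matrix_map_mul, Derivation.matrix_map_mul, map_e, map_θ, map_map_φ]
    simp only [Matrix.map_sub P.φ (map_sub P.φ), Matrix.map_add P.φ (map_add P.φ),
      Matrix.map_mul, conn, Matrix.mul_add, Matrix.mul_sub, Matrix.sub_mul, smul_sub, smul_add,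
      Finset.sum_add_distrib, Finset.sum_sub_distrib, Matrix.sum_mul, Matrix.mul_sum,
      Matrix.smul_mul, Matrix.mul_smul, Matrix.mul_assoc, Matrix.add_mul, Matrix.mul_neg]
    abel
  have h2 : ∀ i, P.H i ((P.θ * C.map P.φ * P.e) i c) = ∑ k, ∑ s, P.e k i * (P.θ i s *
      (((C.map (P.D k) + P.Γ k * C - C * P.Γ k).map P.φ) * P.e) s c) := fun i => by
    have := congrFun (congrFun (h1 i) i) c
    simp only [Matrix.map_apply (f := P.H i), Matrix.sum_apply, Matrix.smul_apply,
      smul_eq_mul] at this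
    rw [this]
    simp only [Matrix.mul_assoc, Matrix.mul_apply (M := P.θ), Finset.mul_sum]
  simp only [h2, ← mul_assoc]
  rw [Finset.sum_comm_cycle, Finset.sum_comm_cycle]
  simp only [← Finset.sum_mul]
  rw [Finset.sum_comm]
  simp only [sum_e_mul_θ, ite_mul, one_mul, zero_mul, Finset.sum_ite_eq', Finset.mem_univ, if_true, Matrix.mul_apply, Matrix.map_apply, Matrix.add_apply,
    Matrix.sub_apply]
  rw [Finset.sum_comm]
  refine Finset.sum_congr rfl fun t _ => ?_
  rw [← Finset.sum_mul, ← map_sum, divMixed]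
  simp only [Finset.sum_add_distrib, Finset.sum_sub_distrib]
  congr 3
  exact Finset.sum_congr rfl fun _ _ => Finset.sum_congr rfl fun _ _ => mul_comm _ _

lemma ricMul_sub_ricMul {K : Matrix ι ι A} (hK : Kᵀ = K) (i j : ι) :
    P.toFrameCalculus.ricMul (P.up (P.h * K * P.h)) i j
      - P.toFrameCalculus.ricMul (P.up (P.h * K * P.h)) j i =
      ∑ c, (P.θ * (P.carter K).map P.φ * P.e) i c * P.up P.h c j := by
  have h1 : P.θ * (P.carter K).map P.φ * P.e * P.up P.h =
      P.up P.h * P.low P.ricci * P.up (P.h * K * P.h)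
       - P.up (P.h * K * P.h) * P.low P.ricci * P.up P.h := by
    calc _ = P.up (P.carter K * P.h) := by
          rw [up, up, Matrix.map_mul]
          calc _ = P.θ * (P.carter K).map P.φ * (P.e * P.θ) * P.h.map P.φ * P.θᵀ := by
                simp only [Matrix.mul_assoc]
            _ = _ := by rw [e_mul_θ, Matrix.mul_one]; simp only [Matrix.mul_assoc]
      _ = _ := by
          rw [up_mul_low_mul_up, up_mul_low_mul_up, carter]
          simp only [up, ← Matrix.mul_sub, ← Matrix.sub_mul,
            ← Matrix.map_sub P.φ (map_sub P.φ)]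
          simp only [Matrix.sub_mul, Matrix.mul_assoc]
  have hs := P.up_mul_mul_symm hK
  have h2 := congrFun (congrFun h1 i) j
  rw [Matrix.mul_apply] at h2
  rw [h2, Matrix.sub_apply]
  congr 1
  · simp only [FrameCalculus.ricMul, Ric_eq, Matrix.mul_apply, Finset.sum_mul]
    rw [Finset.sum_comm]
    rfl
  · simp only [FrameCalculus.ricMul, Matrix.mul_apply, Finset.sum_mul]
    refine Finset.sum_congr rfl fun c _ => Finset.sum_congr rfl fun d _ => ?_
    rw [P.toFrameCalculus.Ric_symm, Ric_eq, hs d i]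
    change P.up P.h j c * _ * _ = _
    rw [show P.up P.h j c = P.up P.h c j from P.toFrameCalculus.h_symm j c]
    ring

theorem φ_commutator {K : Matrix ι ι A} (hK : Kᵀ = K)
    (hcyc : ∀ i j k, P.covLow K k i j + P.covLow K i j k + P.covLow K j k i = 0) (f : A) :
    P.φ (3 * (P.op P.h (P.op (P.h * K * P.h) f) - P.op (P.h * K * P.h) (P.op P.h f))) =
      P.φ (-2 * ∑ j, ∑ k, P.divMixed (P.carter K) j * (P.h j k * P.D k f)) := by
  have hmain := (P.isKilling_up hK hcyc).three_mul_commutator (f := P.φ f)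
    (fun a b => P.commutator_φ a b f) (P.isCovector_H_φ f)
    (by
      have : (fun i => ∑ j, P.up (P.h * K * P.h) i j * P.toFrameCalculus.H j (P.φ f)) =
        P.vec (fun i => ∑ j, (P.h * K * P.h) i j * P.D j f) :=
        funext (P.sum_up_mul_H _ f)
      rw [this]
      exact P.isVector_vec _)
    (by
      have : (fun a i => P.toFrameCalculus.H a
          (∑ j, P.up (P.h * K * P.h) i j * P.toFrameCalculus.H j (P.φ f))) = fun a i =>
          P.H a (P.vec (fun i => ∑ j, (P.h * K * P.h) i j * P.D j f) i) :=
        funext fun a => funext fun i => congrArg (P.H a) (P.sum_up_mul_H _ f i)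
      rw [this]
      exact P.isMixed_H_vec _)
  have hH : P.toFrameCalculus.H = P.H := rfl
  have hdiv : ∀ j, ∑ i, P.H i (∑ c, (P.θ * (P.carter K).map P.φ * P.e) i c * P.up P.h c j) =
      ∑ t, P.φ (P.divMixed (P.carter K) t) * ∑ c, P.e t c * P.up P.h c j := fun j => by
    have h1 : ∀ i c, P.H i (P.up P.h c j) = 0 := fun i c =>
      congrFun (congrFun (P.map_up_h i) c) j
    have h2 : ∀ i c (x : B), P.H i (x * P.up P.h c j) = P.up P.h c j * P.H i x := fun i c x => by
      rw [Derivation.leibniz, h1, smul_zero, zero_add, smul_eq_mul]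
    simp only [map_sum, h2]
    rw [Finset.sum_comm]
    simp only [← Finset.mul_sum, sum_H_mixed]
    simp only [Finset.mul_sum]
    rw [Finset.sum_comm]
    exact Finset.sum_congr rfl fun _ _ => Finset.sum_congr rfl fun _ _ => by ring
  have hsharp : ∀ t, ∑ j, (∑ c, P.e t c * P.up P.h c j) * P.H j (P.φ f) =
      ∑ k, P.φ (P.h t k * P.D k f) := fun t => by
    have h1 : P.e * P.up P.h * P.eᵀ = P.h.map P.φ := by
      rw [up, ← Matrix.mul_assoc, ← Matrix.mul_assoc, e_mul_θ, Matrix.one_mul, Matrix.mul_assoc,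
        θT_mul_eT, Matrix.mul_one]
    have h2 : ∀ k, ∑ j, (∑ c, P.e t c * P.up P.h c j) * P.e k j = P.φ (P.h t k) := fun k => by
      simpa [Matrix.mul_apply] using congrFun (congrFun h1 t) k
    simp only [P.H_φ, map_mul, ← h2]
    simp only [Finset.mul_sum, Finset.sum_mul, ← mul_assoc]
    rw [Finset.sum_comm]
  simp only [hH, lap_φ, ricMul_sub_ricMul P hK, sum_H_up_mul_H, hdiv] at hmain
  rw [map_mul, map_sub, map_ofNat, hmain, map_mul, map_neg, map_ofNat, map_sum]
  congr 1
  simp only [← Finset.mul_sum, map_mul (P.φ) (P.divMixed _ _), map_sum, ← hsharp]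
  simp only [Finset.sum_mul, Finset.mul_sum, mul_assoc]
  rw [Finset.sum_comm]

end FrameBundle

section SmoothFunctions

open scoped ContDiff

variable {E F : Type*} [NormedAddCommGroup E] [NormedSpace ℝ E]
  [NormedAddCommGroup F] [NormedSpace ℝ F]

/-- The algebra of smooth functions on a set. -/
def smoothFunctions (Ω : Set E) : Subalgebra ℝ (Ω → ℝ) where
  carrier := {u | ∃ f : E → ℝ, ContDiffOn ℝ ∞ f Ω ∧ ∀ x : Ω, f x = u x}
  mul_mem' := by
    rintro _ _ ⟨f, hf, h1⟩ ⟨f', hf', h2⟩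
    exact ⟨fun x => f x * f' x, hf.mul hf', fun x => by simp [h1, h2]⟩
  add_mem' := by
    rintro _ _ ⟨f, hf, h1⟩ ⟨f', hf', h2⟩
    exact ⟨fun x => f x + f' x, hf.add hf', fun x => by simp [h1, h2]⟩
  algebraMap_mem' r := ⟨fun _ => r, contDiffOn_const, fun _ => rfl⟩

namespace smoothFunctions

variable {Ω : Set E}

/-- The restriction of a smooth function. -/
def mk (f : E → ℝ) (hf : ContDiffOn ℝ ∞ f Ω) : smoothFunctions Ω :=
  ⟨fun x => f x, f, hf, fun _ => rfl⟩

/-- Evaluation at a point. -/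
def eval (x : Ω) : smoothFunctions Ω →+* ℝ :=
  (Pi.evalRingHom (fun _ : Ω => ℝ) x).comp (smoothFunctions Ω).val.toRingHom

@[simp] lemma eval_mk (f : E → ℝ) (hf : ContDiffOn ℝ ∞ f Ω) (x : Ω) : eval x (mk f hf) = f x := rfl

@[simp] lemma eval_smul (r : ℝ) (u : smoothFunctions Ω) (x : Ω) :
    eval x (r • u) = r * eval x u := rfl

@[ext] lemma ext {u v : smoothFunctions Ω} (h : ∀ x, eval x u = eval x v) : u = v :=
  Subtype.ext (funext h)

/-- An extension of a smooth function to the whole space. -/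
noncomputable def extension (u : smoothFunctions Ω) : E → ℝ := u.2.choose

lemma contDiffOn_extension (u : smoothFunctions Ω) : ContDiffOn ℝ ∞ (extension u) Ω :=
  u.2.choose_spec.1

lemma extension_apply (u : smoothFunctions Ω) (x : Ω) : (extension u) x = eval x u :=
  u.2.choose_spec.2 x

lemma fderiv_congr (hΩ : IsOpen Ω) {f f' : E → ℝ} (h : Set.EqOn f f' Ω) {x : E} (hx : x ∈ Ω) :
    fderiv ℝ f x = fderiv ℝ f' x :=
  (h.eventuallyEq_of_mem (hΩ.mem_nhds hx)).fderiv_eq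

lemma contDiffOn_fderiv_apply (hΩ : IsOpen Ω) {f : E → ℝ} (hf : ContDiffOn ℝ ∞ f Ω) (v : E) :
    ContDiffOn ℝ ∞ (fun x => fderiv ℝ f x v) Ω :=
  (hf.fderiv_of_isOpen hΩ (m := ∞) le_rfl).clm_apply contDiffOn_const

lemma differentiableAt_of_contDiffOn (hΩ : IsOpen Ω) {f : E → ℝ} (hf : ContDiffOn ℝ ∞ f Ω) {x : E}
    (hx : x ∈ Ω) : DifferentiableAt ℝ f x :=
  (hf.contDiffAt (hΩ.mem_nhds hx)).differentiableAt (by simp)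

/-- The derivative in a fixed direction. -/
noncomputable def dirDeriv (hΩ : IsOpen Ω) (v : E) : Derivation ℝ (smoothFunctions Ω) (smoothFunctions Ω) :=
  Derivation.mk'
    { toFun := fun u => mk (fun x => fderiv ℝ (extension u) x v)
        (contDiffOn_fderiv_apply hΩ (contDiffOn_extension u) v)
      map_add' := fun u w => by
        ext x
        have h := fderiv_congr hΩ (f := extension (u + w))
          (f' := fun y => (extension u) y + (extension w) y)
          (fun y hy => by
            change extension (u + w) y = extension u y + extension w y
            rw [extension_apply (u + w) ⟨y, hy⟩, extension_apply u ⟨y, hy⟩,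
              extension_apply w ⟨y, hy⟩, map_add]) x.2
        simp only [eval_mk, map_add, h]
        rw [fderiv_fun_add (differentiableAt_of_contDiffOn hΩ (contDiffOn_extension u) x.2)
          (differentiableAt_of_contDiffOn hΩ (contDiffOn_extension w) x.2)]
        rfl
      map_smul' := fun r u => by
        ext x
        have h := fderiv_congr hΩ (f := extension (r • u)) (f' := fun y => r • (extension u) y)
          (fun y hy => by
            change extension (r • u) y = r • extension u y
            rw [extension_apply (r • u) ⟨y, hy⟩, extension_apply u ⟨y, hy⟩, eval_smul]; rfl) x.2
        simp only [eval_mk, h, RingHom.id_apply, eval_smul]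
        rw [fderiv_fun_const_smul (differentiableAt_of_contDiffOn hΩ (contDiffOn_extension u) x.2)]
        rfl }
    fun u w => by
      ext x
      have h := fderiv_congr hΩ (f := extension (u * w))
        (f' := fun y => (extension u) y * (extension w) y)
        (fun y hy => by
          change extension (u * w) y = extension u y * extension w y
          rw [extension_apply (u * w) ⟨y, hy⟩, extension_apply u ⟨y, hy⟩,
            extension_apply w ⟨y, hy⟩, map_mul]) x.2
      simp only [LinearMap.coe_mk, AddHom.coe_mk, eval_mk, map_add, smul_eq_mul, map_mul, h]
      rw [fderiv_fun_mul (differentiableAt_of_contDiffOn hΩ (contDiffOn_extension u) x.2)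
        (differentiableAt_of_contDiffOn hΩ (contDiffOn_extension w) x.2)]
      simp [extension_apply]

lemma eval_dirDeriv (hΩ : IsOpen Ω) (v : E) (u : smoothFunctions Ω) {f : E → ℝ}
    (hf : ∀ x : Ω, f x = eval x u) (x : Ω) : eval x (dirDeriv hΩ v u) = fderiv ℝ f x v := by
  change fderiv ℝ (extension u) x v = _
  rw [fderiv_congr hΩ (fun y hy => (extension_apply u ⟨y, hy⟩).trans (hf ⟨y, hy⟩).symm) x.2]

lemma dirDeriv_comm (hΩ : IsOpen Ω) (v w : E) (u : smoothFunctions Ω) :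
    dirDeriv hΩ v (dirDeriv hΩ w u) = dirDeriv hΩ w (dirDeriv hΩ v u) := by
  have h1 : ∀ v w x, eval x (dirDeriv hΩ v (dirDeriv hΩ w u)) =
      fderiv ℝ (fderiv ℝ (extension u)) x v w := fun v w x => by
    rw [eval_dirDeriv hΩ v _ (f := fun y => fderiv ℝ (extension u) y w) (fun _ => rfl)]
    have h2 : DifferentiableAt ℝ (fderiv ℝ (extension u)) x :=
      (((contDiffOn_extension u).fderiv_of_isOpen hΩ (m := ∞) le_rfl).contDiffAt
        (hΩ.mem_nhds x.2)).differentiableAt (by simp)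
    rw [fderiv_clm_apply h2 (differentiableAt_const w)]
    simp
  ext x
  rw [h1, h1]
  have h3 : ContDiffAt ℝ ∞ (extension u) x := (contDiffOn_extension u).contDiffAt (hΩ.mem_nhds x.2)
  exact (h3.isSymmSndFDerivAt (by
    rw [minSmoothness_of_isRCLikeNormedField]
    exact WithTop.coe_le_coe.2 (le_top : (2 : ℕ∞) ≤ ⊤))).eq v w

lemma isUnit_of_eval_ne_zero {u : smoothFunctions Ω} (h : ∀ x, eval x u ≠ 0) : IsUnit u := by
  refine IsUnit.of_mul_eq_one (mk (fun x => ((extension u) x)⁻¹)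
    ((contDiffOn_extension u).inv fun x hx => ?_)) ?_
  · rw [extension_apply u ⟨x, hx⟩]
    exact h _
  · ext x
    rw [map_mul, eval_mk, extension_apply, mul_inv_cancel₀ (h x), map_one]

/-- Pullback along a smooth map. -/
noncomputable def pullback {Ω' : Set F} (π : F → E) (hπ : ContDiffOn ℝ ∞ π Ω') (hm : Set.MapsTo π Ω' Ω) :
    smoothFunctions Ω →+* smoothFunctions Ω' where
  toFun u := mk (fun x => (extension u) (π x)) ((contDiffOn_extension u).comp hπ hm)
  map_one' := by
    ext x
    rw [eval_mk, extension_apply 1 ⟨π x, hm x.2⟩, map_one, map_one]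
  map_mul' u v := by
    ext x
    simp only [eval_mk, map_mul]
    rw [extension_apply (u * v) ⟨π x, hm x.2⟩, extension_apply u ⟨π x, hm x.2⟩,
      extension_apply v ⟨π x, hm x.2⟩, map_mul]
  map_zero' := by
    ext x
    rw [eval_mk, extension_apply 0 ⟨π x, hm x.2⟩, map_zero, map_zero]
  map_add' u v := by
    ext x
    simp only [eval_mk, map_add]
    rw [extension_apply (u + v) ⟨π x, hm x.2⟩, extension_apply u ⟨π x, hm x.2⟩,
      extension_apply v ⟨π x, hm x.2⟩, map_add]

lemma eval_pullback {Ω' : Set F} (π : F → E) (hπ : ContDiffOn ℝ ∞ π Ω') (hm : Set.MapsTo π Ω' Ω)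
    (u : smoothFunctions Ω) (x : Ω') :
    eval x (pullback π hπ hm u) = eval ⟨π x, hm x.2⟩ u := extension_apply u ⟨π x, hm x.2⟩

end smoothFunctions

end SmoothFunctions

section LeviCivita

/-- The Christoffel symbols of a symmetric matrix `g` with inverse `h` with respect to
derivations. -/
noncomputable def christoffel {ι A : Type*} [Fintype ι] [CommRing A] [Algebra ℝ A] (D : ι → Derivation ℝ A A)
    (g h : Matrix ι ι A) (k : ι) : Matrix ι ι A :=
  Matrix.of fun s j => (1 / 2 : ℝ) • ∑ l, h s l * (D k (g l j) + D j (g l k) - D l (g k j))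

variable {ι A : Type*} [Fintype ι] [DecidableEq ι] [CommRing A] [Algebra ℝ A]
  (D : ι → Derivation ℝ A A) {g h : Matrix ι ι A}

omit [DecidableEq ι] in
lemma christoffel_symm (hg : gᵀ = g) (s i j : ι) :
    christoffel D g h i s j = christoffel D g h j s i := by
  have h1 : g i j = g j i := congrFun (congrFun hg j) i
  simp only [christoffel, Matrix.of_apply, h1]
  congr 1
  exact Finset.sum_congr rfl fun _ _ => by ring

lemma map_metric_eq (hg : gᵀ = g) (hh : h * g = 1) (k : ι) :
    g.map (D k) = (christoffel D g h k)ᵀ * g + g * christoffel D g h k := by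
  have hs : ∀ i j, g i j = g j i := fun i j => congrFun (congrFun hg j) i
  have h1 : ∀ i j, (g * christoffel D g h k) i j =
      (1 / 2 : ℝ) • (D k (g i j) + D j (g i k) - D i (g k j)) := fun i j => by
    have h2 : ∀ l, ∑ s, g i s * h s l = if i = l then 1 else 0 := fun l => by
      have hgh : g * h = 1 := mul_eq_one_comm.1 hh
      have := congrFun (congrFun hgh i) l
      rwa [Matrix.mul_apply, Matrix.one_apply] at this
    simp only [Matrix.mul_apply, christoffel, Matrix.of_apply, mul_smul_comm, ← Finset.smul_sum,
      Finset.mul_sum]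
    rw [Finset.sum_comm]
    simp only [← mul_assoc, ← Finset.sum_mul, h2]
    simp
  have h3 : (christoffel D g h k)ᵀ * g = (g * christoffel D g h k)ᵀ := by
    rw [Matrix.transpose_mul, hg]
  ext i j
  rw [h3, Matrix.add_apply, Matrix.transpose_apply, h1, h1, ← smul_add, hs k i, hs k j, hs j i,
    Matrix.map_apply]
  rw [show D k (g i j) + D i (g j k) - D j (g i k) + (D k (g i j) + D j (g i k) - D i (g j k))
    = (2 : ℝ) • D k (g i j) by rw [two_smul]; ring, smul_smul]
  norm_num

end LeviCivita

noncomputable section FrameSpace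

open smoothFunctions
open scoped ContDiff

variable {n : ℕ} {U : Set (Fin n → ℝ)}

/-- The frame bundle of an open set. -/
def frameSet (U : Set (Fin n → ℝ)) : Set ((Fin n → ℝ) × (Fin n → Fin n → ℝ)) :=
  {q | q.1 ∈ U ∧ (Matrix.of q.2).det ≠ 0}

lemma isOpen_frameSet (hU : IsOpen U) : IsOpen (frameSet U) := by
  refine (hU.preimage continuous_fst).inter ?_
  have : Continuous fun q : (Fin n → ℝ) × (Fin n → Fin n → ℝ) => (Matrix.of q.2).det :=
    Continuous.matrix_det continuous_snd
  exact isOpen_ne.preimage this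

lemma mapsTo_fst_frameSet : Set.MapsTo Prod.fst (frameSet U) U := fun _ h => h.1

/-- The coordinates of the tautological frame. -/
def frameMatrix (U : Set (Fin n → ℝ)) : Matrix (Fin n) (Fin n) (smoothFunctions (frameSet U)) :=
  Matrix.of fun s b => mk (fun q => q.2 s b)
    (contDiff_apply_apply ℝ ℝ s b |>.comp contDiff_snd).contDiffOn

lemma isUnit_det_frameMatrix : IsUnit (frameMatrix U).det := by
  refine isUnit_of_eval_ne_zero fun x => ?_
  rw [RingHom.map_det]
  exact x.2.2

lemma dirDeriv_frameMatrix (hU : IsOpen U) (v : (Fin n → ℝ) × (Fin n → Fin n → ℝ)) (s b : Fin n) :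
    dirDeriv (isOpen_frameSet hU) v (frameMatrix U s b) =
      algebraMap ℝ (smoothFunctions (frameSet U)) (v.2 s b) := by
  ext x
  rw [eval_dirDeriv _ v _ (f := fun q => q.2 s b) (fun _ => rfl)]
  let L : (Fin n → ℝ) × (Fin n → Fin n → ℝ) →L[ℝ] ℝ :=
      (ContinuousLinearMap.proj (R := ℝ) (φ := fun _ : Fin n => ℝ) b).comp
        ((ContinuousLinearMap.proj (R := ℝ) (φ := fun _ : Fin n => Fin n → ℝ) s).comp
          (ContinuousLinearMap.snd ℝ (Fin n → ℝ) (Fin n → Fin n → ℝ)))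
  have h1 : HasFDerivAt (fun q : (Fin n → ℝ) × (Fin n → Fin n → ℝ) => q.2 s b) L x :=
    L.hasFDerivAt
  rw [h1.fderiv]
  rfl

/-- Pullback of functions to the frame bundle. -/
def framePullback (U : Set (Fin n → ℝ)) : smoothFunctions U →+* smoothFunctions (frameSet U) :=
  pullback Prod.fst contDiff_fst.contDiffOn mapsTo_fst_frameSet

lemma dirDeriv_framePullback (hU : IsOpen U) (v : (Fin n → ℝ) × (Fin n → Fin n → ℝ))
    (u : smoothFunctions U) : dirDeriv (isOpen_frameSet hU) v (framePullback U u) =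
      framePullback U (dirDeriv hU v.1 u) := by
  ext x
  rw [eval_dirDeriv _ v _ (f := fun q => extension u q.1) (fun _ => rfl), framePullback,
    eval_pullback, eval_dirDeriv hU v.1 u (extension_apply u)]
  have h1 := (differentiableAt_of_contDiffOn hU (contDiffOn_extension u) x.2.1).hasFDerivAt.comp
    (x : (Fin n → ℝ) × (Fin n → Fin n → ℝ)) hasFDerivAt_fst
  exact DFunLike.congr_fun h1.fderiv v

lemma framePullback_injective : Function.Injective (framePullback U) := by
  intro u w h
  ext x
  have h1 : ((x : Fin n → ℝ), fun i j => (1 : Matrix (Fin n) (Fin n) ℝ) i j) ∈ frameSet U :=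
    ⟨x.2, by
      change (1 : Matrix (Fin n) (Fin n) ℝ).det ≠ 0
      simp⟩
  have h2 := congrArg (eval ⟨_, h1⟩) h
  rwa [framePullback, eval_pullback, eval_pullback] at h2

/-- The coordinate derivations. -/
def coordDeriv (hU : IsOpen U) (k : Fin n) :
    Derivation ℝ (smoothFunctions U) (smoothFunctions U) := dirDeriv hU (Pi.single k 1)

/-- The standard horizontal vector fields of a connection with Christoffel matrices `Γ`. -/
def horizontal (hU : IsOpen U) (Γ : Fin n → Matrix (Fin n) (Fin n) (smoothFunctions U))
    (c : Fin n) : Derivation ℝ (smoothFunctions (frameSet U)) (smoothFunctions (frameSet U)) :=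
  ∑ k, frameMatrix U k c • dirDeriv (isOpen_frameSet hU) (Pi.single k 1, 0) -
    ∑ s, ∑ b, ((∑ k, frameMatrix U k c • (Γ k).map (framePullback U)) * frameMatrix U) s b •
      dirDeriv (isOpen_frameSet hU) (0, Pi.single s (Pi.single b 1))

lemma Derivation.sum_apply' {κ B : Type*} [CommRing B] [Algebra ℝ B] (t : Finset κ)
    (δ : κ → Derivation ℝ B B) (x : B) : (∑ i ∈ t, δ i) x = ∑ i ∈ t, δ i x := by
  rw [← Derivation.coeFnAddMonoidHom_apply, map_sum, Finset.sum_apply]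
  rfl

lemma horizontal_apply (hU : IsOpen U)
    (Γ : Fin n → Matrix (Fin n) (Fin n) (smoothFunctions U)) (c : Fin n)
    (u : smoothFunctions (frameSet U)) : horizontal hU Γ c u =
      ∑ k, frameMatrix U k c * dirDeriv (isOpen_frameSet hU) (Pi.single k 1, 0) u -
        ∑ s, ∑ b, ((∑ k, frameMatrix U k c • (Γ k).map (framePullback U)) * frameMatrix U) s b *
          dirDeriv (isOpen_frameSet hU) (0, Pi.single s (Pi.single b 1)) u := by
  rw [horizontal, Derivation.sub_apply]
  simp only [Derivation.sum_apply']
  rfl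

lemma horizontal_framePullback (hU : IsOpen U)
    (Γ : Fin n → Matrix (Fin n) (Fin n) (smoothFunctions U)) (c : Fin n) (u : smoothFunctions U) :
    horizontal hU Γ c (framePullback U u) =
      ∑ k, frameMatrix U k c * framePullback U (coordDeriv hU k u) := by
  have h1 : dirDeriv hU (0 : Fin n → ℝ) u = 0 := by
    ext x
    rw [eval_dirDeriv hU _ _ (extension_apply u), map_zero, map_zero]
  simp [horizontal_apply, dirDeriv_framePullback hU, h1, coordDeriv]

lemma horizontal_frameMatrix (hU : IsOpen U)
    (Γ : Fin n → Matrix (Fin n) (Fin n) (smoothFunctions U)) (c : Fin n) :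
    (frameMatrix U).map (horizontal hU Γ c) =
      -((∑ k, frameMatrix U k c • (Γ k).map (framePullback U)) * frameMatrix U) := by
  ext1 s b
  rw [Matrix.map_apply, horizontal_apply]
  simp only [dirDeriv_frameMatrix hU, Pi.zero_apply, map_zero, mul_zero, Finset.sum_const_zero,
    zero_sub, Matrix.neg_apply]
  congr 1
  rw [Finset.sum_eq_single s, Finset.sum_eq_single b]
  · simp
  · intro b' _ hb
    simp [hb.symm]
  · simp
  · intro s' _ hs
    simp [hs.symm]
  · simp

/-- The frame bundle of a metric. -/
def metricFrameBundle (hU : IsOpen U) (g : Matrix (Fin n) (Fin n) (smoothFunctions U))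
    (hg : gᵀ = g) (hdet : IsUnit g.det) :
    FrameBundle (Fin n) (smoothFunctions U) (smoothFunctions (frameSet U)) where
  D := coordDeriv hU
  D_comm _ _ u := dirDeriv_comm hU _ _ u
  g := g
  h := g⁻¹
  g_symm := hg
  h_symm := by rw [Matrix.transpose_nonsing_inv, hg]
  h_mul_g := Matrix.nonsing_inv_mul _ hdet
  Γ := christoffel (coordDeriv hU) g g⁻¹
  Γ_symm := christoffel_symm _ hg
  D_g := map_metric_eq _ hg (Matrix.nonsing_inv_mul _ hdet)
  φ := framePullback U
  e := frameMatrix U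
  θ := (frameMatrix U)⁻¹
  θ_mul_e := Matrix.nonsing_inv_mul _ isUnit_det_frameMatrix
  e_mul_θ := Matrix.mul_nonsing_inv _ isUnit_det_frameMatrix
  H := horizontal hU (christoffel (coordDeriv hU) g g⁻¹)
  H_φ := horizontal_framePullback hU _
  H_e := horizontal_frameMatrix hU _

end FrameSpace

section Jacobi

variable {ι B : Type*} [Fintype ι] [DecidableEq ι] [CommRing B] [Algebra ℝ B]
  (δ : Derivation ℝ B B)

omit [Fintype ι] in
lemma Derivation.map_prod (s : Finset ι) (f : ι → B) :
    δ (∏ j ∈ s, f j) = ∑ i ∈ s, ∏ j ∈ s, Function.update f i (δ (f i)) j := by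
  induction s using Finset.induction_on with
  | empty => simp
  | insert a s ha ih =>
    rw [Finset.prod_insert ha, Derivation.leibniz, ih, Finset.sum_insert ha, Finset.prod_insert ha,
      Function.update_self, add_comm]
    congr 1
    · rw [smul_eq_mul, mul_comm]
      congr 1
      exact Finset.prod_congr rfl fun j hj => by
        rw [Function.update_of_ne (ne_of_mem_of_not_mem hj ha)]
    · rw [smul_eq_mul, Finset.mul_sum]
      exact Finset.sum_congr rfl fun i hi => by
        rw [Finset.prod_insert ha, Function.update_of_ne (ne_of_mem_of_not_mem hi ha).symm]

/-- Jacobi's formula for a derivation. -/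
lemma Derivation.map_det (M : Matrix ι ι B) : δ M.det = (M.adjugate * M.map δ).trace := by
  have h1 : ∀ i, (M.adjugate * M.map δ) i i = (M.updateCol i fun s => δ (M s i)).det := fun i => by
    rw [← Matrix.cramer_apply, Matrix.cramer_eq_adjugate_mulVec]
    rfl
  simp only [Matrix.trace, Matrix.diag, h1, Matrix.det_apply, map_sum]
  rw [Finset.sum_comm]
  refine Finset.sum_congr rfl fun σ _ => ?_
  rw [← Finset.smul_sum, Units.smul_def, map_zsmul, Derivation.map_prod]
  congr 1
  refine Finset.sum_congr rfl fun i _ => Finset.prod_congr rfl fun j _ => ?_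
  rw [Matrix.updateCol_apply, Function.update_apply]
  split_ifs with h
  · rw [h]
  · rfl

end Jacobi

lemma Matrix.map_nonsing_inv {ι A B : Type*} [Fintype ι] [DecidableEq ι] [CommRing A] [CommRing B]
    (f : A →+* B) {M : Matrix ι ι A} (hM : IsUnit M.det) : M⁻¹.map f = (M.map f)⁻¹ := by
  refine (Matrix.inv_eq_left_inv ?_).symm
  rw [← Matrix.map_mul, Matrix.nonsing_inv_mul _ hM, Matrix.map_one f (map_zero f) (map_one f)]

namespace FrameBundle

variable {ι A B : Type*} [Fintype ι] [DecidableEq ι] [CommRing A] [Algebra ℝ A]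
    [CommRing B] [Algebra ℝ B] (P : FrameBundle ι A B)

/-- The logarithmic derivative of the density `w` of the volume form. -/
lemma D_density {w : A} (hw : IsUnit w) (hwg : w ^ 4 = P.g.det ^ 2) (i : ι) :
    P.D i w = w * ∑ l, P.Γ i l l := by
  have h1 : P.D i P.g.det = 2 * P.g.det * (P.Γ i).trace := by
    have h2 : P.g.adjugate * P.g = P.g.det • 1 := Matrix.adjugate_mul _
    have h3 : P.g * P.g.adjugate = P.g.det • 1 := Matrix.mul_adjugate _
    rw [Derivation.map_det, P.D_g, Matrix.mul_add, Matrix.trace_add, ← Matrix.mul_assoc,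
      ← Matrix.mul_assoc, h2, Matrix.trace_mul_cycle, h3]
    simp only [Matrix.smul_mul, Matrix.one_mul, Matrix.trace_smul, smul_eq_mul,
      Matrix.trace_transpose]
    ring
  have h4 : 4 * (w ^ 3 * P.D i w) = 4 * (w ^ 3 * (w * ∑ l, P.Γ i l l)) := by
    have h5 := congrArg (P.D i) hwg
    rw [Derivation.leibniz_pow, Derivation.leibniz_pow, h1] at h5
    simp only [smul_eq_mul, nsmul_eq_mul] at h5
    push_cast at h5
    have h6 : (P.Γ i).trace = ∑ l, P.Γ i l l := rfl
    rw [← h6]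
    simp only [pow_one] at h5
    linear_combination h5 - 4 * (P.Γ i).trace * hwg
  have h7 : IsUnit (4 : A) := by
    have := (isUnit_iff_ne_zero.2 (four_ne_zero (α := ℝ))).map (algebraMap ℝ A)
    rwa [map_ofNat] at this
  exact (hw.pow 3).mul_left_cancel (h7.mul_left_cancel h4)

/-- The coordinate expression of a divergence through the density of the volume form. -/
lemma density_mul_div {w : A} (hw : IsUnit w) (hwg : w ^ 4 = P.g.det ^ 2) (V : ι → A) :
    w * P.div V = ∑ i, P.D i (w * V i) := by
  simp only [div, covVec, Derivation.leibniz, smul_eq_mul, P.D_density hw hwg, Finset.mul_sum,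
    mul_add, Finset.sum_add_distrib]
  congr 1
  rw [Finset.sum_comm]
  refine Finset.sum_congr rfl fun i _ => Finset.sum_congr rfl fun l _ => ?_
  rw [P.Γ_symm l l i]
  ring

end FrameBundle

noncomputable section Coordinates

open smoothFunctions
open scoped ContDiff

variable {n : ℕ} {U : Set (Fin n → ℝ)}

lemma eval_coordDeriv (hU : IsOpen U) (k : Fin n) (u : smoothFunctions U)
    {f : (Fin n → ℝ) → ℝ} (hf : ∀ x : U, f x = eval x u) (x : U) :
    pd k f x = eval x (coordDeriv hU k u) := (eval_dirDeriv hU _ u hf x).symm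

/-- The matrix of smooth functions given by a smooth field of matrices. -/
def smoothMatrix (M : (Fin n → ℝ) → Matrix (Fin n) (Fin n) ℝ)
    (hM : ∀ i j, ContDiffOn ℝ ∞ (fun x => M x i j) U) :
    Matrix (Fin n) (Fin n) (smoothFunctions U) := Matrix.of fun i j => mk _ (hM i j)

/-- A field of matrices on `U` given by a matrix of smooth functions. -/
def FieldOf (M : Matrix (Fin n) (Fin n) (smoothFunctions U))
    (F : (Fin n → ℝ) → Matrix (Fin n) (Fin n) ℝ) : Prop := ∀ x : U, F x = M.map (eval x)

lemma fieldOf_smoothMatrix (M : (Fin n → ℝ) → Matrix (Fin n) (Fin n) ℝ)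
    (hM : ∀ i j, ContDiffOn ℝ ∞ (fun x => M x i j) U) : FieldOf (smoothMatrix M hM) M :=
  fun _ => rfl

namespace FieldOf

variable {M N : Matrix (Fin n) (Fin n) (smoothFunctions U)}
  {F G : (Fin n → ℝ) → Matrix (Fin n) (Fin n) ℝ}

lemma apply (h : FieldOf M F) (i j : Fin n) (x : U) : F x i j = eval x (M i j) := by
  rw [h x]
  rfl

lemma mul (h : FieldOf M F) (h' : FieldOf N G) : FieldOf (M * N) fun x => F x * G x := fun x => by
  dsimp only
  rw [h x, h' x, Matrix.map_mul]

lemma sub (h : FieldOf M F) (h' : FieldOf N G) : FieldOf (M - N) fun x => F x - G x := fun x => by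
  dsimp only
  rw [h x, h' x, Matrix.map_sub _ (map_sub _)]

lemma det (h : FieldOf M F) (x : U) : (F x).det = eval x M.det := by
  rw [h x, RingHom.map_det]
  rfl

lemma isUnit_det (h : FieldOf M F) (hF : ∀ x ∈ U, IsUnit (F x).det) : IsUnit M.det :=
  isUnit_of_eval_ne_zero fun x => by
    rw [← h.det]
    exact (hF x x.2).ne_zero

lemma inv (h : FieldOf M F) (hF : ∀ x ∈ U, IsUnit (F x).det) : FieldOf M⁻¹ fun x => (F x)⁻¹ :=
  fun x => by
    dsimp only
    rw [h x, Matrix.map_nonsing_inv _ (h.isUnit_det hF)]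

lemma transpose_eq (h : FieldOf M F) (hF : ∀ x ∈ U, (F x).IsSymm) : Mᵀ = M := by
  ext i j x
  rw [Matrix.transpose_apply, ← h.apply, ← h.apply]
  exact (hF x x.2).apply i j

lemma pd_apply (h : FieldOf M F) (hU : IsOpen U) (k i j : Fin n) (x : U) :
    pd k (fun y => F y i j) x = eval x (coordDeriv hU k (M i j)) :=
  eval_coordDeriv hU k (M i j) (h.apply i j) x

end FieldOf

variable (hU : IsOpen U) {g A : (Fin n → ℝ) → Matrix (Fin n) (Fin n) ℝ}
  {G M : Matrix (Fin n) (Fin n) (smoothFunctions U)}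

lemma Gamma_eq_eval (hG : FieldOf G g) (hg : ∀ x ∈ U, IsUnit (g x).det) (k i j : Fin n) (x : U) :
    Gamma g k i j x = eval x (christoffel (coordDeriv hU) G G⁻¹ i k j) := by
  simp only [Gamma, christoffel, Matrix.of_apply, eval_smul, map_sum, map_mul, map_add, map_sub,
    (hG.inv hg).apply, hG.pd_apply hU]

variable (hGs : Gᵀ = G) (hGd : IsUnit G.det)

lemma Ricci_eq_eval (hG : FieldOf G g) (hg : ∀ x ∈ U, IsUnit (g x).det) (i j : Fin n) (x : U) :
    Ricci g i j x = eval x ((metricFrameBundle hU G hGs hGd).ricci i j) := by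
  have h1 := Gamma_eq_eval hU hG hg
  have h2 : ∀ l k i j, pd l (fun y => Gamma g k i j y) x =
      eval x (coordDeriv hU l (christoffel (coordDeriv hU) G G⁻¹ i k j)) := fun l k i j =>
    eval_coordDeriv hU l _ (h1 k i j) x
  have h3 := christoffel_symm (coordDeriv hU) (h := G⁻¹) hGs
  simp only [Ricci, h1, h2, FrameBundle.ricci, FrameBundle.curv, metricFrameBundle,
    Matrix.of_apply, Matrix.sub_apply, Matrix.add_apply, Matrix.map_apply, Matrix.mul_apply,
    map_sum, map_sub, map_add, map_mul, Finset.sum_add_distrib, Finset.sum_sub_distrib]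
  ring

lemma fieldOf_ricci (hG : FieldOf G g) (hg : ∀ x ∈ U, IsUnit (g x).det) :
    FieldOf (metricFrameBundle hU G hGs hGd).ricci fun x => Matrix.of fun i j => Ricci g i j x :=
  fun x => Matrix.ext fun i j => Ricci_eq_eval hU hGs hGd hG hg i j x

lemma divMixed_eq_eval (hG : FieldOf G g) (hg : ∀ x ∈ U, IsUnit (g x).det) (hM : FieldOf M A)
    (j : Fin n) (x : U) :
    (∑ i, pd i (fun y => A y i j) x) + (∑ i, ∑ s, Gamma g i i s x * A x s j) -
      ∑ i, ∑ s, Gamma g s i j x * A x i s =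
    eval x ((metricFrameBundle hU G hGs hGd).divMixed M j) := by
  simp only [Gamma_eq_eval hU hG hg, hM.apply, hM.pd_apply hU, FrameBundle.divMixed,
    metricFrameBundle, map_sum, map_add, map_sub, map_mul]

lemma assocOp_eq_eval (hG : FieldOf G g) (hg : ∀ x ∈ U, IsUnit (g x).det) (hM : FieldOf M A)
    {f : (Fin n → ℝ) → ℝ} {u : smoothFunctions U} (hf : ∀ x : U, f x = eval x u) (x : U) :
    assocOp g A f x = eval x ((metricFrameBundle hU G hGs hGd).op M u) := by
  have h0 : ∀ x : U, eval x G.det ≠ 0 := fun x => by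
    rw [← hG.det]
    exact (hg x x.2).ne_zero
  have h1 : ContDiffOn ℝ ∞ (fun y => |extension G.det y| ^ ((1 : ℝ) / 2)) U := by
    have h2 : ∀ y ∈ U, extension G.det y ≠ 0 := fun y hy => by
      rw [extension_apply G.det ⟨y, hy⟩]
      exact h0 _
    refine ContDiffOn.rpow_const_of_ne (fun y hy => ?_) fun y hy => abs_ne_zero.2 (h2 y hy)
    exact (contDiffAt_abs (h2 y hy)).comp_contDiffWithinAt y (contDiffOn_extension _ y hy)
  let w : smoothFunctions U := mk _ h1
  have hwe : ∀ x, eval x w = |eval x G.det| ^ ((1 : ℝ) / 2) := fun x => by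
    rw [eval_mk, extension_apply]
  have hw : IsUnit w := isUnit_of_eval_ne_zero fun x => by
    rw [hwe]
    exact (Real.rpow_pos_of_pos (abs_pos.2 (h0 x)) _).ne'
  have hwg : w ^ 4 = (metricFrameBundle hU G hGs hGd).g.det ^ 2 := by
    ext x
    change eval x (w ^ 4) = eval x (G.det ^ 2)
    rw [map_pow, map_pow, hwe, ← Real.rpow_natCast, ← Real.rpow_mul (abs_nonneg _),
      ← sq_abs (eval x G.det), ← Real.rpow_natCast]
    norm_num
  have h3 := congrArg (eval x) ((metricFrameBundle hU G hGs hGd).density_mul_div hw hwg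
    fun i => ∑ j, M i j * coordDeriv hU j u)
  have h4 : ∀ i j, pd i (fun y => |(g y).det| ^ ((1 : ℝ) / 2) * A y i j * pd j f y) x =
      eval x (coordDeriv hU i (w * M i j * coordDeriv hU j u)) := fun i j =>
    eval_coordDeriv hU i _ (fun y => by
      rw [map_mul, map_mul, hwe, hG.det, hM.apply, eval_coordDeriv hU j u hf]) x
  simp only [assocOp, h4]
  simp only [Finset.mul_sum, map_sum, ← mul_assoc] at h3
  change eval x (w * (metricFrameBundle hU G hGs hGd).op M u) =
    ∑ i, ∑ j, eval x (coordDeriv hU i (w * M i j * coordDeriv hU j u)) at h3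
  rw [← h3, map_mul, hwe, hG.det, ← mul_assoc, ← Real.rpow_add (abs_pos.2 (h0 x))]
  norm_num

end Coordinates

section IteratedDerivations

variable {ι B : Type*} [CommRing B] [Algebra ℝ B] (D : ι → Derivation ℝ B B)

/-- Iterated derivations along a word. -/
def iterDeriv : List ι → B →ₗ[ℝ] B
  | [] => LinearMap.id
  | i :: l => (D i).toLinearMap ∘ₗ iterDeriv l

lemma iterDeriv_append_singleton (l : List ι) (i : ι) (u : B) :
    iterDeriv D (l ++ [i]) u = iterDeriv D l (D i u) := by
  induction l with
  | nil => rfl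
  | cons j l ih => exact congrArg (D j) ih

/-- The elements whose derivatives of order at most `k` are in the kernel of `ε` are closed under
multiplication by arbitrary elements. -/
lemma map_iterDeriv_mul_eq_zero {C : Type*} [CommRing C] (ε : B →+* C) (l : List ι) {k : ℕ}
    (hl : l.length ≤ k) {u : B} (hu : ∀ l' : List ι, l'.length ≤ k → ε (iterDeriv D l' u) = 0)
    (v : B) : ε (iterDeriv D l (u * v)) = 0 := by
  induction l using List.reverseRecOn generalizing u v k with
  | nil =>
    have := hu [] (Nat.zero_le _)
    simp only [iterDeriv, LinearMap.id_apply] at this ⊢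
    rw [map_mul, this, zero_mul]
  | append_singleton l i ih =>
    rw [List.length_append, List.length_singleton] at hl
    obtain ⟨k, rfl⟩ : ∃ m, k = m + 1 := ⟨k - 1, by lia⟩
    rw [iterDeriv_append_singleton, Derivation.leibniz, map_add, map_add, smul_eq_mul, smul_eq_mul,
      mul_comm v, ih (by lia) hu, ih (k := k) (by lia), zero_add]
    intro l' h'
    rw [← iterDeriv_append_singleton]
    exact hu _ (by simpa using h')

end IteratedDerivations

section Vanishing

open smoothFunctions

variable {n : ℕ} {U : Set (Fin n → ℝ)}

lemma iterPD_eq_eval (hU : IsOpen U) {f : (Fin n → ℝ) → ℝ} {u : smoothFunctions U}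
    (hf : ∀ x : U, f x = eval x u) (l : List (Fin n)) (x : U) :
    iterPD l f x = eval x (iterDeriv (coordDeriv hU) l u) := by
  induction l generalizing x with
  | nil => exact hf x
  | cons i l ih => exact eval_coordDeriv hU i _ ih x

lemma vanishUpTo_iff (hU : IsOpen U) {f : (Fin n → ℝ) → ℝ} {u : smoothFunctions U}
    (hf : ∀ x : U, f x = eval x u) (k : ℕ) (x : U) :
    VanishUpTo k f x ↔
      ∀ l : List (Fin n), l.length ≤ k → eval x (iterDeriv (coordDeriv hU) l u) = 0 := by
  simp only [VanishUpTo, iterPD_eq_eval hU hf]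

variable {g K : (Fin n → ℝ) → Matrix (Fin n) (Fin n) ℝ}

/-- The commutator of the quantized Killing tensor and the Laplacian vanishes to the order of
Carter's obstruction, given the Killing equation in coordinates. -/
theorem vanishUpTo_commutator (hU : IsOpen U) (hg : IsMetricOn U g)
    (hKs : ∀ i j : Fin n, ContDiffOn ℝ (⊤ : ℕ∞) (fun x => K x i j) U)
    (hKsym : ∀ x ∈ U, (K x).IsSymm)
    (hK : ∀ x ∈ U, ∀ i j k, covDeriv2 g K k i j x + covDeriv2 g K i j k x
      + covDeriv2 g K j k i x = 0)
    (k : ℕ) {p : Fin n → ℝ} (hp : p ∈ U) {C : (Fin n → ℝ) → Matrix (Fin n) (Fin n) ℝ}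
    (hC : C = fun x => ((g x)⁻¹ * Matrix.of fun a b => Ricci g a b x) * ((g x)⁻¹ * K x) -
            ((g x)⁻¹ * K x) * ((g x)⁻¹ * Matrix.of fun a b => Ricci g a b x))
    (hD : ∀ j : Fin n, VanishUpTo k (fun x => (∑ i, pd i (fun y => C y i j) x) +
      (∑ i, ∑ s, Gamma g i i s x * C x s j) - ∑ i, ∑ s, Gamma g s i j x * C x i s) p)
    {f : (Fin n → ℝ) → ℝ} (hf : ContDiffOn ℝ (⊤ : ℕ∞) f U) :
    VanishUpTo k (fun x => LaplaceOp g (assocOp g (fun y => (g y)⁻¹ * K y * (g y)⁻¹) f) x -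
      assocOp g (fun y => (g y)⁻¹ * K y * (g y)⁻¹) (LaplaceOp g f) x) p := by
  set G := smoothMatrix g hg.smooth
  set L := smoothMatrix K hKs
  have hG : FieldOf G g := fieldOf_smoothMatrix g hg.smooth
  have hL : FieldOf L K := fieldOf_smoothMatrix K hKs
  have hGd := hG.isUnit_det hg.nondeg
  have hGs := hG.transpose_eq hg.symm
  set P := metricFrameBundle hU G hGs hGd with hP
  have hGi := hG.inv hg.nondeg
  have hM := (hGi.mul hL).mul hGi
  have hop := fun {A} {M} (hM : FieldOf M A) {f} {u} (hf) x =>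
    assocOp_eq_eval hU hGs hGd hG hg.nondeg hM (f := f) (u := u) hf x
  have hR := fieldOf_ricci hU hGs hGd hG hg.nondeg
  have hCa : FieldOf (P.carter L) C := by
    rw [hC]
    exact ((hGi.mul hR).mul (hGi.mul hL)).sub ((hGi.mul hL).mul (hGi.mul hR))
  set u : smoothFunctions U := mk f hf
  have hu : ∀ x : U, f x = eval x u := fun _ => rfl
  have hcov : ∀ k i j (x : U), covDeriv2 g K k i j x = eval x (P.covLow L k i j) := fun k i j x => by
    simp only [covDeriv2, Gamma_eq_eval hU hG hg.nondeg, hL.apply, hL.pd_apply hU,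
      FrameBundle.covLow, hP, metricFrameBundle, Matrix.sub_apply, Matrix.map_apply,
      Matrix.mul_apply, Matrix.transpose_apply, map_sub, map_sum, map_mul]
    congr 1
    exact Finset.sum_congr rfl fun _ _ => mul_comm _ _
  have key := P.φ_commutator (hL.transpose_eq hKsym) (fun i j k => by
    ext x
    rw [map_add, map_add, ← hcov, ← hcov, ← hcov, hK x x.2, map_zero]) u
  replace key := framePullback_injective key
  have hcomm : ∀ x : U, LaplaceOp g (assocOp g (fun y => (g y)⁻¹ * K y * (g y)⁻¹) f) x -
      assocOp g (fun y => (g y)⁻¹ * K y * (g y)⁻¹) (LaplaceOp g f) x =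
      eval x (P.op P.h (P.op (P.h * L * P.h) u) - P.op (P.h * L * P.h) (P.op P.h u)) := fun x => by
    rw [map_sub]
    exact congrArg₂ _ (hop hGi (hop hM hu) x) (hop hM (hop hGi hu) x)
  have hD' := fun j => (vanishUpTo_iff hU
    (divMixed_eq_eval hU hGs hGd hG hg.nondeg hCa j) k ⟨p, hp⟩).1 (hD j)
  rw [vanishUpTo_iff hU hcomm k ⟨p, hp⟩]
  intro l hl
  have h3 := congrArg (fun z => eval (⟨p, hp⟩ : U) (iterDeriv (coordDeriv hU) l z)) key
  have h4 : eval (⟨p, hp⟩ : U) (iterDeriv (coordDeriv hU) l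
      (-2 * ∑ j, ∑ k, P.divMixed (P.carter L) j * (P.h j k * P.D k u))) = 0 := by
    rw [show ∀ z : smoothFunctions U, -2 * z = (-2 : ℝ) • z from fun z => by
      rw [Algebra.smul_def, map_neg, map_ofNat]]
    simp only [map_smul, map_sum, eval_smul]
    rw [Finset.sum_eq_zero, mul_zero]
    exact fun j _ => Finset.sum_eq_zero fun k _ => map_iterDeriv_mul_eq_zero _ _ _ hl (hD' j) _
  rw [h4, show ∀ z : smoothFunctions U, 3 * z = (3 : ℝ) • z from fun z => by
      rw [Algebra.smul_def, map_ofNat],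
    map_smul, eval_smul] at h3
  simpa using h3

end Vanishing

section Polarization

variable {ι R : Type*} [Fintype ι] [CommRing R] {T : ι → ι → ι → R}

lemma polarize_cubic_form (h : ∀ v : ι → R, ∑ k, ∑ i, ∑ j, T k i j * v k * v i * v j = 0)
    (a b c : ι → R) :
    ∑ k, ∑ i, ∑ j, T k i j * a k * b i * c j + ∑ k, ∑ i, ∑ j, T k i j * a k * c i * b j +
    ∑ k, ∑ i, ∑ j, T k i j * b k * a i * c j + ∑ k, ∑ i, ∑ j, T k i j * b k * c i * a j +
    ∑ k, ∑ i, ∑ j, T k i j * c k * a i * b j + ∑ k, ∑ i, ∑ j, T k i j * c k * b i * a j = 0 := by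
  have ha := h a
  have hb := h b
  have hc := h c
  have hab := h (a + b)
  have hac := h (a + c)
  have hbc := h (b + c)
  have habc := h (a + b + c)
  simp only [Pi.add_apply, mul_add, add_mul, Finset.sum_add_distrib] at hab hac hbc habc
  linear_combination habc - hab - hac - hbc + ha + hb + hc

lemma cyclic_sum_eq_zero_of_cubic_form [DecidableEq ι] [NoZeroDivisors R] [CharZero R]
    (hT : ∀ k i j, T k i j = T k j i)
    (h : ∀ v : ι → R, ∑ k, ∑ i, ∑ j, T k i j * v k * v i * v j = 0) (i j k : ι) :
    T k i j + T i j k + T j k i = 0 := by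
  have h1 := polarize_cubic_form h (Pi.single k 1) (Pi.single i 1) (Pi.single j 1)
  simp only [Pi.single_apply, mul_ite, mul_one, mul_zero, Finset.sum_ite_eq', Finset.mem_univ,
    if_true] at h1
  rw [hT k j i, hT i k j, hT j i k] at h1
  have h2 : (2 : R) * (T k i j + T i j k + T j k i) = 0 := by linear_combination h1
  exact (mul_eq_zero.1 h2).resolve_left two_ne_zero

end Polarization

noncomputable section Geodesics

open smoothFunctions
open scoped ContDiff

variable {n : ℕ} {U : Set (Fin n → ℝ)} {g K : (Fin n → ℝ) → Matrix (Fin n) (Fin n) ℝ}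

lemma contDiffOn_Gamma (hU : IsOpen U) (hg : IsMetricOn U g) (k i j : Fin n) :
    ContDiffOn ℝ ∞ (Gamma g k i j) U :=
  (contDiffOn_extension _).congr fun x hx =>
    (Gamma_eq_eval hU (fieldOf_smoothMatrix g hg.smooth) hg.nondeg k i j ⟨x, hx⟩).trans
      (extension_apply _ ⟨x, hx⟩).symm

/-- The geodesic vector field on the tangent bundle. -/
def geodesicField (g : (Fin n → ℝ) → Matrix (Fin n) (Fin n) ℝ)
    (q : (Fin n → ℝ) × (Fin n → ℝ)) : (Fin n → ℝ) × (Fin n → ℝ) :=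
  (q.2, fun k => -∑ i, ∑ j, Gamma g k i j q.1 * q.2 i * q.2 j)

lemma contDiffOn_geodesicField (hU : IsOpen U) (hg : IsMetricOn U g) :
    ContDiffOn ℝ ∞ (geodesicField g) (U ×ˢ Set.univ) := by
  have h1 : ∀ i, ContDiffOn ℝ ∞ (fun q : (Fin n → ℝ) × (Fin n → ℝ) => q.2 i) (U ×ˢ Set.univ) :=
    fun i => ((contDiff_apply ℝ ℝ i).comp contDiff_snd).contDiffOn
  refine contDiff_snd.contDiffOn.prodMk (contDiffOn_pi.2 fun k => ContDiffOn.neg ?_)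
  refine ContDiffOn.sum fun i _ => ContDiffOn.sum fun j _ => ContDiffOn.mul (.mul ?_ (h1 i)) (h1 j)
  exact (contDiffOn_Gamma hU hg k i j).comp contDiff_fst.contDiffOn fun q hq => hq.1

/-- Local existence of geodesics. -/
lemma exists_geodesic (hU : IsOpen U) (hg : IsMetricOn U g) {x : Fin n → ℝ} (hx : x ∈ U)
    (v : Fin n → ℝ) : ∃ (α : ℝ → (Fin n → ℝ) × (Fin n → ℝ)) (δ : ℝ), 0 < δ ∧ α 0 = (x, v) ∧
      (∀ t ∈ Set.Ioo (-δ) δ, HasDerivAt α (geodesicField g (α t)) t) ∧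
      (∀ t ∈ Set.Ioo (-δ) δ, ∀ i, deriv (fun s => (α s).1 i) t = (α t).2 i) ∧
      IsGeodesicOn U g (fun t => (α t).1) (Set.Ioo (-δ) δ) := by
  have hO : IsOpen (U ×ˢ (Set.univ : Set (Fin n → ℝ))) := hU.prod isOpen_univ
  have hF := contDiffOn_geodesicField hU hg
  have hxv : (x, v) ∈ U ×ˢ (Set.univ : Set (Fin n → ℝ)) := ⟨hx, trivial⟩
  obtain ⟨α, h0, ε, hε, hα⟩ :=
    ((hF.contDiffAt (hO.mem_nhds hxv)).of_le (m := 1) (by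
      exact WithTop.coe_le_coe.2 (le_top : (1 : ℕ∞) ≤ ⊤)
      )).exists_forall_mem_closedBall_exists_eq_forall_mem_Ioo_hasDerivAt₀ 0
  rw [zero_sub, zero_add] at hα
  have h1 : ∀ᶠ t in nhds (0 : ℝ), α t ∈ U ×ˢ (Set.univ : Set (Fin n → ℝ)) :=
    (hα 0 ⟨by linarith, hε⟩).continuousAt.eventually_mem (by rw [h0]; exact hO.mem_nhds hxv)
  obtain ⟨r, hr, hball⟩ := Metric.eventually_nhds_iff.1 h1
  set δ := min r ε / 2
  have hδ : 0 < δ := half_pos (lt_min hr hε)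
  have hδr : δ < r := (half_lt_self (lt_min hr hε)).trans_le (min_le_left _ _)
  have hδε : δ < ε := (half_lt_self (lt_min hr hε)).trans_le (min_le_right _ _)
  have hmem : ∀ t ∈ Set.Icc (-δ) δ, α t ∈ U ×ˢ (Set.univ : Set (Fin n → ℝ)) := fun t ht => by
    refine hball ?_
    rw [Real.dist_0_eq_abs, abs_lt]
    exact ⟨by linarith [ht.1], by linarith [ht.2]⟩
  have hder : ∀ t ∈ Set.Icc (-δ) δ, HasDerivAt α (geodesicField g (α t)) t := fun t ht =>
    hα t ⟨by linarith [ht.1], by linarith [ht.2]⟩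
  have hsmooth : ContDiffOn ℝ ∞ α (Set.Icc (-δ) δ) :=
    ODE.contDiffOn_enat_Icc_of_hasDerivWithinAt (f := fun _ => geodesicField g)
      (u := U ×ˢ Set.univ) (hF.comp contDiff_snd.contDiffOn fun q hq => hq.2)
      (fun t ht => (hder t ht).hasDerivWithinAt) hmem
  have hfst : ∀ t ∈ Set.Icc (-δ) δ, ∀ i, HasDerivAt (fun s => (α s).1 i) ((α t).2 i) t :=
    fun t ht i => hasDerivAt_pi.1 (hder t ht).fst i
  have hsnd : ∀ t ∈ Set.Icc (-δ) δ, ∀ i,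
      HasDerivAt (fun s => (α s).2 i) ((geodesicField g (α t)).2 i) t :=
    fun t ht i => hasDerivAt_pi.1 (hder t ht).snd i
  have hsub : Set.Ioo (-δ) δ ⊆ Set.Icc (-δ) δ := Set.Ioo_subset_Icc_self
  refine ⟨α, δ, hδ, h0, fun t ht => hder t (hsub ht), fun t ht i => (hfst t (hsub ht) i).deriv,
    ⟨isOpen_Ioo, Set.ordConnected_Ioo⟩, fun k => ?_, fun t ht => (hmem t (hsub ht)).1,
    fun t ht k => ?_⟩
  · exact ((contDiff_apply ℝ ℝ k).comp contDiff_fst).comp_contDiffOn (hsmooth.mono hsub)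
  · have h2 : deriv (fun s => (α s).1 k) =ᶠ[nhds t] fun s => (α s).2 k := by
      filter_upwards [isOpen_Ioo.mem_nhds ht] with s hs using (hfst s (hsub hs) k).deriv
    rw [h2.deriv_eq, (hsnd t (hsub ht) k).deriv]
    simp only [(hfst t (hsub ht) _).deriv, geodesicField]
    exact neg_add_cancel _

lemma fderiv_apply_eq_sum_pd (f : (Fin n → ℝ) → ℝ) (x v : Fin n → ℝ) :
    fderiv ℝ f x v = ∑ k, v k * pd k f x := by
  have h : v = ∑ k, v k • (Pi.single k 1 : Fin n → ℝ) := by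
    ext
    simp [Finset.sum_apply, Pi.single_apply]
  conv_lhs => rw [h]
  simp only [map_sum, map_smul, smul_eq_mul, pd]

/-- The Killing equation in coordinates. -/
lemma IsKillingTensorOn.covDeriv2_cyclic (hU : IsOpen U) (hg : IsMetricOn U g)
    (hKs : ∀ i j : Fin n, ContDiffOn ℝ ∞ (fun x => K x i j) U)
    (hKsym : ∀ x ∈ U, (K x).IsSymm) (hK : IsKillingTensorOn U g K) {x : Fin n → ℝ} (hx : x ∈ U)
    (i j k : Fin n) :
    covDeriv2 g K k i j x + covDeriv2 g K i j k x + covDeriv2 g K j k i x = 0 := by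
  have hs : ∀ i j, K x i j = K x j i := fun i j => ((hKsym x hx).apply i j).symm
  have hpd : ∀ k i j, pd k (fun y => K y i j) x = pd k (fun y => K y j i) x := fun k i j =>
    DFunLike.congr_fun (fderiv_congr hU (fun y hy => ((hKsym y hy).apply i j).symm) hx) _
  have hΓ : ∀ s i j, Gamma g s i j x = Gamma g s j i x := fun s i j => by
    have hG := fieldOf_smoothMatrix g hg.smooth
    have h1 := Gamma_eq_eval hU hG hg.nondeg
    rw [h1 s i j ⟨x, hx⟩, h1 s j i ⟨x, hx⟩, christoffel_symm _ (hG.transpose_eq hg.symm)]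
  refine cyclic_sum_eq_zero_of_cubic_form (T := fun k i j => covDeriv2 g K k i j x)
    (fun k i j => ?_) (fun v => ?_) i j k
  · simp only [covDeriv2, hpd k i j, fun s => hs s j, fun s => hs s i]
    ring
  obtain ⟨α, δ, hδ, h0, hα, hd, hgeo⟩ := exists_geodesic hU hg hx v
  have h0m : (0 : ℝ) ∈ Set.Ioo (-δ) δ := ⟨neg_lt_zero.2 hδ, hδ⟩
  have hα0 := hα 0 h0m
  set a : Fin n → ℝ := fun k => -∑ i, ∑ j, Gamma g k i j x * v i * v j with ha
  have hF : geodesicField g (α 0) = (v, a) := by rw [h0]; rfl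
  rw [hF] at hα0
  have hv : ∀ i, HasDerivAt (fun s => (α s).2 i) (a i) 0 := hasDerivAt_pi.1 hα0.snd
  have hKd : ∀ i j, HasDerivAt (fun s => K (α s).1 i j) (∑ k, v k * pd k (fun y => K y i j) x) 0 :=
    fun i j => by
      rw [← fderiv_apply_eq_sum_pd]
      have h1 : HasFDerivAt (fun y => K y i j) (fderiv ℝ (fun y => K y i j) x) (α 0).1 := by
        rw [h0]
        exact (differentiableAt_of_contDiffOn hU (hKs i j) hx).hasFDerivAt
      exact h1.comp_hasDerivAt 0 hα0.fst
  have hq : HasDerivAt (fun s => ∑ i, ∑ j, (α s).2 i * K (α s).1 i j * (α s).2 j)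
      (∑ i, ∑ j, ((a i * K x i j + v i * ∑ k, v k * pd k (fun y => K y i j) x) * v j
        + v i * K x i j * a j)) 0 := by
    refine HasDerivAt.fun_sum fun i _ => HasDerivAt.fun_sum fun j _ => ?_
    have := ((hv i).fun_mul (hKd i j)).fun_mul (hv j)
    simpa only [h0] using this
  have hc : (fun s => ∑ i, ∑ j, (α s).2 i * K (α s).1 i j * (α s).2 j) =ᶠ[nhds 0]
      fun _ => ∑ i, ∑ j, v i * K x i j * v j := by
    filter_upwards [isOpen_Ioo.mem_nhds h0m] with s hs
    have := hK _ _ hgeo s hs 0 h0m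
    simp only [hd s hs, hd 0 h0m] at this
    rw [this, h0]
  have hz := hq.unique ((hasDerivAt_const (0 : ℝ) _).congr_of_eventuallyEq hc)
  rw [← hz]
  have e1 : ∑ i, ∑ j, a i * K x i j * v j =
      -∑ k, ∑ i, ∑ j, (∑ s, Gamma g s k i x * K x s j) * v k * v i * v j := by
    simp only [ha, neg_mul, Finset.sum_neg_distrib, Finset.sum_mul]
    rw [neg_inj, eq_comm]
    calc _ = ∑ k, ∑ i, ∑ s, ∑ j, Gamma g s k i x * K x s j * v k * v i * v j :=
          Finset.sum_congr rfl fun _ _ => Finset.sum_congr rfl fun _ _ => Finset.sum_comm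
      _ = ∑ k, ∑ s, ∑ i, ∑ j, Gamma g s k i x * K x s j * v k * v i * v j :=
          Finset.sum_congr rfl fun _ _ => Finset.sum_comm
      _ = ∑ s, ∑ k, ∑ i, ∑ j, Gamma g s k i x * K x s j * v k * v i * v j := Finset.sum_comm
      _ = ∑ s, ∑ j, ∑ k, ∑ i, Gamma g s k i x * K x s j * v k * v i * v j :=
          Finset.sum_congr rfl fun _ _ => Finset.sum_comm_cycle
      _ = _ := by
        refine Finset.sum_congr rfl fun _ _ => Finset.sum_congr rfl fun _ _ =>
          Finset.sum_congr rfl fun _ _ => Finset.sum_congr rfl fun _ _ => ?_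
        ring
  have e2 : ∑ i, ∑ j, v i * K x i j * a j =
      -∑ k, ∑ i, ∑ j, (∑ s, Gamma g s k j x * K x i s) * v k * v i * v j := by
    simp only [ha, mul_neg, Finset.sum_neg_distrib, Finset.sum_mul, Finset.mul_sum]
    rw [neg_inj, eq_comm, Finset.sum_comm]
    refine Finset.sum_congr rfl fun _ _ => ?_
    rw [Finset.sum_comm_cycle]
    refine Finset.sum_congr rfl fun _ _ => Finset.sum_congr rfl fun _ _ =>
      Finset.sum_congr rfl fun _ _ => ?_
    ring
  have e3 : ∑ i, ∑ j, v i * (∑ k, v k * pd k (fun y => K y i j) x) * v j =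
      ∑ k, ∑ i, ∑ j, pd k (fun y => K y i j) x * v k * v i * v j := by
    simp only [Finset.mul_sum, Finset.sum_mul]
    rw [Finset.sum_comm_cycle]
    refine Finset.sum_congr rfl fun _ _ => Finset.sum_congr rfl fun _ _ =>
      Finset.sum_congr rfl fun _ _ => ?_
    ring
  simp only [add_mul, Finset.sum_add_distrib, e1, e2, e3, covDeriv2, sub_mul,
    Finset.sum_sub_distrib]
  ring

end Geodesics

theorem carter_condition_pointwise {n : ℕ} (hn : 2 ≤ n) (U : Set (Fin n → ℝ)) (hUo : IsOpen U) (hUc : IsConnected U)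
    (g : (Fin n → ℝ) → Matrix (Fin n) (Fin n) ℝ) (hg : IsMetricOn U g)
    (K : (Fin n → ℝ) → Matrix (Fin n) (Fin n) ℝ)
    (hKs : ∀ i j : Fin n, ContDiffOn ℝ (⊤ : ℕ∞) (fun x => K x i j) U)
    (hKsym : ∀ x ∈ U, (K x).IsSymm)
    (hK : IsKillingTensorOn U g K)
    (k : ℕ) (p : Fin n → ℝ) (hp : p ∈ U)
    (hD : ∀ j : Fin n, VanishUpTo k (fun x =>
      (∑ i, pd i (fun y =>
          (((g y)⁻¹ * Matrix.of fun a b => Ricci g a b y) * ((g y)⁻¹ * K y) -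
            ((g y)⁻¹ * K y) * ((g y)⁻¹ * Matrix.of fun a b => Ricci g a b y)) i j) x) +
        (∑ i, ∑ s, Gamma g i i s x *
          (((g x)⁻¹ * Matrix.of fun a b => Ricci g a b x) * ((g x)⁻¹ * K x) -
            ((g x)⁻¹ * K x) * ((g x)⁻¹ * Matrix.of fun a b => Ricci g a b x)) s j) -
        ∑ i, ∑ s, Gamma g s i j x *
          (((g x)⁻¹ * Matrix.of fun a b => Ricci g a b x) * ((g x)⁻¹ * K x) -
            ((g x)⁻¹ * K x) * ((g x)⁻¹ * Matrix.of fun a b => Ricci g a b x)) i s) p) :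
    ∀ f : (Fin n → ℝ) → ℝ, ContDiffOn ℝ (⊤ : ℕ∞) f U →
      VanishUpTo k (fun x =>
        LaplaceOp g (assocOp g (fun y => (g y)⁻¹ * K y * (g y)⁻¹) f) x -
          assocOp g (fun y => (g y)⁻¹ * K y * (g y)⁻¹) (LaplaceOp g f) x) p := by
  exact fun f hf => vanishUpTo_commutator hUo hg hKs hKsym
    (fun x hx i j k => hK.covDeriv2_cyclic hUo hg hKs hKsym hx i j k) k hp rfl hD hf
end
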